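/- Let ℓ ≠ p be primes, k an algebraic closure of a finite field of characteristic p, and K|k a function field with td(K|k) = d > 1. Let Z ⊆ G^ℓ_K be a divisorial like subgroup, i.e., a closed subgroup which is isomorphic as a topological group to a divisorial subgroup of G^ℓ_{K₁} for some function field K₁|k₁ with td(K₁|k₁) = d and k₁ an algebraic closure of a finite field. Then: (1) there exists a unique Zariski prime divisor v of K^ℓ (a valuation of K^ℓ whose restriction to K is a Zariski prime divisor of K|k) such that Z is contained in the decomposition group Z_v of v in G^ℓ_K and the residue field of v has characteristic ≠ ℓ; and (2) the unique maximal closed abelian normal subgroup T of Z satisfies T = Z ∩ T_v, where T_v is the inertia subgroup of Z_v. -/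

import Mathlib

open IntermediateField

/-- Transcendence degree of a ring extension. -/
noncomputable def trdeg (k K : Type*) [CommRing k] [CommRing K] [Algebra k K] : Cardinal :=
  ⨆ s : {s : Set K // AlgebraicIndependent k ((↑) : s → K)}, Cardinal.mk s.1

/-- The maximal pro-ℓ Galois extension of `K`, inside a fixed algebraic closure: the compositum
of all finite Galois extensions of `K` of `ℓ`-power degree. -/
noncomputable def proL (ℓ : ℕ) (K : Type*) [Field K] :
    IntermediateField K (AlgebraicClosure K) :=
  ⨆ L ∈ {L : IntermediateField K (AlgebraicClosure K) |
      IsGalois K L ∧ ∃ n : ℕ, Module.finrank K L = ℓ ^ n}, L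

/-- `G^ℓ_K`, the Galois group of the maximal pro-ℓ extension of `K`,
carrying the Krull topology. -/
noncomputable abbrev GalL (ℓ : ℕ) (K : Type*) [Field K] :=
  ↥(proL ℓ K) ≃ₐ[K] ↥(proL ℓ K)

section Valuations

variable {F E : Type*} [Field F] [Field E] [Algebra F E]

private theorem aut_apply_inv_apply (a : E ≃ₐ[F] E) (x : E) : a (a⁻¹ x) = x :=
  a.apply_symm_apply x

/-- The decomposition subgroup of a valuation of `E` in the Galois group of `E|F`:
the stabilizer of the valuation ring. -/
def decompSubgroup (O : ValuationSubring E) : Subgroup (E ≃ₐ[F] E) where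
  carrier := {σ | ∀ x : E, σ x ∈ O ↔ x ∈ O}
  one_mem' := by intro x; rfl
  mul_mem' := by
    intro a b ha hb x
    simpa [AlgEquiv.mul_apply] using (ha (b x)).trans (hb x)
  inv_mem' := by
    intro a ha x
    have h := (ha (a⁻¹ x)).symm
    rwa [aut_apply_inv_apply] at h

/-- The inertia subgroup of a valuation of `E` in the Galois group of `E|F`: the elements of
the decomposition group which act trivially on the residue field. -/
def inertiaSubgroup (O : ValuationSubring E) : Subgroup (E ≃ₐ[F] E) where
  carrier := {σ | (∀ x : E, σ x ∈ O ↔ x ∈ O) ∧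
      ∀ x : E, x ∈ O → O.valuation (σ x - x) < 1}
  one_mem' := by
    refine ⟨fun x => Iff.rfl, fun x _ => ?_⟩
    simp
  mul_mem' := by
    rintro a b ⟨had, hai⟩ ⟨hbd, hbi⟩
    refine ⟨fun x => by simpa [AlgEquiv.mul_apply] using (had (b x)).trans (hbd x), ?_⟩
    intro x hx
    have h1 : O.valuation (a (b x) - b x) < 1 := hai (b x) ((hbd x).mpr hx)
    have h2 : O.valuation (b x - x) < 1 := hbi x hx
    have h3 : (a * b) x - x = (a (b x) - b x) + (b x - x) := by
      rw [AlgEquiv.mul_apply]; ring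
    rw [h3]
    exact lt_of_le_of_lt (O.valuation.map_add _ _) (max_lt h1 h2)
  inv_mem' := by
    rintro a ⟨had, hai⟩
    have hdec : ∀ x : E, a⁻¹ x ∈ O ↔ x ∈ O := by
      intro x
      have h := (had (a⁻¹ x)).symm
      rwa [aut_apply_inv_apply] at h
    refine ⟨hdec, ?_⟩
    intro x hx
    have h1 : O.valuation (a (a⁻¹ x) - a⁻¹ x) < 1 := hai _ ((hdec x).mpr hx)
    rw [aut_apply_inv_apply] at h1
    have h3 : a⁻¹ x - x = -(x - a⁻¹ x) := by ring
    rw [h3, Valuation.map_neg]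
    exact h1

end Valuations

section ZPD

variable {k K : Type*} [Field k] [Field K] [Algebra k K]

/-- The canonical map from the base field to the residue field of a valuation subring whose
ring contains the base field. -/
noncomputable def resMap (O : ValuationSubring K)
    (h : ∀ c : k, algebraMap k K c ∈ O) : k →+* IsLocalRing.ResidueField ↥O :=
  (IsLocalRing.residue ↥O).comp ((algebraMap k K).codRestrict O.toSubring h)

/-- A Zariski prime divisor of `K|k`, given by its valuation ring `O`: a nontrivial valuation
of `K`, trivial on `k`, with value group isomorphic to `ℤ`, whose residue field `Kv` satisfies
`td(Kv|k) = td(K|k) - 1`. -/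
structure IsZPD (k : Type*) [Field k] {K : Type*} [Field K] [Algebra k K]
    (O : ValuationSubring K) : Prop where
  trivialBase : ∀ c : k, algebraMap k K c ∈ O
  nontrivial : O ≠ ⊤
  discrete : Nonempty ((O.ValueGroup)ˣ ≃* Multiplicative ℤ)
  residue_td :
    letI := (resMap O trivialBase).toAlgebra
    trdeg k (IsLocalRing.ResidueField ↥O) + 1 = trdeg k K

end ZPD

/-- A divisorial subgroup of `G^ℓ_K`: the decomposition group of a prolongation to `K^ℓ` of a
Zariski prime divisor of `K|k`. -/
noncomputable def IsDivisorialSubgroup (ℓ : ℕ) (k : Type*) (K : Type*) [Field k] [Field K]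
    [Algebra k K] (Z : Subgroup (GalL ℓ K)) : Prop :=
  ∃ O' : ValuationSubring ↥(proL ℓ K),
    IsZPD k (O'.comap (algebraMap K ↥(proL ℓ K))) ∧ Z = decompSubgroup O'

/-- A witness that the topological group `Z` is isomorphic, as a topological group, to a
divisorial subgroup of `G^ℓ_{K₁}` for some function field `K₁|k₁` of transcendence degree `d`
over an algebraic closure `k₁` of a finite field (of characteristic `≠ ℓ`). -/
structure DivisorialLikeWitness.{u, w} (ℓ : ℕ) (Z : Type*) [Group Z] [TopologicalSpace Z]
    (d : Cardinal.{w}) where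
  k₁ : Type u
  K₁ : Type u
  [field_k₁ : Field k₁]
  [field_K₁ : Field K₁]
  [alg : Algebra k₁ K₁]
  p₁ : ℕ
  p₁_prime : p₁.Prime
  p₁_ne : p₁ ≠ ℓ
  algClosed : IsAlgClosed k₁
  charP : CharP k₁ p₁
  over_finite : Algebra.IsAlgebraic (⊥ : Subfield k₁) k₁
  fg : (⊤ : IntermediateField k₁ K₁).FG
  td : Cardinal.lift.{w} (trdeg k₁ K₁) = Cardinal.lift.{u} d
  Z₁ : Subgroup (GalL ℓ K₁)
  divisorial : IsDivisorialSubgroup ℓ k₁ K₁ Z₁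
  e : Z ≃* ↥Z₁
  cont : Continuous e
  cont_symm : Continuous e.symm


set_option linter.unusedSectionVars false

namespace S5
structure RHyp (E : Type*) {Λ W : Type*} [Field Λ] [Field E] [AddCommGroup W] [Module E W]
    (ψ : Λ → W) : Prop where
  mul : ∀ x y, x ≠ 0 → y ≠ 0 → ψ (x * y) = ψ x + ψ y
  one_sub : ∀ x, x ≠ 0 → x ≠ 1 → ψ x ≠ 0 → ∃ c : E, ψ (1 - x) = c • ψ x
section R
variable {E Λ W : Type*} [Field Λ] [Field E] [CharZero E] [AddCommGroup W] [Module E W]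
  {ψ : Λ → W}
theorem RHyp.one (h : RHyp E ψ) : ψ 1 = 0 := by
  have := h.mul 1 1 one_ne_zero one_ne_zero
  simpa using this
theorem RHyp.two_ne (_h : RHyp E ψ) {w : W} (hw : w + w = 0) : w = 0 := by
  have : (2 : E) • w = 0 := by rw [two_smul]; exact hw
  rcases smul_eq_zero.1 this with h | h
  · exact absurd h two_ne_zero
  · exact h
theorem RHyp.neg_one (h : RHyp E ψ) : ψ (-1) = 0 := by
  have := h.mul (-1) (-1) (by simp) (by simp)
  rw [neg_mul_neg, one_mul, h.one] at this
  exact h.two_ne this.symm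
theorem RHyp.neg (h : RHyp E ψ) {x : Λ} (hx : x ≠ 0) : ψ (-x) = ψ x := by
  rw [← neg_one_mul, h.mul _ _ (by simp) hx, h.neg_one, zero_add]
theorem RHyp.inv (h : RHyp E ψ) {x : Λ} (hx : x ≠ 0) : ψ (x⁻¹) = - ψ x := by
  have := h.mul x x⁻¹ hx (inv_ne_zero hx)
  rw [mul_inv_cancel₀ hx, h.one] at this
  exact (neg_eq_of_add_eq_zero_right this.symm).symm
theorem RHyp.div (h : RHyp E ψ) {x y : Λ} (hx : x ≠ 0) (hy : y ≠ 0) :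
    ψ (x / y) = ψ x - ψ y := by
  rw [div_eq_mul_inv, h.mul _ _ hx (inv_ne_zero hy), h.inv hy, sub_eq_add_neg]
theorem RHyp.pow (h : RHyp E ψ) {x : Λ} (hx : x ≠ 0) (n : ℕ) : ψ (x ^ n) = n • ψ x := by
  induction n with
  | zero => simp [h.one]
  | succ n ih => rw [pow_succ, h.mul _ _ (pow_ne_zero _ hx) hx, ih, succ_nsmul]
theorem RHyp.root (h : RHyp E ψ) {x : Λ} {n : ℕ} (hn : n ≠ 0) (hx : x ^ n = 1) : ψ x = 0 := by
  have hx0 : x ≠ 0 := by rintro rfl; simp [hn] at hx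
  have := h.pow hx0 n
  rw [hx, h.one, ← Nat.cast_smul_eq_nsmul E] at this
  rcases smul_eq_zero.1 this.symm with h | h
  · exact absurd (Nat.cast_eq_zero.1 h) hn
  · exact h
theorem RHyp.natCast (h : RHyp E ψ) (p : ℕ) [Fact p.Prime] [CharP Λ p] {j : ℕ}
    (hj : (j : Λ) ≠ 0) : ψ (j : Λ) = 0 := by
  have hp : p.Prime := Fact.out
  have h1 : (j : Λ) ^ p = j := by
    have := map_natCast (frobenius Λ p) j
    rwa [frobenius_def] at this
  apply h.root (n := p - 1) (by have := hp.two_le; omega)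
  have : (j : Λ) ^ (p - 1) * j = 1 * j := by
    rw [← pow_succ, Nat.sub_add_cancel hp.one_le, one_mul, h1]
  exact mul_right_cancel₀ hj this
theorem RHyp.line (h : RHyp E ψ) {A B : Λ} (hA : A ≠ 0) (hB : B ≠ 0) (hAB : ψ A ≠ ψ B) :
    A - B ≠ 0 ∧ ∃ c : E, ψ (A - B) = (1 - c) • ψ A + c • ψ B := by
  have hne : A ≠ B := by rintro rfl; exact hAB rfl
  refine ⟨sub_ne_zero.2 hne, ?_⟩
  have h1 : B / A ≠ 1 := by
    intro h1; exact hne ((div_eq_one_iff_eq hA).1 h1).symm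
  obtain ⟨c, hc⟩ := h.one_sub (B / A) (div_ne_zero hB hA) h1 (by
    rw [h.div hB hA]; exact sub_ne_zero.2 hAB.symm)
  refine ⟨c, ?_⟩
  have : A - B = A * (1 - B / A) := by field_simp
  rw [this, h.mul _ _ hA (sub_ne_zero.2 h1.symm), hc, h.div hB hA]
  module
theorem pair_inj {X Y : W} (hXY : LinearIndependent E ![X, Y]) {a b c d : E}
    (h : a • X + b • Y = c • X + d • Y) : a = c ∧ b = d := by
  have h2 := LinearIndependent.pair_iff.1 hXY (a - c) (b - d) (by
    rw [sub_smul, sub_smul]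
    rw [← sub_eq_zero] at h
    rw [← h]; abel)
  exact ⟨sub_eq_zero.1 h2.1, sub_eq_zero.1 h2.2⟩
theorem RHyp.lemM (h : RHyp E ψ) (p : ℕ) [Fact p.Prime] [CharP Λ p] {x y : Λ}
    (hx : x ≠ 0) (hy : y ≠ 0)
    (hXY : LinearIndependent E ![ψ x, ψ y]) {a b : E} (ha : ψ (1 - x) = a • ψ x)
    (hb : ψ (1 - y) = b • ψ y) (ha0 : a ≠ 0) (ha1 : a ≠ 1) (hb0 : b ≠ 0) (hb1 : b ≠ 1) :
    False := by
  have hp : p.Prime := Fact.out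
  have hX0 : ψ x ≠ 0 := hXY.ne_zero 0
  have hY0 : ψ y ≠ 0 := hXY.ne_zero 1
  have inj := fun {a b c d : E} => pair_inj (a := a) (b := b) (c := c) (d := d) hXY
  have hx1 : 1 - x ≠ 0 := by
    intro h0; apply hX0; rw [← sub_eq_zero.1 h0, h.one]
  have hy1 : 1 - y ≠ 0 := by
    intro h0; apply hY0; rw [← sub_eq_zero.1 h0, h.one]
  have hxy : ψ x ≠ ψ y := by
    intro e
    have := inj (a := 1) (b := 0) (c := 0) (d := 1) (by simpa using e)
    exact one_ne_zero this.1
  obtain ⟨hxy0, c, hc⟩ := h.line hx hy hxy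
  have hxy' : ψ (1 - y) ≠ ψ (1 - x) := by
    rw [ha, hb]; intro e
    have := inj (a := a) (b := 0) (c := 0) (d := b) (by simpa using e.symm)
    exact ha0 this.1
  obtain ⟨-, c', hc'⟩ := h.line hy1 hx1 hxy'
  have e1 : (1 - y) - (1 - x) = x - y := by ring
  rw [e1, hc, ha, hb] at hc'
  obtain ⟨f1, f2⟩ := inj (a := 1 - c) (b := c) (c := c' * a) (d := (1 - c') * b) (by
    rw [hc']; module)
  have key : ∀ j : ℕ, j + 1 ≤ p →
      1 - ((j + 1 : ℕ) : Λ) * x ≠ 0 ∧ ∃ r : E, ψ (1 - ((j + 1 : ℕ) : Λ) * x) = r • ψ x ∧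
        r * (1 + j * a) = (j + 1) * a := by
    intro j
    induction j with
    | zero => intro _; exact ⟨by simpa using hx1, a, by simpa using ha, by simp⟩
    | succ j ih =>
      intro hj
      obtain ⟨hne, r, hr, hr'⟩ := ih (by omega)
      have hjp : ((j + 1 : ℕ) : Λ) ≠ 0 := by
        intro h0
        rw [CharP.cast_eq_zero_iff Λ p] at h0
        have := Nat.le_of_dvd (by omega) h0
        omega
      set J : Λ := ((j + 1 : ℕ) : Λ) with hJ
      have hJx : J * x ≠ 0 := mul_ne_zero hjp hx
      have hψJ : ψ (J * x) = ψ x := by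
        rw [h.mul _ _ hjp hx, hJ, h.natCast p hjp, zero_add]
      obtain ⟨hQ0, s, hs⟩ := h.line hne hy (by
        rw [hr]; intro e
        have := inj (a := r) (b := 0) (c := 0) (d := 1) (by simpa using e)
        exact one_ne_zero this.2.symm)
      obtain ⟨-, t, ht⟩ := h.line hy1 hJx (by
        rw [hb, hψJ]; intro e
        have := inj (a := 1) (b := 0) (c := 0) (d := b) (by simpa using e.symm)
        exact one_ne_zero this.1)
      have e2 : (1 - y) - J * x = (1 - J * x) - y := by ring
      rw [e2, hs, hb, hψJ, hr] at ht
      obtain ⟨g1, g2⟩ := inj (a := (1 - s) * r) (b := s) (c := t) (d := (1 - t) * b) (by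
        rw [← sub_eq_zero] at ht ⊢
        rw [← ht]; module)
      have hQ : ψ (1 - J * x - y) = t • ψ x + s • ψ y := by
        rw [hs, hr, ← g1]; module
      have hj0 : (j : E) + 1 ≠ 0 := by exact_mod_cast Nat.succ_ne_zero j
      have hba : b - a ≠ 0 := by
        intro h0
        have : b = a := sub_eq_zero.1 h0
        subst this
        have : b = 1 := by linear_combination -f1 - f2
        exact hb1 this
      have hDt : t * (1 + j * a - (j + 1) * a * b) = (j + 1) * a * (1 - b) := by
        linear_combination (-(1 + j * a)) * g1 - (r * (1 + j * a)) * g2 +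
          (1 - b * (1 - t)) * hr'
      have hD : (1 + j * a - (j + 1) * a * b) ≠ 0 := by
        intro h0
        rw [h0, mul_zero] at hDt
        exact mul_ne_zero (mul_ne_zero hj0 ha0) (sub_ne_zero.2 hb1.symm) hDt.symm
      have hDs : s * (1 + j * a - (j + 1) * a * b) = b * (1 - a) := by
        linear_combination (1 + j * a - (j + 1) * a * b) * g2 - b * hDt
      have hB : c * (b - a) = b * (1 - a) := by
        linear_combination (-a) * f2 - b * f1
      have hA : (1 - c) * (b - a) = - (a * (1 - b)) := by linear_combination -hB
      obtain ⟨hR0, q, hq⟩ := h.line hQ0 hxy0 (by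
        rw [hQ, hc]; intro e
        obtain ⟨i1, i2⟩ := inj e
        have : (b - a) = (1 + j * a - (j + 1) * a * b) := by
          have h3 : b * (1 - a) ≠ 0 := mul_ne_zero hb0 (sub_ne_zero.2 ha1.symm)
          have hs0 : s ≠ 0 := by rintro rfl; rw [zero_mul] at hDs; exact h3 hDs.symm
          apply mul_left_cancel₀ hs0
          rw [hDs, i2, hB]
        rw [← this, i1, hA] at hDt
        have : ((j : E) + 1 + 1) * (a * (1 - b)) = 0 := by linear_combination -hDt
        rcases mul_eq_zero.1 this with h4 | h4
        · have : (j : E) + 1 + 1 ≠ 0 := by exact_mod_cast Nat.succ_ne_zero (j+1)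
          exact this h4
        · exact mul_ne_zero ha0 (sub_ne_zero.2 hb1.symm) h4)
      have e3 : (1 - J * x - y) - (x - y) = 1 - ((j + 1 + 1 : ℕ) : Λ) * x := by
        rw [hJ]; push_cast; ring
      rw [e3] at hq hR0
      rw [hQ, hc] at hq
      have hJx1 : ψ (((j + 1 + 1 : ℕ) : Λ) * x) = ψ x ∨ ((j + 1 + 1 : ℕ) : Λ) = 0 := by
        by_cases h0 : ((j + 1 + 1 : ℕ) : Λ) = 0
        · exact Or.inr h0
        · left; rw [h.mul _ _ h0 hx, h.natCast p h0, zero_add]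
      have hex : ∃ r' : E, ψ (1 - ((j + 1 + 1 : ℕ) : Λ) * x) = r' • ψ x := by
        rcases hJx1 with h1 | h1
        · by_cases h0 : ((j + 1 + 1 : ℕ) : Λ) = 0
          · exact ⟨0, by simp [h0, h.one]⟩
          · obtain ⟨r', hr''⟩ := h.one_sub _ (mul_ne_zero h0 hx)
              (fun h2 => hR0 (by rw [h2, sub_self])) (by rw [h1]; exact hX0)
            exact ⟨r', by rw [hr'', h1]⟩
        · exact ⟨0, by simp [h1, h.one]⟩
      obtain ⟨r', hr''⟩ := hex
      refine ⟨hR0, r', hr'', ?_⟩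
      rw [hr''] at hq
      obtain ⟨k1, k2⟩ := inj (a := r') (b := 0) (c := (1 - q) * t + q * (1 - c))
        (d := (1 - q) * s + q * c) (by rw [zero_smul, add_zero, hq]; module)
      have h3 : b * (1 - a) ≠ 0 := mul_ne_zero hb0 (sub_ne_zero.2 ha1.symm)
      set D := (1 + j * a - (j + 1) * a * b) with hDdef
      have h5 : (1 - q) * (b - a) + q * D = 0 := by
        apply mul_left_cancel₀ h3
        linear_combination (-(D * (b - a))) * k2 - (1 - q) * (b - a) * hDs - q * D * hB
      have h6 : r' * (D * (b - a)) = (j + 2) * (a * (1 - b)) * ((1 - q) * (b - a)) := by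
        linear_combination (D * (b - a)) * k1 + (1 - q) * (b - a) * hDt + q * D * hA
          - (a * (1 - b)) * h5
      have h7 : (1 - q) * ((1 - b) * (1 + (j + 1) * a)) = D := by
        rw [hDdef] at h5 ⊢; linear_combination -h5
      have h8 : (1 - b) ≠ 0 := sub_ne_zero.2 hb1.symm
      apply mul_left_cancel₀ (mul_ne_zero (mul_ne_zero hba h8) hD)
      push_cast
      linear_combination (1 - b) * (1 + (j + 1) * a) * h6 +
        (j + 2) * (a * (1 - b)) * (b - a) * h7
  obtain ⟨-, r, hr, hr'⟩ := key (p - 1) (by have := hp.one_le; omega)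
  rw [Nat.sub_add_cancel hp.one_le] at hr
  rw [CharP.cast_eq_zero, zero_mul, sub_zero, h.one] at hr
  have hr0 : r = 0 := by
    rcases smul_eq_zero.1 hr.symm with h | h
    · exact h
    · exact absurd h hX0
  rw [hr0, zero_mul] at hr'
  have : (((p - 1 : ℕ) : E) + 1) ≠ 0 := by exact Nat.cast_add_one_ne_zero (p - 1)
  exact mul_ne_zero this ha0 hr'.symm
theorem RHyp.exL0 (h : RHyp E ψ) (p : ℕ) [Fact p.Prime] [CharP Λ p] :
    ∃ w0 : W, ∀ y, y ≠ 0 → ψ y ∉ Submodule.span E {w0} → ψ (1 - y) = 0 ∨ ψ (1 - y) = ψ y := by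
  have one_sub : ∀ x, x ≠ 0 → ψ x ≠ 0 → ∃ c : E, ψ (1 - x) = c • ψ x := fun x hx hx' =>
    h.one_sub x hx (by rintro rfl; exact hx' h.one) hx'
  by_cases hw : ∃ x, x ≠ 0 ∧ ψ x ≠ 0 ∧ ψ (1 - x) ≠ 0 ∧ ψ (1 - x) ≠ ψ x
  · obtain ⟨x, hx, hX, h0, h1⟩ := hw
    refine ⟨ψ x, fun y hy hY => ?_⟩
    have hY0 : ψ y ≠ 0 := by intro h; apply hY; rw [h]; exact zero_mem _
    obtain ⟨a, ha⟩ := one_sub x hx hX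
    obtain ⟨b, hb⟩ := one_sub y hy hY0
    by_contra hcon
    push Not at hcon
    refine h.lemM p hx hy ?_ ha hb ?_ ?_ ?_ ?_
    · rw [LinearIndependent.pair_iff' hX]
      intro a e
      exact hY (e ▸ Submodule.smul_mem _ _ (Submodule.mem_span_singleton_self _))
    · rintro rfl; simp at ha; exact h0 ha
    · rintro rfl; simp at ha; exact h1 ha
    · rintro rfl; simp at hb; exact hcon.1 hb
    · rintro rfl; simp at hb; exact hcon.2 hb
  · push Not at hw
    refine ⟨0, fun y hy hY => ?_⟩
    have hY0 : ψ y ≠ 0 := by intro h; apply hY; rw [h]; exact zero_mem _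
    by_cases h0 : ψ (1 - y) = 0
    · exact Or.inl h0
    · exact Or.inr (hw y hy hY0 h0)
end R
end S5
set_option linter.unusedSectionVars false
namespace S5
section R
variable {E Λ W : Type*} [Field Λ] [Field E] [CharZero E] [AddCommGroup W] [Module E W]
  {ψ : Λ → W}
structure RH2 (ψ : Λ → W) (L : Submodule E W) : Prop extends RHyp E ψ where
  tame : ∀ y, y ≠ 0 → ψ y ∉ L → ψ (1 - y) = 0 ∨ ψ (1 - y) = ψ y
def m0 (ψ : Λ → W) (L : Submodule E W) (x : Λ) : Prop := x ≠ 0 ∧ ψ x ∉ L ∧ ψ (1 - x) = 0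
def Opl (ψ : Λ → W) (L : Submodule E W) (x : Λ) : Prop :=
  x ≠ 0 ∧ ψ x ∈ L ∧ ∀ y, m0 ψ L y → m0 ψ L (x * y)
variable {L : Submodule E W} (h : RH2 ψ L)
include h
theorem RH2.ne0 {x : Λ} (hL : ψ x ∉ L) : ψ x ≠ 0 := fun h => hL (h ▸ zero_mem _)
theorem RH2.ne1 {x : Λ} (hL : ψ x ∉ L) : 1 - x ≠ 0 := by
  intro h0
  rw [← sub_eq_zero.1 h0, h.one] at hL
  exact hL (zero_mem _)
theorem RH2.two {w : W} (hw : w ∉ L) : w + w ∉ L := by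
  intro h2
  apply hw
  have : w = (2⁻¹ : E) • (w + w) := by
    rw [← two_smul E w, smul_smul, inv_mul_cancel₀ two_ne_zero, one_smul]
  rw [this]; exact L.smul_mem _ h2
theorem RH2.line {A B : Λ} (hA : A ≠ 0) (hB : B ≠ 0) (hAB : ψ A - ψ B ∉ L) :
    A - B ≠ 0 ∧ (ψ (A - B) = ψ A ∨ ψ (A - B) = ψ B) := by
  have hL : ψ (B / A) ∉ L := by
    rw [h.div hB hA, ← neg_sub]; rwa [L.neg_mem_iff]
  have h1 := h.ne1 hL
  have : A - B = A * (1 - B / A) := by field_simp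
  refine ⟨by rw [this]; exact mul_ne_zero hA h1, ?_⟩
  rw [this, h.mul _ _ hA h1]
  rcases h.tame _ (div_ne_zero hB hA) hL with h2 | h2
  · left; rw [h2, add_zero]
  · right; rw [h2, h.div hB hA]; abel
theorem RH2.line' {A B : Λ} (hA : A ≠ 0) (hB : B ≠ 0) (hAB : ψ A - ψ B ∉ L) :
    A + B ≠ 0 ∧ (ψ (A + B) = ψ A ∨ ψ (A + B) = ψ B) := by
  have := h.line hA (neg_ne_zero.2 hB) (by rwa [h.neg hB])
  rwa [sub_neg_eq_add, h.neg hB] at this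
theorem RH2.m0_neg {x : Λ} (hx : m0 ψ L x) : m0 ψ L (-x) := by
  obtain ⟨h0, hL, h1⟩ := hx
  have hL' : ψ (-x) ∉ L := by rwa [h.neg h0]
  refine ⟨neg_ne_zero.2 h0, hL', ?_⟩
  rcases h.tame _ (neg_ne_zero.2 h0) hL' with h2 | h2
  · exact h2
  exfalso
  have h3 : ψ (1 - x * x) = ψ x := by
    have : 1 - x * x = (1 - x) * (1 - -x) := by ring
    rw [this, h.mul _ _ (h.ne1 hL) (h.ne1 hL'), h1, h2, h.neg h0, zero_add]
  have hxx : ψ (x * x) ∉ L := by rw [h.mul _ _ h0 h0]; exact h.two hL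
  rcases h.tame _ (mul_ne_zero h0 h0) hxx with h4 | h4
  · exact h.ne0 hL (h3 ▸ h4)
  · rw [h3, h.mul _ _ h0 h0] at h4
    exact h.ne0 hL (by simpa using h4)
theorem RH2.m0_inv {x : Λ} (hx0 : x ≠ 0) (hL : ψ x ∉ L) : m0 ψ L x ∨ m0 ψ L x⁻¹ := by
  rcases h.tame x hx0 hL with h1 | h1
  · exact Or.inl ⟨hx0, hL, h1⟩
  · refine Or.inr ⟨inv_ne_zero hx0, by rwa [h.inv hx0, L.neg_mem_iff], ?_⟩
    have : 1 - x⁻¹ = - ((1 - x) / x) := by field_simp; ring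
    rw [this, h.neg (div_ne_zero (h.ne1 hL) hx0), h.div (h.ne1 hL) hx0, h1, sub_self]
theorem RH2.m0_not_inv {x : Λ} (hx : m0 ψ L x) (hx' : m0 ψ L x⁻¹) : False := by
  obtain ⟨hx0, hL, h1⟩ := hx
  have : 1 - x⁻¹ = - ((1 - x) / x) := by field_simp; ring
  have h2 := hx'.2.2
  rw [this, h.neg (div_ne_zero (h.ne1 hL) hx0), h.div (h.ne1 hL) hx0, h1, zero_sub,
    neg_eq_zero] at h2
  exact h.ne0 hL h2
theorem RH2.m0_mul {x y : Λ} (hx : m0 ψ L x) (hy : m0 ψ L y) : ψ (1 - x * y) = 0 := by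
  obtain ⟨hx0, hxL, hx1⟩ := hx
  obtain ⟨hy0, hyL, hy1⟩ := hy
  have a1 := h.line' (h.ne1 hxL) (mul_ne_zero hx0 (h.ne1 hyL)) (by
    rw [hx1, h.mul _ _ hx0 (h.ne1 hyL), hy1, add_zero, zero_sub]; rwa [L.neg_mem_iff])
  have a2 := h.line' (h.ne1 hyL) (mul_ne_zero hy0 (h.ne1 hxL)) (by
    rw [hy1, h.mul _ _ hy0 (h.ne1 hxL), hx1, add_zero, zero_sub]; rwa [L.neg_mem_iff])
  have e1 : (1 - x) + x * (1 - y) = 1 - x * y := by ring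
  have e2 : (1 - y) + y * (1 - x) = 1 - x * y := by ring
  rw [e1, hx1, h.mul _ _ hx0 (h.ne1 hyL), hy1, add_zero] at a1
  rw [e2, hy1, h.mul _ _ hy0 (h.ne1 hxL), hx1, add_zero] at a2
  rcases a1.2 with b1 | b1
  · exact b1
  rcases a2.2 with b2 | b2
  · exact b2
  have hXY : ψ x = ψ y := by rw [← b1, ← b2]
  have hxy : ψ (x * y) ∉ L := by rw [h.mul _ _ hx0 hy0, ← hXY]; exact h.two hxL
  rcases h.tame _ (mul_ne_zero hx0 hy0) hxy with b3 | b3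
  · exact b3
  · rw [b1, h.mul _ _ hx0 hy0, ← hXY] at b3
    exact absurd (by simpa using b3) (h.ne0 hxL)
theorem RH2.m0_mul' {x y : Λ} (hx : m0 ψ L x) (hy : m0 ψ L y) (hL : ψ x + ψ y ∉ L) :
    m0 ψ L (x * y) :=
  ⟨mul_ne_zero hx.1 hy.1, by rwa [h.mul _ _ hx.1 hy.1], h.m0_mul hx hy⟩
theorem RH2.Opl_or {t : Λ} (ht0 : t ≠ 0) (ht : ψ t ∈ L) : Opl ψ L t ∨ Opl ψ L t⁻¹ := by
  by_contra hcon
  rw [not_or] at hcon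
  obtain ⟨c1, c2⟩ := hcon
  have d1 : ∃ y, m0 ψ L y ∧ ¬ m0 ψ L (t * y) := by
    by_contra hh; push Not at hh; exact c1 ⟨ht0, ht, hh⟩
  have d2 : ∃ y, m0 ψ L y ∧ ¬ m0 ψ L (t⁻¹ * y) := by
    by_contra hh; push Not at hh
    exact c2 ⟨inv_ne_zero ht0, by rwa [h.inv ht0, L.neg_mem_iff], hh⟩
  obtain ⟨y, hy, hy'⟩ := d1
  obtain ⟨z, hz, hz'⟩ := d2
  have hw : m0 ψ L (t * y)⁻¹ := by
    rcases h.m0_inv (mul_ne_zero ht0 hy.1) (by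
      rw [h.mul _ _ ht0 hy.1]; intro hh; exact hy.2.1 ((L.add_mem_iff_right ht).1 hh)) with g | g
    · exact absurd g hy'
    · exact g
  have hti : ψ t⁻¹ ∈ L := by rwa [h.inv ht0, L.neg_mem_iff]
  have hw' : m0 ψ L (t⁻¹ * z)⁻¹ := by
    rcases h.m0_inv (mul_ne_zero (inv_ne_zero ht0) hz.1) (by
      rw [h.mul _ _ (inv_ne_zero ht0) hz.1]; intro hh
      exact hz.2.1 ((L.add_mem_iff_right hti).1 hh)) with g | g
    · exact absurd g hz'
    · exact g
  have pw : ψ (t * y)⁻¹ = - ψ t - ψ y := by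
    rw [h.inv (mul_ne_zero ht0 hy.1), h.mul _ _ ht0 hy.1]; abel
  have pw' : ψ (t⁻¹ * z)⁻¹ = ψ t - ψ z := by
    rw [h.inv (mul_ne_zero (inv_ne_zero ht0) hz.1), h.mul _ _ (inv_ne_zero ht0) hz.1, h.inv ht0]
    abel
  by_cases hL : ψ y + ψ z ∈ L
  · have i1 : m0 ψ L (y * (t⁻¹ * z)⁻¹) := by
      refine h.m0_mul' hy hw' ?_
      rw [pw']; intro hh
      apply h.two hy.2.1
      have := L.add_mem (L.sub_mem hh ht) hL
      convert this using 1; abel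
    have i2 : m0 ψ L ((t * y)⁻¹ * z) := by
      refine h.m0_mul' hw hz ?_
      rw [pw]; intro hh
      apply h.two hz.2.1
      have := L.add_mem (L.add_mem hh ht) hL
      convert this using 1; abel
    refine h.m0_not_inv i1 ?_
    convert i2 using 1
    have := hy.1; have := hz.1
    field_simp
  · have i1 := h.m0_mul' hy hz hL
    have i2 : m0 ψ L ((t * y)⁻¹ * (t⁻¹ * z)⁻¹) := by
      refine h.m0_mul' hw hw' ?_
      rw [pw, pw']; intro hh; apply hL
      rw [← L.neg_mem_iff]; convert hh using 1; abel
    refine h.m0_not_inv i1 ?_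
    convert i2 using 1
    have := hy.1; have := hz.1
    field_simp
theorem RH2.m0_m0 {x y : Λ} (hx : m0 ψ L x) (hy : m0 ψ L y) :
    m0 ψ L (x * y) ∨ Opl ψ L (x * y) := by
  by_cases hL : ψ x + ψ y ∈ L
  · right
    refine ⟨mul_ne_zero hx.1 hy.1, by rwa [h.mul _ _ hx.1 hy.1], fun z hz => ?_⟩
    have hxyz : ψ x + ψ y + ψ z ∉ L := fun hh => hz.2.1 ((L.add_mem_iff_right hL).1 hh)
    by_cases h1 : ψ x + ψ z ∈ L
    · have h2 : ψ y + ψ z ∉ L := by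
        intro h2
        apply h.two hz.2.1
        have := L.sub_mem (L.add_mem h1 h2) hL
        convert this using 1; abel
      have := h.m0_mul' hx (h.m0_mul' hy hz h2) (by
        rw [h.mul _ _ hy.1 hz.1]; rwa [← add_assoc])
      rwa [← mul_assoc] at this
    · have := h.m0_mul' (h.m0_mul' hx hz h1) hy (by
        rw [h.mul _ _ hx.1 hz.1]; intro hh; apply hxyz; convert hh using 1; abel)
      convert this using 1; ring
  · exact Or.inl (h.m0_mul' hx hy hL)
theorem RH2.Opl_neg {x : Λ} (hx : Opl ψ L x) : Opl ψ L (-x) := by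
  refine ⟨neg_ne_zero.2 hx.1, by rw [h.neg hx.1]; exact hx.2.1, fun y hy => ?_⟩
  rw [neg_mul]; exact h.m0_neg (hx.2.2 y hy)
theorem RH2.one_add {x : Λ} (hx : m0 ψ L x ∨ Opl ψ L x) (hx1 : 1 - x ≠ 0) :
    m0 ψ L (1 - x) ∨ Opl ψ L (1 - x) := by
  by_cases hL : ψ (1 - x) ∈ L
  · right
    refine ⟨hx1, hL, fun y hy => ?_⟩
    have hyL : ψ ((1 - x) * y) ∉ L := by
      rw [h.mul _ _ hx1 hy.1]; intro hh; exact hy.2.1 ((L.add_mem_iff_right hL).1 hh)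
    refine ⟨mul_ne_zero hx1 hy.1, hyL, ?_⟩
    rcases h.tame _ (mul_ne_zero hx1 hy.1) hyL with g | g
    · exact g
    exfalso
    have hy' := h.m0_neg hy
    have k1 : ψ (1 - -y) = 0 := hy'.2.2
    have k1' : 1 - -y ≠ 0 := h.ne1 hy'.2.1
    have k2 : ψ (1 - x * -y) = 0 := by
      rcases hx with hx | hx
      · exact h.m0_mul hx hy'
      · exact (hx.2.2 _ hy').2.2
    have hx0 : x ≠ 0 := by rcases hx with hx | hx <;> exact hx.1
    have k2' : 1 - x * -y ≠ 0 := by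
      intro h0
      rcases hx with hx | hx
      · have : -y = x⁻¹ := by field_simp; linear_combination -h0
        rw [this] at hy'; exact h.m0_not_inv hx hy'
      · exact h.ne1 (hx.2.2 _ hy').2.1 h0
    have k3 : ψ ((1 - x) * y * y) = ψ (1 - x) + ψ y + ψ y := by
      rw [h.mul _ _ (mul_ne_zero hx1 hy.1) hy.1, h.mul _ _ hx1 hy.1]
    have k4 := h.line k2' (mul_ne_zero (mul_ne_zero hx1 hy.1) hy.1) (by
      rw [k2, k3, zero_sub, L.neg_mem_iff, add_assoc]
      intro hh; exact h.two hy.2.1 ((L.add_mem_iff_right hL).1 hh))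
    have e : 1 - x * -y - (1 - x) * y * y = (1 - (1 - x) * y) * (1 - -y) := by ring
    rw [e, h.mul _ _ (h.ne1 hyL) k1', k1, add_zero, g, k2, k3] at k4
    rcases k4.2 with k5 | k5
    · exact h.ne0 hyL k5
    · rw [h.mul _ _ hx1 hy.1] at k5
      exact h.ne0 hy.2.1 (by simpa using k5)
  · left
    rcases hx with hx | hx
    · exact absurd (by rw [hx.2.2]; exact zero_mem _) hL
    · refine ⟨hx1, hL, ?_⟩
      rcases h.tame _ hx1 hL with g | g
      · exact g
      · rw [sub_sub_cancel] at g
        exact absurd (g ▸ hx.2.1) hL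
def RH2.ring : ValuationSubring Λ where
  carrier := {x | x = 0 ∨ m0 ψ L x ∨ Opl ψ L x}
  zero_mem' := Or.inl rfl
  one_mem' := Or.inr (Or.inr ⟨one_ne_zero, by rw [h.one]; exact zero_mem _, by simp⟩)
  mul_mem' := by
    rintro x y (rfl | hx) (rfl | hy)
    · simp
    · simp
    · simp
    · right
      rcases hx with hx | hx <;> rcases hy with hy | hy
      · exact h.m0_m0 hx hy
      · left; rw [mul_comm]; exact hy.2.2 _ hx
      · left; exact hx.2.2 _ hy
      · right
        refine ⟨mul_ne_zero hx.1 hy.1, ?_, fun z hz => ?_⟩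
        · rw [h.mul _ _ hx.1 hy.1]; exact L.add_mem hx.2.1 hy.2.1
        · rw [mul_assoc]; exact hx.2.2 _ (hy.2.2 _ hz)
  neg_mem' := by
    rintro x (rfl | hx | hx)
    · simp
    · exact Or.inr (Or.inl (h.m0_neg hx))
    · exact Or.inr (Or.inr (h.Opl_neg hx))
  add_mem' := by
    have hmul : ∀ x y : Λ, (m0 ψ L x ∨ Opl ψ L x) → (m0 ψ L y ∨ Opl ψ L y) →
        (m0 ψ L (x * y) ∨ Opl ψ L (x * y)) := by
      intro x y hx hy
      rcases hx with hx | hx <;> rcases hy with hy | hy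
      · exact h.m0_m0 hx hy
      · left; rw [mul_comm]; exact hy.2.2 _ hx
      · left; exact hx.2.2 _ hy
      · right
        refine ⟨mul_ne_zero hx.1 hy.1, ?_, fun z hz => ?_⟩
        · rw [h.mul _ _ hx.1 hy.1]; exact L.add_mem hx.2.1 hy.2.1
        · rw [mul_assoc]; exact hx.2.2 _ (hy.2.2 _ hz)
    have hinv : ∀ x : Λ, x ≠ 0 → (m0 ψ L x ∨ Opl ψ L x) ∨ (m0 ψ L x⁻¹ ∨ Opl ψ L x⁻¹) := by
      intro x hx
      by_cases hL : ψ x ∈ L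
      · rcases h.Opl_or hx hL with g | g
        · exact Or.inl (Or.inr g)
        · exact Or.inr (Or.inr g)
      · rcases h.m0_inv hx hL with g | g
        · exact Or.inl (Or.inl g)
        · exact Or.inr (Or.inl g)
    have hneg : ∀ x : Λ, (m0 ψ L x ∨ Opl ψ L x) → (m0 ψ L (-x) ∨ Opl ψ L (-x)) := by
      rintro x (hx | hx)
      · exact Or.inl (h.m0_neg hx)
      · exact Or.inr (h.Opl_neg hx)
    rintro x y (rfl | hx) (rfl | hy)
    · simp
    · rw [zero_add]; exact Or.inr hy
    · rw [add_zero]; exact Or.inr hx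
    have hx0 : x ≠ 0 := by rcases hx with hx | hx <;> exact hx.1
    have hy0 : y ≠ 0 := by rcases hy with hx | hx <;> exact hx.1
    rcases hinv (y / x) (div_ne_zero hy0 hx0) with g | g
    · by_cases h0 : 1 - -(y / x) = 0
      · left
        have : x + y = x * (1 - -(y/x)) := by field_simp; ring
        rw [this, h0, mul_zero]
      · right
        have : x + y = x * (1 - -(y/x)) := by field_simp; ring
        rw [this]; exact hmul _ _ hx (h.one_add (hneg _ g) h0)
    · by_cases h0 : 1 - -(y / x)⁻¹ = 0
      · left
        have : x + y = y * (1 - -(y/x)⁻¹) := by field_simp; ring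
        rw [this, h0, mul_zero]
      · right
        have : x + y = y * (1 - -(y/x)⁻¹) := by field_simp; ring
        rw [this]; exact hmul _ _ hy (h.one_add (hneg _ g) h0)
  mem_or_inv_mem' := by
    intro x
    by_cases hx : x = 0
    · exact Or.inl (Or.inl hx)
    by_cases hL : ψ x ∈ L
    · rcases h.Opl_or hx hL with g | g
      · exact Or.inl (Or.inr (Or.inr g))
      · exact Or.inr (Or.inr (Or.inr g))
    · rcases h.m0_inv hx hL with g | g
      · exact Or.inl (Or.inr (Or.inl g))
      · exact Or.inr (Or.inr (Or.inl g))
theorem RH2.mem_ring {x : Λ} : x ∈ h.ring ↔ x = 0 ∨ m0 ψ L x ∨ Opl ψ L x := Iff.rfl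
omit h
theorem RHyp.main (h : RHyp E ψ) (p : ℕ) [Fact p.Prime] [CharP Λ p] :
    ∃ (O : ValuationSubring Λ) (w0 : W),
      (∀ x, O.valuation x = 1 → ψ x ∈ Submodule.span E {w0}) ∧
      (∀ x, O.valuation x < 1 → ψ (1 - x) = 0) := by
  obtain ⟨w0, hw⟩ := h.exL0 p
  set L := Submodule.span E {w0}
  have h2 : RH2 ψ L := { toRHyp := h, tame := hw }
  refine ⟨h2.ring, w0, fun x hx => ?_, fun x hx => ?_⟩
  · have hx0 : x ≠ 0 := by rintro rfl; simp at hx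
    by_contra hL
    have m1 : x ∈ h2.ring := (h2.ring.valuation_le_one_iff x).1 hx.le
    have m2 : x⁻¹ ∈ h2.ring := (h2.ring.valuation_le_one_iff x⁻¹).1 (by simp [hx])
    rw [h2.mem_ring] at m1 m2
    have hL' : ψ x⁻¹ ∉ L := by rwa [h.inv hx0, L.neg_mem_iff]
    rcases m1 with m1 | m1 | m1
    · exact hx0 m1
    · rcases m2 with m2 | m2 | m2
      · exact hx0 (inv_eq_zero.1 m2)
      · exact h2.m0_not_inv m1 m2
      · exact hL' m2.2.1
    · exact hL m1.2.1
  · by_cases hx0 : x = 0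
    · simp [hx0, h.one]
    have m1 : x ∈ h2.ring := (h2.ring.valuation_le_one_iff x).1 hx.le
    have m2 : x⁻¹ ∉ h2.ring := by
      rw [← h2.ring.valuation_le_one_iff, map_inv₀, not_le]
      exact (one_lt_inv₀ (by rwa [zero_lt_iff, Valuation.ne_zero_iff])).2 hx
    rw [h2.mem_ring] at m1 m2
    rcases m1 with m1 | m1 | m1
    · exact absurd m1 hx0
    · exact m1.2.2
    · have : ¬ Opl ψ L x⁻¹ := fun g => m2 (Or.inr (Or.inr g))
      have hiL : ψ x⁻¹ ∈ L := by rw [h.inv hx0, L.neg_mem_iff]; exact m1.2.1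
      have : ∃ z, m0 ψ L z ∧ ¬ m0 ψ L (x⁻¹ * z) := by
        by_contra hh; push Not at hh
        exact this ⟨inv_ne_zero hx0, hiL, hh⟩
      obtain ⟨z, hz, hz'⟩ := this
      rcases h2.m0_inv (mul_ne_zero (inv_ne_zero hx0) hz.1) (by
        rw [h.mul _ _ (inv_ne_zero hx0) hz.1]; intro hh
        exact hz.2.1 ((L.add_mem_iff_right hiL).1 hh)) with g | g
      · exact absurd g hz'
      · have := h2.m0_mul hz g
        have e : z * (x⁻¹ * z)⁻¹ = x := by have := hz.1; field_simp
        rwa [e] at this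
end R
end S5
set_option linter.all false
namespace S5
structure Cx (ℓ : ℕ) {k : Type*} (Ω : Type*) [Field k] [Field Ω] [Algebra k Ω] (ζ : ℕ → k) :
    Prop where
  prim : ∀ n, IsPrimitiveRoot (ζ n) (ℓ ^ n)
  succ : ∀ n, ζ (n + 1) ^ ℓ = ζ n
  div : ∀ x : Ω, ∃ y, y ^ ℓ = x
  tors : ∀ c : k, c ≠ 0 → ∃ n, n ≠ 0 ∧ c ^ n = 1
  lne : (ℓ : k) ≠ 0
section K
variable {ℓ : ℕ} [hℓ : Fact ℓ.Prime] {k Ω : Type*} [Field k] [Field Ω] [Algebra k Ω] {ζ : ℕ → k}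
noncomputable def zp (ζ : ℕ → k) (n : ℕ) (c : ℤ_[ℓ]) : k := ζ n ^ (PadicInt.toZModPow n c).val
variable (hc : Cx ℓ Ω ζ)
include hc
theorem Cx.lpos (n : ℕ) : 0 < ℓ ^ n := pow_pos hℓ.out.pos n
theorem Cx.zp_eq_of {n : ℕ} {c : ℤ_[ℓ]} {a : ℕ} (h : PadicInt.toZModPow n c = (a : ZMod (ℓ ^ n))) :
    zp ζ n c = ζ n ^ a := by
  haveI : NeZero (ℓ ^ n) := ⟨(hc.lpos n).ne'⟩
  rw [zp, h, ZMod.val_natCast]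
  exact pow_mod_orderOf (ζ n) a ▸ by rw [← (hc.prim n).eq_orderOf]
theorem Cx.zp_cast (n a : ℕ) : zp ζ n (a : ℤ_[ℓ]) = ζ n ^ a := hc.zp_eq_of (by simp)
theorem Cx.zp_rep (n : ℕ) (c : ℤ_[ℓ]) :
    PadicInt.toZModPow n c = ((PadicInt.toZModPow n c).val : ZMod (ℓ ^ n)) := by
  haveI : NeZero (ℓ ^ n) := ⟨(hc.lpos n).ne'⟩
  simp
theorem Cx.zp_add (n : ℕ) (c d : ℤ_[ℓ]) : zp ζ n (c + d) = zp ζ n c * zp ζ n d := by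
  have : PadicInt.toZModPow n (c + d) =
    (((PadicInt.toZModPow n c).val + (PadicInt.toZModPow n d).val : ℕ) : ZMod (ℓ ^ n)) := by
    push_cast; rw [← hc.zp_rep n c, ← hc.zp_rep n d, map_add]
  rw [hc.zp_eq_of this, pow_add, zp, zp]
theorem Cx.zp_zero (n : ℕ) : zp ζ n (0 : ℤ_[ℓ]) = 1 := by
  simpa using hc.zp_cast n 0
theorem Cx.zp_eq_one {n : ℕ} {c : ℤ_[ℓ]} : zp ζ n c = 1 ↔ (ℓ : ℤ_[ℓ]) ^ n ∣ c := by
  haveI : NeZero (ℓ ^ n) := ⟨(hc.lpos n).ne'⟩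
  rw [← Ideal.mem_span_singleton, ← PadicInt.ker_toZModPow, RingHom.mem_ker, zp,
    (hc.prim n).pow_eq_one_iff_dvd]
  constructor
  · intro h
    have := Nat.eq_zero_of_dvd_of_lt h (ZMod.val_lt _)
    exact (ZMod.val_eq_zero _).1 this
  · intro h; rw [h]; simp
theorem Cx.zp_ne (n : ℕ) (c : ℤ_[ℓ]) : zp ζ n c ≠ 0 :=
  pow_ne_zero _ ((hc.prim n).ne_zero (hc.lpos n).ne')
theorem Cx.zp_nsmul (n a : ℕ) (c : ℤ_[ℓ]) : zp ζ n ((a : ℤ_[ℓ]) * c) = zp ζ n c ^ a := by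
  induction a with
  | zero => simp [hc.zp_zero]
  | succ a ih =>
    rw [pow_succ, ← ih, ← hc.zp_add]; congr 1; push_cast; ring
theorem Cx.zp_pow (n : ℕ) (c : ℤ_[ℓ]) : zp ζ n c ^ (ℓ ^ n) = 1 := by
  rw [← hc.zp_nsmul, hc.zp_eq_one]
  exact ⟨c, by push_cast; rfl⟩
theorem Cx.zeta_add (n e : ℕ) : ζ (n + e) ^ (ℓ ^ e) = ζ n := by
  induction e with
  | zero => simp
  | succ e ih => rw [pow_succ', pow_mul, ← add_assoc, hc.succ, ih]
theorem Cx.zp_succ (n e : ℕ) (c : ℤ_[ℓ]) : zp ζ (n + e) c ^ (ℓ ^ e) = zp ζ n c := by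
  have : PadicInt.toZModPow n c = ((PadicInt.toZModPow (n + e) c).val : ZMod (ℓ ^ n)) := by
    rw [← PadicInt.cast_toZModPow n (n + e) (by omega) c]
    haveI : NeZero (ℓ ^ (n+e)) := ⟨(hc.lpos (n+e)).ne'⟩
    rw [ZMod.natCast_val]
  rw [hc.zp_eq_of this, zp, ← pow_mul, mul_comm, pow_mul, hc.zeta_add]
theorem Cx.zp_inj {n : ℕ} {c d : ℤ_[ℓ]} (h : zp ζ n c = zp ζ n d) : (ℓ : ℤ_[ℓ]) ^ n ∣ c - d := by
  rw [← hc.zp_eq_one]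
  have h1 : zp ζ n (c - d) * zp ζ n d = zp ζ n c := by rw [← hc.zp_add, sub_add_cancel]
  rw [h] at h1
  exact mul_right_cancel₀ (hc.zp_ne n d) (by rw [h1, one_mul])
theorem Cx.zp_congr {n : ℕ} {c d : ℤ_[ℓ]} (h : (ℓ : ℤ_[ℓ]) ^ n ∣ c - d) : zp ζ n c = zp ζ n d := by
  rw [← hc.zp_eq_one] at h
  have h1 : zp ζ n (c - d) * zp ζ n d = zp ζ n c := by rw [← hc.zp_add, sub_add_cancel]
  rw [← h1, h, one_mul]
theorem Cx.zp_prim {n : ℕ} {c : ℤ_[ℓ]} (h : IsUnit c) : IsPrimitiveRoot (zp ζ n c) (ℓ ^ n) := by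
  refine ⟨hc.zp_pow n c, fun l hl => ?_⟩
  rw [← hc.zp_nsmul, hc.zp_eq_one] at hl
  have := h.dvd_mul_right.1 hl
  exact (hc.prim n).dvd_of_pow_eq_one l (by rw [← hc.zp_cast, hc.zp_eq_one]; exact this)
omit hc in
theorem eq_zero_of_forall_dvd {c : ℤ_[ℓ]} (h : ∀ n, (ℓ : ℤ_[ℓ]) ^ n ∣ c) : c = 0 := by
  rw [← PadicInt.ext_of_toZModPow]
  intro n
  rw [map_zero, ← RingHom.mem_ker, PadicInt.ker_toZModPow, Ideal.mem_span_singleton]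
  exact h n
theorem Cx.root (n : ℕ) (x : Ω) : ∃ r : Ω, r ^ (ℓ ^ n) = x := by
  induction n with
  | zero => exact ⟨x, by simp⟩
  | succ n ih =>
    obtain ⟨r, hr⟩ := ih
    obtain ⟨y, hy⟩ := hc.div r
    exact ⟨y, by rw [pow_succ', pow_mul, hy, hr]⟩
theorem Cx.root_ratio {n : ℕ} {r r' : Ω} (h : r ^ (ℓ ^ n) = r' ^ (ℓ ^ n)) :
    ∃ a : ℕ, r' = ζ n ^ a • r := by
  by_cases hr : r = 0
  · subst hr
    rw [zero_pow (hc.lpos n).ne'] at h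
    exact ⟨0, by simpa using (pow_eq_zero_iff (hc.lpos n).ne').1 h.symm⟩
  have h1 : (r' / r) ^ (ℓ ^ n) = 1 := by
    rw [div_pow, h, div_self]; rw [← h]; exact pow_ne_zero _ hr
  haveI : NeZero (ℓ ^ n) := ⟨(hc.lpos n).ne'⟩
  obtain ⟨a, -, ha⟩ := ((hc.prim n).map_of_injective
    (algebraMap k Ω).injective).eq_pow_of_pow_eq_one h1
  refine ⟨a, ?_⟩
  rw [Algebra.smul_def, map_pow, ha, div_mul_cancel₀ _ hr]
theorem Cx.prod_one_sub {n : ℕ} {η : k} (hη : IsPrimitiveRoot η (ℓ ^ n)) (y : Ω) :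
    ∏ j ∈ Finset.range (ℓ ^ n), (1 - η ^ j • y) = 1 - y ^ (ℓ ^ n) := by
  classical
  have hη' := hη.map_of_injective (algebraMap k Ω).injective
  have h1 := hη'.pow_sub_pow_eq_prod_sub_mul 1 y (hc.lpos n)
  rw [one_pow] at h1
  rw [h1]
  have h2 : Polynomial.nthRootsFinset (ℓ ^ n) (1 : Ω) =
      (Finset.range (ℓ ^ n)).image (fun j => (algebraMap k Ω η) ^ j) := by
    symm
    apply Finset.eq_of_subset_of_card_le
    · intro x hx
      obtain ⟨j, -, rfl⟩ := Finset.mem_image.1 hx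
      rw [Polynomial.mem_nthRootsFinset (hc.lpos n), ← pow_mul, mul_comm, pow_mul, hη'.pow_eq_one,
        one_pow]
    · rw [hη'.card_nthRootsFinset, Finset.card_image_of_injOn, Finset.card_range]
      intro i hi j hj hij
      exact hη'.pow_inj (by simpa using hi) (by simpa using hj) hij
  rw [h2, Finset.prod_image]
  · apply Finset.prod_congr rfl; intro j _; rw [Algebra.smul_def, map_pow]
  · intro i hi j hj hij
    exact hη'.pow_inj (by simpa using hi) (by simpa using hj) hij
def IsKap (ζ : ℕ → k) (s : Ω ≃ₐ[k] Ω) (x : Ω) (c : ℤ_[ℓ]) : Prop :=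
  ∀ n (r : Ω), r ^ (ℓ ^ n) = x → s r = zp ζ n c • r
theorem Cx.exists_kap (s : Ω ≃ₐ[k] Ω) {x : Ω} (hx : s x = x) :
    ∃ c : ℤ_[ℓ], IsKap ζ s x c := by
  choose q hq using hc.div
  let r : ℕ → Ω := fun n => Nat.rec x (fun _ y => q y) n
  have hr : ∀ n, r (n + 1) ^ ℓ = r n := fun n => hq _
  have hrx : ∀ n, r n ^ (ℓ ^ n) = x := by
    intro n
    induction n with
    | zero => simp [r]
    | succ n ih => rw [pow_succ', pow_mul, hr, ih]
  by_cases hx0 : x = 0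
  · refine ⟨0, fun n y hy => ?_⟩
    rw [hx0] at hy
    rw [(pow_eq_zero_iff (hc.lpos n).ne').1 hy]; simp
  have hr0 : ∀ n, r n ≠ 0 := by
    intro n h0
    have := hrx n
    rw [h0, zero_pow (hc.lpos n).ne'] at this
    exact hx0 this.symm
  have hs : ∀ n, ∃ a : ℕ, s (r n) = ζ n ^ a • r n := by
    intro n
    apply hc.root_ratio
    rw [← map_pow, hrx, hx]
  choose a ha using hs
  have hdvd : ∀ i, (ℓ : ℤ) ^ i ∣ (a (i + 1) : ℤ) - a i := by
    intro i
    have h1 : ζ i ^ a (i + 1) • r i = ζ i ^ a i • r i := by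
      have h0 : s (r (i + 1) ^ ℓ) = ζ i ^ a (i + 1) • r (i + 1) ^ ℓ := by
        rw [map_pow, ha (i + 1), smul_pow, ← pow_mul, mul_comm, pow_mul, hc.succ]
      rw [hr] at h0
      rw [← h0, ha]
    have h2 : ζ i ^ a (i + 1) = ζ i ^ a i := smul_left_injective k (hr0 i) h1
    have h3 : zp ζ i (a (i + 1) : ℤ_[ℓ]) = zp ζ i (a i : ℤ_[ℓ]) := by
      rw [hc.zp_cast, hc.zp_cast, h2]
    have h4 := hc.zp_inj h3
    have h5 := (PadicInt.pow_p_dvd_int_iff (p := ℓ) i ((a (i + 1) : ℤ) - a i)).1 (by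
      push_cast; exact h4)
    exact h5
  refine ⟨PadicInt.ofIntSeq _ (PadicInt.isCauSeq_padicNorm_of_pow_dvd_sub (fun i => (a i : ℤ)) ℓ hdvd), ?_⟩
  intro n y hy
  have hz := PadicInt.toZModPow_ofIntSeq_of_pow_dvd_sub (fun i => (a i : ℤ)) ℓ hdvd n
  rw [hc.zp_eq_of (a := a n) (by rw [hz]; simp)]
  obtain ⟨b, hb⟩ := hc.root_ratio (r := r n) (r' := y) (by rw [hy, hrx])
  rw [hb, map_smul, ha, smul_comm]
open Classical in
noncomputable def kap (ζ : ℕ → k) (s : Ω ≃ₐ[k] Ω) (x : Ω) : ℤ_[ℓ] :=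
  if h : ∃ c : ℤ_[ℓ], IsKap ζ s x c then h.choose else 0
theorem Cx.kap_spec {s : Ω ≃ₐ[k] Ω} {x : Ω} (hx : s x = x) {n : ℕ} {r : Ω}
    (hr : r ^ (ℓ ^ n) = x) : s r = zp ζ n (kap (ℓ := ℓ) ζ s x) • r := by
  have h := hc.exists_kap s hx
  rw [kap, dif_pos h]
  exact h.choose_spec n r hr
theorem Cx.kap_dvd {s : Ω ≃ₐ[k] Ω} {x : Ω} (hx : s x = x) (hx0 : x ≠ 0) {n : ℕ} {r : Ω}
    (hr : r ^ (ℓ ^ n) = x) {c : ℤ_[ℓ]} (h : s r = zp ζ n c • r) :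
    (ℓ : ℤ_[ℓ]) ^ n ∣ kap ζ s x - c := by
  have hr0 : r ≠ 0 := by rintro rfl; exact hx0 (by rw [← hr, zero_pow (hc.lpos n).ne'])
  rw [hc.kap_spec hx hr] at h
  exact hc.zp_inj (smul_left_injective k hr0 h)
theorem Cx.kap_uniq {s : Ω ≃ₐ[k] Ω} {x : Ω} (hx : s x = x) (hx0 : x ≠ 0) {c : ℤ_[ℓ]}
    (h : ∀ n, ∃ r : Ω, r ^ (ℓ ^ n) = x ∧ s r = zp ζ n c • r) : kap ζ s x = c := by
  rw [← sub_eq_zero]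
  apply eq_zero_of_forall_dvd
  intro n
  obtain ⟨r, hr, h⟩ := h n
  exact hc.kap_dvd hx hx0 hr h
theorem Cx.fix_iff {s : Ω ≃ₐ[k] Ω} {x : Ω} (hx : s x = x) (hx0 : x ≠ 0) {n : ℕ} {r : Ω}
    (hr : r ^ (ℓ ^ n) = x) : s r = r ↔ (ℓ : ℤ_[ℓ]) ^ n ∣ kap ζ s x := by
  constructor
  · intro h
    have := hc.kap_dvd (c := 0) hx hx0 hr (by rw [h, hc.zp_zero, one_smul])
    simpa using this
  · intro h
    rw [hc.kap_spec hx hr, hc.zp_eq_one.2 h, one_smul]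
theorem Cx.kap_mul {s : Ω ≃ₐ[k] Ω} {x y : Ω} (hx : s x = x) (hy : s y = y) (hx0 : x ≠ 0)
    (hy0 : y ≠ 0) : kap (ℓ := ℓ) ζ s (x * y) = kap ζ s x + kap ζ s y := by
  apply hc.kap_uniq (by rw [map_mul, hx, hy]) (mul_ne_zero hx0 hy0)
  intro n
  obtain ⟨r, hr⟩ := hc.root n x
  obtain ⟨t, ht⟩ := hc.root n y
  refine ⟨r * t, by rw [mul_pow, hr, ht], ?_⟩
  rw [map_mul, hc.kap_spec hx hr, hc.kap_spec hy ht, hc.zp_add, smul_mul_smul_comm]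
theorem Cx.kap_one {s : Ω ≃ₐ[k] Ω} : kap (ℓ := ℓ) ζ s 1 = 0 := by
  have := hc.kap_mul (s := s) (map_one s) (map_one s) one_ne_zero one_ne_zero
  simpa using this
theorem Cx.kap_zpow_root {s : Ω ≃ₐ[k] Ω} {x y : Ω} (hy : s y = y) (hx0 : x ≠ 0) {n : ℕ}
    (h : y ^ n = x) : kap (ℓ := ℓ) ζ s x = (n : ℤ_[ℓ]) * kap ζ s y := by
  subst h
  have hy0 : n = 0 ∨ y ≠ 0 := by
    by_cases h : n = 0
    · exact Or.inl h
    · right; rintro rfl; simp [h] at hx0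
  induction n with
  | zero => simp [hc.kap_one]
  | succ n ih =>
    have hy0 : y ≠ 0 := by simpa using hy0
    rw [pow_succ, hc.kap_mul (by rw [map_pow, hy]) hy (pow_ne_zero _ hy0) hy0,
      ih (pow_ne_zero _ hy0) (Or.inr hy0)]
    push_cast; ring
theorem Cx.kap_const {s : Ω ≃ₐ[k] Ω} {x : Ω} {n : ℕ} (hn : n ≠ 0) (hx : s x = x)
    (h : x ^ n = 1) : kap (ℓ := ℓ) ζ s x = 0 := by
  have := hc.kap_zpow_root hx one_ne_zero h
  rw [hc.kap_one] at this
  rcases mul_eq_zero.1 this.symm with h | h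
  · exact absurd (by exact_mod_cast h) hn
  · exact h
theorem Cx.kap_smul {s : Ω ≃ₐ[k] Ω} {x : Ω} {c : k} {n : ℕ} (hn : n ≠ 0) (hc1 : c ^ n = 1)
    (hx : s x = x) (hx0 : x ≠ 0) : kap (ℓ := ℓ) ζ s (c • x) = kap ζ s x := by
  have hc0 : c ≠ 0 := by rintro rfl; simp [hn] at hc1
  have h1 : algebraMap k Ω c ^ n = 1 := by rw [← map_pow, hc1, map_one]
  rw [Algebra.smul_def, hc.kap_mul (s.commutes c) hx (by simpa using hc0) hx0,
    hc.kap_const hn (s.commutes c) h1, zero_add]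
theorem Cx.kap_comp {s t : Ω ≃ₐ[k] Ω} {x : Ω} (hx : s x = x) (hx' : t x = x) (hx0 : x ≠ 0) :
    kap (ℓ := ℓ) ζ (s * t) x = kap ζ s x + kap ζ t x := by
  apply hc.kap_uniq (by rw [AlgEquiv.mul_apply, hx', hx]) hx0
  intro n
  obtain ⟨r, hr⟩ := hc.root n x
  refine ⟨r, hr, ?_⟩
  rw [AlgEquiv.mul_apply, hc.kap_spec hx' hr, map_smul, hc.kap_spec hx hr, hc.zp_add, smul_smul,
    mul_comm]
omit hc in
theorem pow_fix {s : Ω ≃ₐ[k] Ω} {x : Ω} (hx : s x = x) (n : ℕ) : (s ^ n) x = x := by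
  induction n with
  | zero => simp
  | succ n ih => rw [pow_succ, AlgEquiv.mul_apply, hx, ih]
theorem Cx.kap_one_left {x : Ω} (hx0 : x ≠ 0) :
    kap (ℓ := ℓ) ζ (1 : Ω ≃ₐ[k] Ω) x = 0 := by
  apply hc.kap_uniq rfl hx0
  intro n
  obtain ⟨r, hr⟩ := hc.root n x
  exact ⟨r, hr, by simp [hc.zp_zero]⟩
theorem Cx.kap_pow {s : Ω ≃ₐ[k] Ω} {x : Ω} (hx : s x = x) (hx0 : x ≠ 0) (n : ℕ) :
    kap (ℓ := ℓ) ζ (s ^ n) x = (n : ℤ_[ℓ]) * kap ζ s x := by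
  induction n with
  | zero => simp [hc.kap_one_left hx0]
  | succ n ih =>
    rw [pow_succ, hc.kap_comp (pow_fix hx n) hx hx0, ih]; push_cast; ring
theorem Cx.kap_conj {s g : Ω ≃ₐ[k] Ω} {x : Ω} (hx : s x = x) (hx0 : x ≠ 0) (hsg : s * g = g * s) :
    kap (ℓ := ℓ) ζ s (g x) = kap ζ s x := by
  have hsg' : ∀ y, s (g y) = g (s y) := fun y => by
    rw [← AlgEquiv.mul_apply, hsg, AlgEquiv.mul_apply]
  apply hc.kap_uniq (by rw [hsg', hx]) (by simpa using hx0)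
  intro n
  obtain ⟨r, hr⟩ := hc.root n x
  refine ⟨g r, by rw [← map_pow, hr], ?_⟩
  rw [hsg', hc.kap_spec hx hr, map_smul]
theorem Cx.kap_conj' {s g : Ω ≃ₐ[k] Ω} {x : Ω} (hx : s x = x) (hx0 : x ≠ 0) :
    kap (ℓ := ℓ) ζ (g * s * g⁻¹) (g x) = kap ζ s x := by
  have e : ∀ y, (g * s * g⁻¹) (g y) = g (s y) := fun y => by
    rw [AlgEquiv.mul_apply, AlgEquiv.mul_apply]
    congr 2
    exact g.symm_apply_apply y
  apply hc.kap_uniq (by rw [e, hx]) (by simpa using hx0)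
  intro n
  obtain ⟨r, hr⟩ := hc.root n x
  refine ⟨g r, by rw [← map_pow, hr], ?_⟩
  rw [e, hc.kap_spec hx hr, map_smul]
theorem Cx.cpair0 {s t : Ω ≃ₐ[k] Ω} (hst : s * t = t * s) {x : Ω} (hs : s x = x) (ht : t x = x)
    (hx0 : x ≠ 0) (hx1 : 1 - x ≠ 0) (hu : IsUnit (kap (ℓ := ℓ) ζ s x)) :
    kap (ℓ := ℓ) ζ s x * kap ζ t (1 - x) = kap ζ t x * kap ζ s (1 - x) := by
  rw [← sub_eq_zero]
  apply eq_zero_of_forall_dvd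
  intro n
  obtain ⟨u, hu'⟩ := hu
  set v : ℤ_[ℓ] := kap ζ t x
  obtain ⟨y, hy⟩ := hc.root n x
  have hy0 : y ≠ 0 := by rintro rfl; exact hx0 (by rw [← hy, zero_pow (hc.lpos n).ne'])
  set c : ℕ := (PadicInt.toZModPow n (v * ((u⁻¹ : ℤ_[ℓ]ˣ) : ℤ_[ℓ]))).val
  have hcu : (ℓ : ℤ_[ℓ]) ^ n ∣ c * u - v := by
    have h1 : (ℓ : ℤ_[ℓ]) ^ n ∣ c - v * ((u⁻¹ : ℤ_[ℓ]ˣ) : ℤ_[ℓ]) := by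
      rw [← Ideal.mem_span_singleton, ← PadicInt.ker_toZModPow, RingHom.mem_ker, map_sub,
        map_natCast, ← hc.zp_rep, sub_self]
    have h2 := Dvd.dvd.mul_right h1 (u : ℤ_[ℓ])
    rw [sub_mul, mul_assoc, Units.inv_mul, mul_one] at h2
    exact h2
  have hcomm : ∀ (j : ℕ) z, t ((s ^ j) z) = (s ^ j) (t z) := by
    intro j z
    have : Commute s t := hst
    rw [← AlgEquiv.mul_apply, ← (this.pow_left j).eq, AlgEquiv.mul_apply]
  have hsy : ∀ j : ℕ, (s ^ j) y = (zp ζ n (u : ℤ_[ℓ])) ^ j • y := by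
    intro j
    rw [hc.kap_spec (pow_fix hs j) hy, hc.kap_pow hs hx0, ← hu', hc.zp_nsmul]
  have hty : t y = (s ^ c) y := by
    rw [hc.kap_spec ht hy, hc.kap_spec (pow_fix hs c) hy, hc.kap_pow hs hx0, ← hu']
    congr 1; symm; exact hc.zp_congr hcu
  obtain ⟨z, hz⟩ := hc.root n (1 - y)
  set P := ∏ j ∈ Finset.range (ℓ ^ n), (s ^ j) z with hP
  have hPn : P ^ (ℓ ^ n) = 1 - x := by
    rw [hP, ← Finset.prod_pow, ← hy, ← hc.prod_one_sub (hc.zp_prim u.isUnit)]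
    apply Finset.prod_congr rfl
    intro j _
    rw [← map_pow, hz, map_sub, map_one, hsy]
  obtain ⟨b, hb⟩ := hc.root_ratio (n := n) (r := (s ^ c) z) (r' := t z) (by
    rw [← map_pow, ← map_pow, hz, map_sub, map_sub, map_one, map_one, hty])
  have htP : t P = (s ^ c) P := by
    rw [hP, map_prod, map_prod]
    have : ∀ j ∈ Finset.range (ℓ ^ n), t ((s ^ j) z) =
        algebraMap k Ω (ζ n ^ b) * (s ^ c) ((s ^ j) z) := by
      intro j _
      rw [hcomm, hb, map_smul, Algebra.smul_def]
      congr 1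
      rw [← AlgEquiv.mul_apply, ← AlgEquiv.mul_apply, ← pow_add, ← pow_add, add_comm]
    rw [Finset.prod_congr rfl this, Finset.prod_mul_distrib, Finset.prod_const, Finset.card_range,
      ← map_pow, ← pow_mul, mul_comm b, pow_mul, (hc.prim n).pow_eq_one]
    simp
  have hs1 : s (1 - x) = 1 - x := by rw [map_sub, map_one, hs]
  have ht1 : t (1 - x) = 1 - x := by rw [map_sub, map_one, ht]
  rw [hc.kap_spec (pow_fix hs1 c) hPn, hc.kap_pow hs1 hx1] at htP
  have h3 := hc.kap_dvd ht1 hx1 hPn htP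
  rw [← hu']
  have e : (u : ℤ_[ℓ]) * kap ζ t (1 - x) - v * kap ζ s (1 - x) =
    (u : ℤ_[ℓ]) * (kap ζ t (1 - x) - (c : ℤ_[ℓ]) * kap ζ s (1 - x)) +
      ((c : ℤ_[ℓ]) * (u : ℤ_[ℓ]) - v) * kap ζ s (1 - x) := by ring
  rw [e]
  exact dvd_add (Dvd.dvd.mul_left h3 _) (Dvd.dvd.mul_right hcu _)
theorem Cx.kap_prod {s : Ω ≃ₐ[k] Ω} {ι : Type*} (S : Finset ι) (f : ι → Ω)
    (hf : ∀ i ∈ S, s (f i) = f i) (hf0 : ∀ i ∈ S, f i ≠ 0) :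
    kap (ℓ := ℓ) ζ s (∏ i ∈ S, f i) = ∑ i ∈ S, kap ζ s (f i) := by
  classical
  induction S using Finset.induction_on with
  | empty => simp [hc.kap_one]
  | insert a S ha ih =>
    rw [Finset.prod_insert ha, Finset.sum_insert ha, hc.kap_mul, ih]
    · exact fun i hi => hf i (Finset.mem_insert_of_mem hi)
    · exact fun i hi => hf0 i (Finset.mem_insert_of_mem hi)
    · exact hf a (Finset.mem_insert_self _ _)
    · rw [map_prod]; exact Finset.prod_congr rfl fun i hi => hf i (Finset.mem_insert_of_mem hi)
    · exact hf0 a (Finset.mem_insert_self _ _)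
    · rw [Finset.prod_ne_zero_iff]; exact fun i hi => hf0 i (Finset.mem_insert_of_mem hi)
theorem Cx.cpair1 {s t : Ω ≃ₐ[k] Ω} (hst : s * t = t * s) {x : Ω} (hs : s x = x) (ht : t x = x)
    (hx0 : x ≠ 0) (hx1 : 1 - x ≠ 0) (hd : kap (ℓ := ℓ) ζ s x ∣ kap (ℓ := ℓ) ζ t x) :
    kap (ℓ := ℓ) ζ s x * kap ζ t (1 - x) = kap ζ t x * kap ζ s (1 - x) := by
  by_cases h0 : kap (ℓ := ℓ) ζ s x = 0
  · rw [h0, zero_dvd_iff] at hd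
    rw [h0, hd, zero_mul, zero_mul]
  set e := (kap (ℓ := ℓ) ζ s x).valuation
  have hu := PadicInt.unitCoeff_spec h0
  set u := PadicInt.unitCoeff h0
  have hes : (ℓ : ℤ_[ℓ]) ^ e ∣ kap (ℓ := ℓ) ζ s x := ⟨u, by rw [hu, mul_comm]⟩
  obtain ⟨y, hy⟩ := hc.root e x
  have hy0 : y ≠ 0 := by rintro rfl; exact hx0 (by rw [← hy, zero_pow (hc.lpos e).ne'])
  have hsy : s y = y := (hc.fix_iff hs hx0 hy).2 hes
  have hty : t y = y := (hc.fix_iff ht hx0 hy).2 (hes.trans hd)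
  have k1 := hc.kap_zpow_root hsy hx0 hy
  have k2 := hc.kap_zpow_root hty hx0 hy
  have hle : ((ℓ ^ e : ℕ) : ℤ_[ℓ]) ≠ 0 := by exact_mod_cast (hc.lpos e).ne'
  have hyu : kap (ℓ := ℓ) ζ s y = u := by
    apply mul_left_cancel₀ hle
    rw [← k1, hu]; push_cast; rw [mul_comm]
  rw [← hy, ← hc.prod_one_sub (hc.prim e)] at hx1 ⊢
  rw [Finset.prod_ne_zero_iff] at hx1
  have fs : ∀ j, s (1 - ζ e ^ j • y) = 1 - ζ e ^ j • y := fun j => by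
    rw [map_sub, map_one, map_smul, hsy]
  have ft : ∀ j, t (1 - ζ e ^ j • y) = 1 - ζ e ^ j • y := fun j => by
    rw [map_sub, map_one, map_smul, hty]
  rw [hc.kap_prod _ _ (fun j _ => fs j) hx1, hc.kap_prod _ _ (fun j _ => ft j) hx1, hy, k1, k2,
    mul_assoc, mul_assoc]
  congr 1
  rw [Finset.mul_sum, Finset.mul_sum]
  apply Finset.sum_congr rfl
  intro j hj
  have hz1 : (ζ e ^ j) ^ (ℓ ^ e) = 1 := by
    rw [← pow_mul, mul_comm, pow_mul, (hc.prim e).pow_eq_one, one_pow]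
  have ks := hc.kap_smul (s := s) (hc.lpos e).ne' hz1 hsy hy0
  have kt := hc.kap_smul (s := t) (hc.lpos e).ne' hz1 hty hy0
  have hzy : ζ e ^ j • y ≠ 0 :=
    smul_ne_zero (pow_ne_zero _ ((hc.prim e).ne_zero (hc.lpos e).ne')) hy0
  have := hc.cpair0 hst (x := ζ e ^ j • y) (by rw [map_smul, hsy]) (by rw [map_smul, hty])
    hzy (hx1 j hj) (by rw [ks, hyu]; exact u.isUnit)
  rwa [ks, kt] at this
theorem Cx.cpair {s t : Ω ≃ₐ[k] Ω} (hst : s * t = t * s) {x : Ω} (hs : s x = x) (ht : t x = x)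
    (hx0 : x ≠ 0) (hx1 : 1 - x ≠ 0) :
    kap (ℓ := ℓ) ζ s x * kap ζ t (1 - x) = kap ζ t x * kap ζ s (1 - x) := by
  rcases ValuationRing.dvd_total (kap (ℓ := ℓ) ζ s x) (kap (ℓ := ℓ) ζ t x) with h | h
  · exact hc.cpair1 hst hs ht hx0 hx1 h
  · exact (hc.cpair1 hst.symm ht hs hx0 hx1 h).symm
end K
end S5
namespace S5
theorem KI {F A ι : Type*} [Field F] [Field A] [Algebra F A] {q : ℕ} {ξ : F}
    (hξ : IsPrimitiveRoot ξ q) (hq : (q : F) ≠ 0) (r : ι → A) (hr0 : ∀ i, r i ≠ 0)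
    (hr : ∀ i, ∃ b : F, r i ^ q = algebraMap F A b)
    (hne : ∀ i j, i ≠ j → ∀ c : F, r i ≠ algebraMap F A c * r j) :
    LinearIndependent F r := by
  let B := AlgebraicClosure A
  let S := separableClosure F B
  have hq0 : 0 < q := Nat.pos_of_ne_zero (by rintro rfl; simp at hq)
  have hmem : ∀ i, algebraMap A B (r i) ∈ S := by
    intro i
    obtain ⟨b, hb⟩ := hr i
    have hb0 : b ≠ 0 := by
      rintro rfl; rw [map_zero] at hb; exact hr0 i (pow_eq_zero_iff hq0.ne' |>.1 hb)
    rw [mem_separableClosure_iff]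
    refine (Polynomial.separable_X_pow_sub_C b hq hb0).of_dvd (minpoly.dvd F _ ?_)
    rw [map_sub, map_pow, Polynomial.aeval_X, Polynomial.aeval_C, ← map_pow, hb,
      ← IsScalarTower.algebraMap_apply F A B, sub_self]
  let R : ι → S := fun i => ⟨_, hmem i⟩
  have hR0 : ∀ i, R i ≠ 0 := fun i h => hr0 i (by
    have := congrArg Subtype.val h
    simpa [R] using this)
  have hR : ∀ i, ∃ b : F, R i ^ q = algebraMap F S b := by
    intro i
    obtain ⟨b, hb⟩ := hr i
    refine ⟨b, Subtype.ext ?_⟩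
    change algebraMap A B (r i) ^ q = algebraMap F B b
    rw [← map_pow, hb, ← IsScalarTower.algebraMap_apply F A B]
  have hroot : ∀ i (τ : S ≃ₐ[F] S), ∃ c : F, τ (R i) = algebraMap F S c * R i := by
    intro i τ
    obtain ⟨b, hb⟩ := hR i
    have h1 : (τ (R i) / R i) ^ q = 1 := by
      rw [div_pow, ← map_pow, hb, AlgEquiv.commutes, div_self]
      rw [← hb]; exact pow_ne_zero _ (hR0 i)
    haveI : NeZero q := ⟨hq0.ne'⟩
    obtain ⟨a, -, ha⟩ := (hξ.map_of_injective (algebraMap F S).injective).eq_pow_of_pow_eq_one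
      h1
    refine ⟨ξ ^ a, ?_⟩
    rw [map_pow, ha, div_mul_cancel₀ _ (hR0 i)]
  let χ : ι → ((S ≃ₐ[F] S) →* S) := fun i =>
    { toFun := fun τ => τ (R i) / R i
      map_one' := by simp [hR0 i]
      map_mul' := by
        intro τ τ'
        obtain ⟨c, hc⟩ := hroot i τ'
        obtain ⟨c', hc'⟩ := hroot i τ
        rw [AlgEquiv.mul_apply, hc, map_mul, AlgEquiv.commutes, hc']
        have := hR0 i
        field_simp }
  have hχ : Function.Injective χ := by
    intro i j hij
    by_contra hn
    have h2 : ∀ τ : S ≃ₐ[F] S, τ (R i / R j) = R i / R j := by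
      intro τ
      have h3 : τ (R i) / R i = τ (R j) / R j := DFunLike.congr_fun hij τ
      rw [div_eq_div_iff (hR0 i) (hR0 j)] at h3
      rw [map_div₀, div_eq_div_iff _ (hR0 j)]
      · linear_combination h3
      · simpa using hR0 j
    obtain ⟨c, hc⟩ := (InfiniteGalois.mem_range_algebraMap_iff_fixed (k := F) (K := S) _).2 h2
    rw [eq_div_iff (hR0 j)] at hc
    apply hne i j hn c
    have := congrArg Subtype.val hc
    apply (algebraMap A B).injective
    rw [map_mul, ← IsScalarTower.algebraMap_apply F A B]
    exact this.symm
  have hD := (linearIndependent_monoidHom (S ≃ₐ[F] S) S).comp χ hχ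
  rw [linearIndependent_iff'] at hD ⊢
  intro s g hg i hi
  have h4 : ∑ j ∈ s, algebraMap F S (g j) * R j = 0 := by
    apply Subtype.ext
    have := congrArg (algebraMap A B) hg
    simp only [map_sum, Algebra.smul_def, map_mul, map_zero] at this
    rw [AddSubmonoidClass.coe_finset_sum]
    rw [← ZeroMemClass.coe_zero S] at this
    rw [← this]
    refine Finset.sum_congr rfl fun j _ => ?_
    rw [← IsScalarTower.algebraMap_apply F A B]; rfl
  have := hD s (fun j => algebraMap F S (g j) * R j) (by
    funext τ
    simp only [Finset.sum_apply, Pi.smul_apply, Function.comp, Pi.zero_apply, smul_eq_mul]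
    rw [← map_zero τ, ← h4, map_sum]
    refine Finset.sum_congr rfl fun j _ => ?_
    change _ * (τ (R j) / R j) = _
    rw [map_mul, AlgEquiv.commutes]
    have := hR0 j
    field_simp) i hi
  simpa [hR0 i] using this
section V
variable {ℓ : ℕ} [hℓ : Fact ℓ.Prime] {k Ω : Type*} [Field k] [Field Ω] [Algebra k Ω] {ζ : ℕ → k}
def resSub (O : ValuationSubring Ω) (Λ : IntermediateField k Ω) :
    Subfield (IsLocalRing.ResidueField O) where
  carrier := {a | ∃ x : O, (x : Ω) ∈ Λ ∧ IsLocalRing.residue O x = a}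
  mul_mem' := by
    rintro _ _ ⟨x, hx, rfl⟩ ⟨y, hy, rfl⟩
    exact ⟨x * y, mul_mem hx hy, map_mul _ _ _⟩
  add_mem' := by
    rintro _ _ ⟨x, hx, rfl⟩ ⟨y, hy, rfl⟩
    exact ⟨x + y, add_mem hx hy, map_add _ _ _⟩
  one_mem' := ⟨1, one_mem Λ, map_one _⟩
  zero_mem' := ⟨0, zero_mem Λ, map_zero _⟩
  neg_mem' := by
    rintro _ ⟨x, hx, rfl⟩
    exact ⟨-x, neg_mem hx, map_neg _ _⟩
  inv_mem' := by
    rintro _ ⟨x, hx, rfl⟩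
    by_cases h : IsUnit x
    · obtain ⟨u, rfl⟩ := h
      refine ⟨(u⁻¹ : Oˣ), ?_, ?_⟩
      · have : ((u⁻¹ : Oˣ) : O) = ((u : O) : Ω)⁻¹ := by
          apply eq_inv_of_mul_eq_one_left
          rw [← MulMemClass.coe_mul, Units.inv_mul]; rfl
        rw [this]; exact inv_mem hx
      · rw [eq_comm]
        apply inv_eq_of_mul_eq_one_left
        rw [← map_mul, Units.inv_mul, map_one]
    · rw [(IsLocalRing.residue_eq_zero_iff x).2 h, inv_zero]
      exact ⟨0, zero_mem Λ, map_zero _⟩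
theorem res_zero {O : ValuationSubring Ω} (x : O) :
    IsLocalRing.residue O x = 0 ↔ O.valuation (x : Ω) < 1 := by
  rw [IsLocalRing.residue_eq_zero_iff, ValuationSubring.valuation_lt_one_iff]
variable (hc : Cx ℓ Ω ζ)
include hc
omit hℓ in
theorem Cx.vk (O : ValuationSubring Ω) {c : k} (h : c ≠ 0) : O.valuation (algebraMap k Ω c) = 1 := by
  obtain ⟨n, hn, hcn⟩ := hc.tors c h
  have : O.valuation (algebraMap k Ω c) ^ n = 1 := by
    rw [← map_pow, ← map_pow, hcn, map_one, map_one]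
  exact (pow_eq_one_iff.1 this).resolve_right hn
omit hℓ in
theorem Cx.vsm (O : ValuationSubring Ω) {c : k} (h : c ≠ 0) (x : Ω) :
    O.valuation (c • x) = O.valuation x := by
  rw [Algebra.smul_def, map_mul, hc.vk O h, one_mul]
omit hℓ in
theorem Cx.kmem (O : ValuationSubring Ω) (c : k) : algebraMap k Ω c ∈ O := by
  by_cases h : c = 0
  · rw [h, map_zero]; exact zero_mem O
  · rw [← ValuationSubring.valuation_le_one_iff, hc.vk O h]
theorem Cx.VKI (O : ValuationSubring Ω) (Λ : IntermediateField k Ω) {n : ℕ} {ι : Type*}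
    (S : Finset ι) (r : ι → Ω) (hr : ∀ i ∈ S, r i ^ (ℓ ^ n) ∈ Λ)
    (hne : ∀ i ∈ S, ∀ j ∈ S, i ≠ j → ∀ c ∈ Λ, ¬ O.valuation (r i - c * r j) < O.valuation (r i)) :
    ∀ i ∈ S, O.valuation (r i) ≤ O.valuation (∑ j ∈ S, r j) := by
  classical
  intro i0 hi0
  obtain ⟨m, hm, hmax⟩ := S.exists_max_image (fun i => O.valuation (r i)) ⟨i0, hi0⟩
  refine (hmax i0 hi0).trans ?_
  by_cases hm0 : r m = 0
  · rw [hm0, map_zero]; exact zero_le'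
  have hvm : O.valuation (r m) ≠ 0 := by simpa using hm0
  have hvm' : 0 < O.valuation (r m) := zero_lt_iff.2 hvm
  let R : ι → Ω := fun i => r i / r m
  have hRle : ∀ i ∈ S, O.valuation (R i) ≤ 1 := fun i hi => by
    simp only [R, map_div₀]; exact div_le_one_of_le₀ (hmax i hi) zero_le'
  let S1 := S.filter (fun i => O.valuation (R i) = 1)
  have hF : algebraMap k Ω (ζ n) ∈ Λ := Λ.algebraMap_mem _
  let F := resSub O Λ
  let A := IsLocalRing.ResidueField O
  let κ : k →+* F :=
    { toFun := fun c => ⟨IsLocalRing.residue O ⟨algebraMap k Ω c, hc.kmem O c⟩, ⟨_, Λ.algebraMap_mem c, rfl⟩⟩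
      map_one' := by apply Subtype.ext; change IsLocalRing.residue O _ = 1; rw [← map_one (IsLocalRing.residue O)]; congr 1; exact Subtype.ext (map_one _)
      map_zero' := by apply Subtype.ext; change IsLocalRing.residue O _ = 0; rw [← map_zero (IsLocalRing.residue O)]; congr 1; exact Subtype.ext (map_zero _)
      map_mul' := fun x y => by apply Subtype.ext; change IsLocalRing.residue O _ = IsLocalRing.residue O _ * IsLocalRing.residue O _; rw [← map_mul (IsLocalRing.residue O)]; congr 1; exact Subtype.ext (map_mul _ _ _)
      map_add' := fun x y => by apply Subtype.ext; change IsLocalRing.residue O _ = IsLocalRing.residue O _ + IsLocalRing.residue O _; rw [← map_add (IsLocalRing.residue O)]; congr 1; exact Subtype.ext (map_add _ _ _) }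
  have hS1 : ∀ i : S1, i.1 ∈ S ∧ O.valuation (R i) = 1 := fun i => Finset.mem_filter.1 i.2
  let ρ : S1 → A := fun i => IsLocalRing.residue O ⟨R i, (O.valuation_le_one_iff _).1 (hS1 i).2.le⟩
  have hρ0 : ∀ i, ρ i ≠ 0 := fun i h => by
    rw [res_zero] at h; exact h.ne (hS1 i).2
  have hli : LinearIndependent F ρ := by
    refine KI (q := ℓ ^ n) (ξ := κ (ζ n)) ((hc.prim n).map_of_injective κ.injective) ?_ ρ hρ0 ?_ ?_
    · rw [Nat.cast_pow]
      refine pow_ne_zero _ ?_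
      rw [← map_natCast κ]
      exact (map_ne_zero κ).2 hc.lne
    · intro i
      refine ⟨⟨ρ i ^ (ℓ ^ n), ⟨⟨R i, _⟩ ^ (ℓ ^ n), ?_, map_pow _ _ _⟩⟩, rfl⟩
      change (R i) ^ (ℓ ^ n) ∈ Λ
      rw [div_pow]
      exact div_mem (hr _ (hS1 i).1) (hr _ hm)
    · rintro i j hij ⟨c, ⟨⟨c, hcO⟩, hcΛ, rfl⟩⟩ h
      refine hne i (hS1 i).1 j (hS1 j).1 (fun h => hij (Subtype.ext h)) c hcΛ ?_
      change IsLocalRing.residue O _ = IsLocalRing.residue O _ * IsLocalRing.residue O _ at h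
      rw [← map_mul, ← sub_eq_zero, ← map_sub, res_zero] at h
      change O.valuation (r i / r m - c * (r j / r m)) < 1 at h
      rw [mul_div_assoc', ← sub_div, map_div₀, div_lt_one₀ hvm'] at h
      have : O.valuation (r i) = O.valuation (r m) := by
        have := (hS1 i).2
        simp only [R, map_div₀] at this
        rwa [div_eq_one_iff_eq hvm] at this
      rwa [this]
  have hm1 : m ∈ S1 := Finset.mem_filter.2 ⟨hm, by simp [R, div_self hm0]⟩
  have h1 : O.valuation (∑ j : S1, R j) = 1 := by
    have hmem : (∑ j : S1, R j) ∈ O := sum_mem fun j _ => (O.valuation_le_one_iff _).1 (hS1 j).2.le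
    refine le_antisymm ((O.valuation_le_one_iff _).2 hmem) (not_lt.1 fun h => ?_)
    rw [← res_zero (O := O) ⟨_, hmem⟩] at h
    rw [linearIndependent_iff'] at hli
    have := hli Finset.univ (fun _ => 1) (by
      simp only [one_smul, ρ]
      rw [← map_sum, ← h]; congr 1; apply Subtype.ext; simp) ⟨m, hm1⟩ (Finset.mem_univ _)
    exact one_ne_zero this
  have h1 : O.valuation (∑ j ∈ S1, R j) = 1 := by rw [← Finset.sum_coe_sort]; exact h1
  have h2 : O.valuation (∑ j ∈ S.filter (fun i => ¬ O.valuation (R i) = 1), R j) < 1 := by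
    refine Valuation.map_sum_lt _ one_ne_zero fun j hj => ?_
    rw [Finset.mem_filter] at hj
    exact lt_of_le_of_ne (hRle j hj.1) hj.2
  have h3 : O.valuation (∑ j ∈ S, R j) = 1 := by
    rw [← Finset.sum_filter_add_sum_filter_not S (fun i => O.valuation (R i) = 1), Valuation.map_add_eq_of_lt_left]
    · exact h1
    · exact h2.trans_eq h1.symm
  simp only [R] at h3
  rw [← Finset.sum_div, map_div₀, div_eq_one_iff_eq hvm] at h3
  exact h3.ge
omit hc hℓ in
theorem ExtV {Λ Ω : Type*} [Field Λ] [Field Ω] (f : Λ →+* Ω) (O : ValuationSubring Λ) :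
    ∃ O' : ValuationSubring Ω, O'.comap f = O := by
  obtain ⟨B, hB, hl⟩ := LocalSubring.exists_le_valuationSubring
    (LocalSubring.range (f.comp O.subtype))
  refine ⟨B, ?_⟩
  have h1 : ∀ x ∈ O, f x ∈ B := fun x hx => hB ⟨⟨x, hx⟩, rfl⟩
  ext x
  rw [ValuationSubring.mem_comap]
  refine ⟨fun hx => ?_, h1 x⟩
  by_contra hn
  have hx0 : x ≠ 0 := by rintro rfl; exact hn (zero_mem O)
  have hi : x⁻¹ ∈ O := (O.mem_or_inv_mem x).resolve_left hn
  have hu : IsUnit (Subring.inclusion hB ⟨f x⁻¹, ⟨⟨x⁻¹, hi⟩, rfl⟩⟩) := by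
    refine IsUnit.of_mul_eq_one ⟨f x, hx⟩ (Subtype.ext ?_)
    change f x⁻¹ * f x = 1
    rw [← map_mul, inv_mul_cancel₀ hx0, map_one]
  have hu' := hl.map_nonunit _ hu
  obtain ⟨⟨_, ⟨y, hy⟩, rfl⟩, h2⟩ := hu'.exists_right_inv
  apply hn
  have h3 : f x⁻¹ * f y = 1 := congrArg Subtype.val h2
  rw [← map_mul, ← map_one f] at h3
  have h4 := f.injective h3
  have : (y : Λ) = x := by field_simp at h4; exact h4
  rw [← this]; exact hy
noncomputable def prj (q : ℕ) (ξ : k) (s : Ω ≃ₐ[k] Ω) (i : ℕ) (z : Ω) : Ω :=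
  ∑ a ∈ Finset.range q, ((q : k)⁻¹ * (ξ ^ (i * a))⁻¹) • (s ^ a) z
omit hc hℓ in
theorem prj_sum {q : ℕ} {ξ : k} (hξ : IsPrimitiveRoot ξ q) (hq : (q : k) ≠ 0)
    (s : Ω ≃ₐ[k] Ω) (z : Ω) : ∑ i ∈ Finset.range q, prj q ξ s i z = z := by
  have hq0 : 0 < q := Nat.pos_of_ne_zero (by rintro rfl; simp at hq)
  unfold prj
  rw [Finset.sum_comm, Finset.sum_eq_single 0]
  · simp [← Finset.sum_smul, hq]
    rw [← map_natCast (algebraMap k Ω) q, ← Algebra.smul_def, smul_smul, inv_mul_cancel₀ hq, one_smul]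
  · intro a ha ha0
    rw [← Finset.sum_smul, ← Finset.mul_sum]
    have h1 : ∑ i ∈ Finset.range q, (ξ ^ (i * a))⁻¹ = 0 := by
      have hne : (ξ ^ a)⁻¹ ≠ 1 := by
        rw [inv_ne_one]
        exact hξ.pow_ne_one_of_pos_of_lt ha0 (Finset.mem_range.1 ha)
      have h2 := geom_sum_eq hne q
      rw [inv_pow, ← pow_mul, mul_comm a q, pow_mul, hξ.pow_eq_one, one_pow, inv_one, sub_self, zero_div] at h2
      rw [← h2]
      refine Finset.sum_congr rfl fun i _ => ?_
      rw [inv_pow, ← pow_mul, mul_comm]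
    rw [h1, mul_zero, zero_smul]
  · intro h; simp at h; omega
omit hc hℓ in
theorem prj_eig {q : ℕ} {ξ : k} (hξ : ξ ^ q = 1) (hξ0 : ξ ≠ 0)
    (s : Ω ≃ₐ[k] Ω) (i : ℕ) (z : Ω) (hz : (s ^ q) z = z) :
    s (prj q ξ s i z) = (ξ ^ i) • prj q ξ s i z := by
  unfold prj
  rw [map_sum, Finset.smul_sum]
  let f : ℕ → Ω := fun a => (ξ ^ i * ((q : k)⁻¹ * (ξ ^ (i * a))⁻¹)) • (s ^ a) z
  have h1 : ∀ a, s (((q : k)⁻¹ * (ξ ^ (i * a))⁻¹) • (s ^ a) z) = f (a + 1) := by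
    intro a
    rw [map_smul, ← AlgEquiv.mul_apply, ← pow_succ']
    simp only [f]
    congr 1
    rw [mul_add, mul_one, pow_add]
    have := pow_ne_zero i hξ0
    have := pow_ne_zero (i * a) hξ0
    field_simp
  have h2 : f q = f 0 := by
    simp only [f]
    rw [hz, mul_comm i q, pow_mul, hξ]; simp
  simp only [h1, smul_smul]
  have := Finset.sum_range_succ f q
  rw [Finset.sum_range_succ', h2] at this
  exact add_right_cancel this
omit hc hℓ in
theorem prj_comm {q : ℕ} {ξ : k} {s t : Ω ≃ₐ[k] Ω} (hst : s * t = t * s) (i : ℕ) (z : Ω) :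
    t (prj q ξ s i z) = prj q ξ s i (t z) := by
  unfold prj
  rw [map_sum]
  refine Finset.sum_congr rfl fun a _ => ?_
  rw [map_smul, ← AlgEquiv.mul_apply, ← AlgEquiv.mul_apply,
    ((show Commute s t from hst).pow_left a).eq]
omit hc hℓ in
theorem prj_smul {q : ℕ} {ξ : k} {s : Ω ≃ₐ[k] Ω} (i : ℕ) (c : k) (z : Ω) :
    prj q ξ s i (c • z) = c • prj q ξ s i z := by
  unfold prj
  rw [Finset.smul_sum]
  refine Finset.sum_congr rfl fun a _ => ?_
  rw [map_smul, smul_comm]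
theorem Cx.qne (n : ℕ) : ((ℓ ^ n : ℕ) : k) ≠ 0 := by
  rw [Nat.cast_pow]; exact pow_ne_zero _ hc.lne
theorem Cx.zne (n : ℕ) : ζ n ≠ 0 := (hc.prim n).ne_zero (hc.lpos n).ne'
theorem Cx.dec {s t : Ω ≃ₐ[k] Ω} (hst : s * t = t * s) {n : ℕ} {z : Ω}
    (hs : (s ^ (ℓ ^ n)) z = z) (ht : (t ^ (ℓ ^ n)) z = z) : ∃ r : ℕ × ℕ → Ω,
    (∑ i ∈ Finset.range (ℓ ^ n) ×ˢ Finset.range (ℓ ^ n), r i = z) ∧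
    (∀ i, s (r i) = ζ n ^ i.1 • r i) ∧ ∀ i, t (r i) = ζ n ^ i.2 • r i := by
  have hts : t * s = s * t := hst.symm
  have h1 : ∀ i, (t ^ (ℓ ^ n)) (prj (ℓ ^ n) (ζ n) s i z) = prj (ℓ ^ n) (ζ n) s i z := by
    intro i
    rw [prj_comm ((show Commute s t from hst).pow_right _), ht]
  refine ⟨fun i => prj (ℓ ^ n) (ζ n) t i.2 (prj (ℓ ^ n) (ζ n) s i.1 z), ?_, ?_, ?_⟩
  · rw [Finset.sum_product]
    simp only [prj_sum (hc.prim n) (hc.qne n)]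
  · intro i
    rw [prj_comm hts, prj_eig (hc.prim n).pow_eq_one (hc.zne n) s _ _ hs, prj_smul]
  · intro i
    rw [prj_eig (hc.prim n).pow_eq_one (hc.zne n) t _ _ (h1 _)]
end V
end S5
namespace S5
section V
variable {ℓ : ℕ} [hℓ : Fact ℓ.Prime] {k Ω : Type*} [Field k] [Field Ω] [Algebra k Ω] {ζ : ℕ → k}
def fixF {ι : Type*} (s : ι → (Ω ≃ₐ[k] Ω)) : IntermediateField k Ω where
  carrier := {x | ∀ i, s i x = x}
  mul_mem' := fun {x y} hx hy i => by rw [map_mul, hx i, hy i]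
  one_mem' := fun i => map_one _
  add_mem' := fun {x y} hx hy i => by rw [map_add, hx i, hy i]
  zero_mem' := fun i => map_zero _
  algebraMap_mem' := fun c i => AlgEquiv.commutes _ _
  inv_mem' := fun x hx i => by rw [map_inv₀, hx i]
theorem mem_fixF {ι : Type*} {s : ι → (Ω ≃ₐ[k] Ω)} {x : Ω} : x ∈ fixF s ↔ ∀ i, s i x = x := Iff.rfl
theorem mem_fix2 {s t : Ω ≃ₐ[k] Ω} {x : Ω} : x ∈ fixF ![s, t] ↔ s x = x ∧ t x = x := by
  rw [mem_fixF, Fin.forall_fin_two]; rfl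
noncomputable def psi {ι : Type*} (ζ : ℕ → k) (s : ι → (Ω ≃ₐ[k] Ω)) (x : fixF s) : ι → ℚ_[ℓ] :=
  fun i => ((kap (ℓ := ℓ) ζ (s i) (x : Ω) : ℤ_[ℓ]) : ℚ_[ℓ])
variable (hc : Cx ℓ Ω ζ)
include hc
theorem Cx.rhyp {ι : Type*} {s : ι → (Ω ≃ₐ[k] Ω)} (hs : ∀ i j, s i * s j = s j * s i) :
    RHyp ℚ_[ℓ] (psi (ℓ := ℓ) ζ s) where
  mul := by
    intro x y hx hy
    funext i
    simp only [psi, Pi.add_apply]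
    rw [← PadicInt.coe_add, ← hc.kap_mul (x.2 i) (y.2 i) (by simpa using hx) (by simpa using hy)]
    rfl
  one_sub := by
    intro x hx hx1 hψ
    obtain ⟨i, hi⟩ := Function.ne_iff.1 hψ
    have hi : ((kap (ℓ := ℓ) ζ (s i) (x : Ω) : ℤ_[ℓ]) : ℚ_[ℓ]) ≠ 0 := hi
    refine ⟨(kap (ℓ := ℓ) ζ (s i) (1 - x : Ω) : ℤ_[ℓ]) / (kap (ℓ := ℓ) ζ (s i) (x : Ω) : ℤ_[ℓ]), ?_⟩
    funext j
    simp only [psi, Pi.smul_apply, smul_eq_mul]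
    have h1 := hc.cpair (hs i j) (x.2 i) (x.2 j) (by simpa using hx)
      (sub_ne_zero.2 fun h => hx1 (Subtype.ext h.symm))
    have h2 := congrArg (fun a : ℤ_[ℓ] => (a : ℚ_[ℓ])) h1
    simp only [PadicInt.coe_mul] at h2
    rw [div_mul_eq_mul_div, eq_div_iff hi, mul_comm, mul_comm ((kap (ℓ := ℓ) ζ (s i) (1 - x : Ω) : ℤ_[ℓ]) : ℚ_[ℓ])]
    exact h2
theorem Cx.core {s t : Ω ≃ₐ[k] Ω} (hst : s * t = t * s) (O : ValuationSubring Ω)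
    (hU : ∀ (u : Ω) (n : ℕ), u ^ (ℓ ^ n) ∈ fixF ![s, t] → O.valuation (u - 1) < 1 → u ∈ fixF ![s, t])
    {n : ℕ} {z : Ω} (hs : (s ^ (ℓ ^ n)) z = z) (ht : (t ^ (ℓ ^ n)) z = z) :
    ∃ (S : Finset (ℕ × ℕ)) (r : ℕ × ℕ → Ω), ∑ i ∈ S, r i = z ∧
      (∀ i, s (r i) = ζ n ^ i.1 • r i) ∧ (∀ i, t (r i) = ζ n ^ i.2 • r i) ∧
      ∀ c : ℕ × ℕ → k, (∀ i, c i ≠ 0) → ∀ i ∈ S, O.valuation (r i) ≤ O.valuation (∑ j ∈ S, c j • r j) := by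
  obtain ⟨r, h1, h2, h3⟩ := hc.dec hst hs ht
  refine ⟨_, r, h1, h2, h3, fun c hc0 i hi => ?_⟩
  rw [← hc.vsm O (hc0 i)]
  have hz : ∀ a, (ζ n ^ a) ^ (ℓ ^ n) = 1 := fun a => by
    rw [← pow_mul, mul_comm, pow_mul, (hc.prim n).pow_eq_one, one_pow]
  have hr : ∀ i, r i ^ (ℓ ^ n) ∈ fixF ![s, t] := fun i => by
    rw [mem_fix2, map_pow, map_pow, h2, h3, smul_pow, smul_pow, hz, hz]; simp
  refine hc.VKI O (fixF ![s, t]) (n := n) _ (fun i => c i • r i) ?_ ?_ i hi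
  · intro i _
    simp only [smul_pow]
    exact (fixF ![s, t]).smul_mem (hr i)
  · intro i hi j hj hij d hd hlt
    by_cases hri : r i = 0
    · simp [hri] at hlt
    have hri' : c i • r i ≠ 0 := smul_ne_zero (hc0 i) hri
    set u := (d * c j • r j) / (c i • r i) with hu
    have hv : O.valuation (u - 1) < 1 := by
      rw [← Valuation.map_neg, show -(u - 1) = (c i • r i - d * c j • r j) / (c i • r i) by
        rw [hu]; field_simp; ring, map_div₀]
      exact (div_lt_one₀ (zero_lt_iff.2 ((Valuation.ne_zero_iff _).2 hri'))).2 hlt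
    have hu0 : u ≠ 0 := by
      intro h; rw [h] at hv; simp at hv
    have hun : u ^ (ℓ ^ n) ∈ fixF ![s, t] := by
      rw [hu, div_pow, mul_pow, smul_pow, smul_pow]
      exact div_mem (mul_mem (pow_mem hd _) ((fixF ![s, t]).smul_mem (hr j)))
        ((fixF ![s, t]).smul_mem (hr i))
    have hf := mem_fix2.1 (hU u n hun hv)
    have hd' := mem_fix2.1 hd
    have hcr : u * (c i • r i) = d * c j • r j := by rw [hu, div_mul_cancel₀ _ hri']
    have hD : d * c j • r j ≠ 0 := by rw [← hcr]; exact mul_ne_zero hu0 hri'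
    have key : ∀ a b : ℕ, a < ℓ ^ n → b < ℓ ^ n → u * (c i • ζ n ^ a • r i) = d * c j • ζ n ^ b • r j → a = b := by
      intro a b ha hb h
      rw [smul_comm (c i), smul_comm (c j), mul_smul_comm (ζ n ^ a), mul_smul_comm (ζ n ^ b), hcr] at h
      have := smul_left_injective k hD h
      exact (hc.prim n).pow_inj ha hb this
    have e1 := congrArg s hcr
    have e2 := congrArg t hcr
    simp only [map_mul, map_smul, hf.1, hf.2, hd'.1, hd'.2, h2, h3] at e1 e2
    simp only [Finset.mem_product, Finset.mem_range] at hi hj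
    exact hij (Prod.ext (key _ _ hi.1 hj.1 e1) (key _ _ hi.2 hj.2 e2))
omit hc in
theorem pow_eig {s : Ω ≃ₐ[k] Ω} {c : k} {r : Ω} (h : s r = c • r) (a : ℕ) : (s ^ a) r = c ^ a • r := by
  induction a with
  | zero => simp
  | succ a ih => rw [pow_succ, AlgEquiv.mul_apply, h, map_smul, ih, smul_smul, pow_succ']
theorem Cx.R1 {s t g : Ω ≃ₐ[k] Ω} (hst : s * t = t * s) (O : ValuationSubring Ω)
    (hp : ∀ z, ∃ n, (s ^ (ℓ ^ n)) z = z ∧ (t ^ (ℓ ^ n)) z = z)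
    (hU : ∀ (u : Ω) (n : ℕ), u ^ (ℓ ^ n) ∈ fixF ![s, t] → O.valuation (u - 1) < 1 → u ∈ fixF ![s, t])
    (hg : ∀ z, ∃ a b : ℕ, g z = (s ^ a) ((t ^ b) z)) :
    (∀ z, g z ∈ O ↔ z ∈ O) ∧
      ((∀ (u : Ω) (n : ℕ), u ^ (ℓ ^ n) ∈ fixF ![s, t] → O.valuation u = 1 → g u = u) →
      ∀ z ∈ O, O.valuation (g z - z) < 1) := by
  have hz : ∀ z : Ω, ∃ (S : Finset (ℕ × ℕ)) (r : ℕ × ℕ → Ω) (c : ℕ × ℕ → k) (n : ℕ), ∑ i ∈ S, r i = z ∧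
      (∀ i, g (r i) = c i • r i) ∧ (∀ i, c i ≠ 0) ∧ (∀ i, r i ^ (ℓ ^ n) ∈ fixF ![s, t]) ∧
      ∀ c : ℕ × ℕ → k, (∀ i, c i ≠ 0) → ∀ i ∈ S, O.valuation (r i) ≤ O.valuation (∑ j ∈ S, c j • r j) := by
    intro z
    obtain ⟨n, hs, ht⟩ := hp z
    obtain ⟨S, r, h1, h2, h3, h4⟩ := hc.core hst O hU hs ht
    have : ∀ i, ∃ c : k, g (r i) = c • r i ∧ c ≠ 0 := by
      intro i
      obtain ⟨a, b, hab⟩ := hg (r i)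
      rw [pow_eig (h3 i), map_smul, pow_eig (h2 i), smul_smul] at hab
      exact ⟨_, hab, mul_ne_zero (pow_ne_zero _ (pow_ne_zero _ (hc.zne n)))
        (pow_ne_zero _ (pow_ne_zero _ (hc.zne n)))⟩
    choose c hc1 hc2 using this
    refine ⟨S, r, c, n, h1, hc1, hc2, fun i => ?_, h4⟩
    have hz : ∀ a, (ζ n ^ a) ^ (ℓ ^ n) = 1 := fun a => by
      rw [← pow_mul, mul_comm, pow_mul, (hc.prim n).pow_eq_one, one_pow]
    rw [mem_fix2, map_pow, map_pow, h2, h3, smul_pow, smul_pow, hz, hz]; simp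
  constructor
  · intro z
    obtain ⟨S, r, c, n, h1, h2, h3, -, h4⟩ := hz z
    have h5 : g z = ∑ i ∈ S, c i • r i := by rw [← h1, map_sum]; simp only [h2]
    constructor
    · intro h
      rw [← h1]
      refine sum_mem fun i hi => ?_
      rw [← ValuationSubring.valuation_le_one_iff] at h ⊢
      rw [h5] at h
      exact (h4 c h3 i hi).trans h
    · intro h
      rw [h5]
      refine sum_mem fun i hi => ?_
      rw [← ValuationSubring.valuation_le_one_iff] at h ⊢
      rw [hc.vsm O (h3 i)]
      refine (h4 (fun _ => 1) (fun _ => one_ne_zero) i hi).trans ?_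
      simpa [h1] using h
  · intro hT z hzO
    obtain ⟨S, r, c, n, h1, h2, h3, h6, h4⟩ := hz z
    have h5 : g z - z = ∑ i ∈ S, (g (r i) - r i) := by
      rw [Finset.sum_sub_distrib, ← map_sum, h1]
    rw [h5]
    refine Valuation.map_sum_lt _ one_ne_zero fun i hi => ?_
    have h7 : O.valuation (r i) ≤ 1 := by
      refine (h4 (fun _ => 1) (fun _ => one_ne_zero) i hi).trans ?_
      rw [← ValuationSubring.valuation_le_one_iff] at hzO
      simpa [h1] using hzO
    rcases h7.lt_or_eq with h | h
    · rw [h2]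
      refine (Valuation.map_sub _ _ _).trans_lt (max_lt ?_ h)
      rwa [hc.vsm O (h3 i)]
    · rw [hT _ n (h6 i) h]; simp
def IsPw (g : Ω ≃ₐ[k] Ω) (c : ℤ_[ℓ]) (h : Ω ≃ₐ[k] Ω) : Prop :=
  ∀ (z : Ω) (n : ℕ), (g ^ (ℓ ^ n)) z = z → h z = (g ^ (PadicInt.toZModPow n c).val) z
omit hc hℓ in
theorem rat_prim (hℓ : Fact ℓ.Prime) (x y : ℚ_[ℓ]) : ∃ a b : ℤ_[ℓ], (IsUnit a ∨ IsUnit b) ∧ (a : ℚ_[ℓ]) * x + b * y = 0 := by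
  rcases le_total ‖x‖ ‖y‖ with h | h
  · by_cases hy : y = 0
    · subst hy
      have : x = 0 := by simpa using h
      exact ⟨1, 0, Or.inl isUnit_one, by simp [this]⟩
    refine ⟨1, ⟨-(x / y), ?_⟩, Or.inl isUnit_one, ?_⟩
    · rw [norm_neg, norm_div]; exact div_le_one_of_le₀ h (norm_nonneg _)
    · simp; field_simp; simp
  · by_cases hx : x = 0
    · subst hx
      have : y = 0 := by simpa using h
      exact ⟨1, 0, Or.inl isUnit_one, by simp [this]⟩
    refine ⟨⟨-(y / x), ?_⟩, 1, Or.inr isUnit_one, ?_⟩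
    · rw [norm_neg, norm_div]; exact div_le_one_of_le₀ h (norm_nonneg _)
    · simp; field_simp; simp
theorem Cx.Rpair (p : ℕ) [Fact p.Prime] [CharP k p] {s t : Ω ≃ₐ[k] Ω} (hst : s * t = t * s)
    (hp : ∀ z, ∃ n, (s ^ (ℓ ^ n)) z = z ∧ (t ^ (ℓ ^ n)) z = z) :
    ∃ (O : ValuationSubring Ω) (a b : ℤ_[ℓ]), (IsUnit a ∨ IsUnit b) ∧
      (∀ z, s z ∈ O ↔ z ∈ O) ∧ (∀ z, t z ∈ O ↔ z ∈ O) ∧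
      ∀ g h, IsPw s a g → IsPw t b h → (∀ z, (g * h) z ∈ O ↔ z ∈ O) ∧ ∀ z ∈ O, O.valuation ((g * h) z - z) < 1 := by
  have hcomm : ∀ i j, (![s, t]) i * (![s, t]) j = (![s, t]) j * (![s, t]) i := by
    simp [Fin.forall_fin_two, hst]
  haveI : CharP (fixF ![s, t]) p := charP_of_injective_algebraMap (algebraMap k _).injective p
  obtain ⟨O0, w, hw1, hw2⟩ := (hc.rhyp hcomm).main p
  obtain ⟨O, hO⟩ := ExtV (algebraMap (fixF ![s, t]) Ω) O0
  have hval : ∀ x : fixF ![s, t], O0.valuation x ≤ 1 ↔ O.valuation (x : Ω) ≤ 1 := by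
    intro x
    rw [ValuationSubring.valuation_le_one_iff, ValuationSubring.valuation_le_one_iff, ← hO]; rfl
  have hval1 : ∀ x : fixF ![s, t], O0.valuation x = 1 ↔ O.valuation (x : Ω) = 1 := by
    intro x
    have h1 := hval x
    have h2 := hval x⁻¹
    by_cases hx : x = 0
    · simp [hx]
    have hx' : (x : Ω) ≠ 0 := by simpa using hx
    push_cast at h2
    rw [map_inv₀, map_inv₀, inv_le_one₀ (zero_lt_iff.2 (by simpa using hx)),
      inv_le_one₀ (zero_lt_iff.2 (by simpa using hx'))] at h2
    rw [le_antisymm_iff, le_antisymm_iff, h1, h2]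
  have hvallt : ∀ x : fixF ![s, t], O0.valuation x < 1 ↔ O.valuation (x : Ω) < 1 := by
    intro x
    rw [lt_iff_le_and_ne, lt_iff_le_and_ne, hval, Ne, Ne, hval1]
  have kz : ∀ (u : Ω) (n : ℕ) (h : u ^ (ℓ ^ n) ∈ fixF ![s, t]),
      s u = zp ζ n (kap (ℓ := ℓ) ζ s (u ^ (ℓ ^ n))) • u ∧ t u = zp ζ n (kap (ℓ := ℓ) ζ t (u ^ (ℓ ^ n))) • u :=
    fun u n h => ⟨hc.kap_spec (mem_fix2.1 h).1 rfl, hc.kap_spec (mem_fix2.1 h).2 rfl⟩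
  have hU : ∀ (u : Ω) (n : ℕ), u ^ (ℓ ^ n) ∈ fixF ![s, t] → O.valuation (u - 1) < 1 → u ∈ fixF ![s, t] := by
    intro u n hu hv
    have huO : u ∈ O := by
      have : u - 1 ∈ O := (O.valuation_le_one_iff _).1 hv.le
      simpa using add_mem this (one_mem O)
    have h1 : O.valuation (1 - u ^ (ℓ ^ n)) < 1 := by
      obtain ⟨c, hc⟩ : ∃ c ∈ O, 1 - u ^ (ℓ ^ n) = (u - 1) * c := by
        refine ⟨-∑ i ∈ Finset.range (ℓ ^ n), u ^ i, neg_mem (sum_mem fun i _ => pow_mem huO i), ?_⟩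
        rw [mul_neg, mul_geom_sum]; ring
      rw [hc.2, map_mul]
      exact mul_lt_one_of_lt_of_le hv ((O.valuation_le_one_iff _).2 hc.1)
    have h2 := hw2 (1 - ⟨_, hu⟩) ((hvallt _).2 h1)
    rw [sub_sub_cancel] at h2
    have h3 := congrFun h2 0
    have h4 := congrFun h2 1
    simp only [psi, Matrix.cons_val_zero, Matrix.cons_val_one, Pi.zero_apply, PadicInt.coe_eq_zero] at h3 h4
    rw [mem_fix2, (kz u n hu).1, (kz u n hu).2, h3, h4, hc.zp_zero]; simp
  obtain ⟨a, b, hab, h0⟩ := rat_prim hℓ (w 0) (w 1)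
  have hR := fun g => hc.R1 (g := g) hst O hp hU
  refine ⟨O, a, b, hab, (hR s fun z => ⟨1, 0, by simp⟩).1, (hR t fun z => ⟨0, 1, by simp⟩).1, ?_⟩
  intro g h hg hh
  obtain ⟨h1, h2⟩ := hR (g * h) (by
    intro z
    obtain ⟨n, -, hn⟩ := hp z
    obtain ⟨m, hm, -⟩ := hp (h z)
    rw [AlgEquiv.mul_apply, hg _ m hm, hh _ n hn]
    exact ⟨_, _, rfl⟩)
  refine ⟨h1, h2 ?_⟩
  intro u n hu hv
  have hps : (s ^ (ℓ ^ n)) u = u := by rw [pow_eig (kz u n hu).1, hc.zp_pow, one_smul]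
  have hpt : (t ^ (ℓ ^ n)) u = u := by rw [pow_eig (kz u n hu).2, hc.zp_pow, one_smul]
  obtain ⟨e, he⟩ := Submodule.mem_span_singleton.1 (hw1 ⟨_, hu⟩ ((hval1 _).2 (by
    change O.valuation (u ^ (ℓ ^ n)) = 1
    rw [map_pow, hv, one_pow])))
  have h3 := congrFun he 0
  have h4 := congrFun he 1
  simp only [psi, Matrix.cons_val_zero, Matrix.cons_val_one, Pi.smul_apply, smul_eq_mul] at h3 h4
  set κs := kap (ℓ := ℓ) ζ s (u ^ (ℓ ^ n))
  set κt := kap (ℓ := ℓ) ζ t (u ^ (ℓ ^ n))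
  have h5 : a * κs + b * κt = 0 := by
    rw [← PadicInt.coe_eq_zero, PadicInt.coe_add, PadicInt.coe_mul, PadicInt.coe_mul, ← h3, ← h4]
    linear_combination e * h0
  have hzc : ∀ c d : ℤ_[ℓ], zp ζ n d ^ (PadicInt.toZModPow n c).val = zp ζ n (c * d) := by
    intro c d
    rw [← hc.zp_nsmul]
    apply hc.zp_congr
    rw [← sub_mul]
    refine Dvd.dvd.mul_right ?_ d
    rw [← Ideal.mem_span_singleton, ← PadicInt.ker_toZModPow, RingHom.mem_ker, map_sub, map_natCast]
    haveI : NeZero (ℓ ^ n) := ⟨(hc.lpos n).ne'⟩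
    simp
  rw [AlgEquiv.mul_apply, hh u n hpt, pow_eig (kz u n hu).2, map_smul, hg u n hps, pow_eig (kz u n hu).1,
    smul_smul, hzc, hzc, ← hc.zp_add, add_comm, h5, hc.zp_zero, one_smul]
end V
end S5
namespace S5
section A
variable {A Γ : Type*} [Field A] [LinearOrderedCommGroupWithZero Γ] (v : Valuation A Γ)
theorem vsum {ι : Type*} {S : Finset ι} (hS : S.Nonempty) {f : ι → A}
    (inj : ∀ i ∈ S, ∀ j ∈ S, v (f i) = v (f j) → i = j) : ∃ i ∈ S, v (∑ j ∈ S, f j) = v (f i) := by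
  classical
  obtain ⟨m, hm, hmax⟩ := S.exists_max_image (fun i => v (f i)) hS
  refine ⟨m, hm, ?_⟩
  have hlt : ∀ i ∈ S.erase m, v (f i) < v (f m) := fun i hi =>
    lt_of_le_of_ne (hmax i (Finset.mem_of_mem_erase hi)) fun h =>
      Finset.ne_of_mem_erase hi (inj i (Finset.mem_of_mem_erase hi) m hm h)
  rw [← Finset.add_sum_erase S f hm]
  by_cases h0 : v (f m) = 0
  · rw [h0] at hlt
    rw [Finset.sum_eq_zero (fun i hi => absurd (hlt i hi) (not_lt.2 zero_le')), add_zero]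
  · exact Valuation.map_add_eq_of_lt_left _ (Valuation.map_sum_lt _ h0 hlt)
theorem vtors {M : Type*} [Field M] [Algebra M A] {z : A} (hz0 : z ≠ 0) (P : Polynomial M) (hP : P ≠ 0)
    (hz : Polynomial.aeval z P = 0) :
    ∃ i, 0 < i ∧ i ≤ P.natDegree ∧ ∃ c : M, c ≠ 0 ∧ v (z ^ i) = v (algebraMap M A c) := by
  by_contra! hcon
  have := vsum v (S := P.support) (Polynomial.support_nonempty.2 hP)
    (f := fun i => algebraMap M A (P.coeff i) * z ^ i) ?_
  · obtain ⟨i, hi, h⟩ := this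
    rw [Polynomial.aeval_eq_sum_range] at hz
    have h2 : ∑ j ∈ P.support, algebraMap M A (P.coeff j) * z ^ j = 0 := by
      rw [← hz]
      simp only [Algebra.smul_def]
      refine Finset.sum_subset Polynomial.supp_subset_range_natDegree_succ fun j _ hj => ?_
      rw [Polynomial.notMem_support_iff.1 hj]; simp
    rw [h2, map_zero, eq_comm, Valuation.zero_iff] at h
    simp [hz0] at h
    exact (Polynomial.mem_support_iff.1 hi) h
  · have key : ∀ i ∈ P.support, ∀ j ∈ P.support, i < j →
        v (algebraMap M A (P.coeff i) * z ^ i) = v (algebraMap M A (P.coeff j) * z ^ j) → False := by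
      intro i hi j hj hij h
      have hi' := Polynomial.mem_support_iff.1 hi
      have hj' := Polynomial.mem_support_iff.1 hj
      have hjn := Polynomial.le_natDegree_of_mem_supp j hj
      refine hcon (j - i) (by omega) (by omega) (P.coeff i / P.coeff j) (div_ne_zero hi' hj') ?_
      have hzz : v z ≠ 0 := by simpa using hz0
      have h3 : v (algebraMap M A (P.coeff j)) ≠ 0 := by simpa using hj'
      rw [map_div₀, map_div₀, eq_div_iff h3]
      rw [map_mul, map_mul, map_pow, map_pow] at h
      have : v z ^ j = v z ^ (j - i) * v z ^ i := by rw [← pow_add]; congr 1; omega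
      rw [this, ← mul_assoc] at h
      have := mul_right_cancel₀ (pow_ne_zero i hzz) h
      rw [map_pow, this, mul_comm]
    intro i hi j hj h
    rcases lt_trichotomy i j with h1 | h1 | h1
    · exact (key i hi j hj h1 h).elim
    · exact h1
    · exact (key j hj i hi h1 h.symm).elim
noncomputable def mon {ι : Type*} [Fintype ι] (x : ι → A) (e : ι → ℤ) : A := ∏ i, x i ^ e i
theorem mon_add {ι : Type*} [Fintype ι] {x : ι → A} (hx : ∀ i, x i ≠ 0) (e e' : ι → ℤ) :
    mon x (e + e') = mon x e * mon x e' := by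
  simp [mon, ← Finset.prod_mul_distrib, zpow_add₀ (hx _)]
theorem mon_neg {ι : Type*} [Fintype ι] {x : ι → A} (e : ι → ℤ) :
    mon x (-e) = (mon x e)⁻¹ := by
  simp [mon]
theorem mon_ne {ι : Type*} [Fintype ι] {x : ι → A} (hx : ∀ i, x i ≠ 0) (e : ι → ℤ) :
    mon x e ≠ 0 := Finset.prod_ne_zero_iff.2 fun i _ => zpow_ne_zero _ (hx i)
def VInd {ι : Type*} [Fintype ι] (x : ι → A) : Prop := (∀ i, x i ≠ 0) ∧ ∀ e : ι → ℤ, v (mon x e) = 1 → e = 0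
variable {v}
theorem VInd.inj {ι : Type*} [Fintype ι] {x : ι → A} (h : VInd v x) {e e' : ι → ℤ}
    (he : v (mon x e) = v (mon x e')) : e = e' := by
  rw [← sub_eq_zero]
  apply h.2
  rw [sub_eq_add_neg, mon_add h.1, map_mul, mon_neg, map_inv₀, he, mul_inv_cancel₀]
  simpa using mon_ne h.1 e'
theorem VInd.poly {ι : Type*} [Fintype ι] {x : ι → A} (h : VInd v x) {D : Type*} [CommRing D]
    [Algebra D A] (hD : ∀ d : D, d ≠ 0 → v (algebraMap D A d) = 1) (P : MvPolynomial ι D) (hP : P ≠ 0) :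
    ∃ e : ι → ℤ, v (MvPolynomial.aeval x P) = v (mon x e) := by
  have hval : ∀ i ∈ P.support, v (algebraMap D A (P.coeff i) * ∏ j, x j ^ i j) = v (mon x (fun j => (i j : ℤ))) := by
    intro i hi
    rw [map_mul, hD _ (MvPolynomial.mem_support_iff.1 hi), one_mul]
    simp [mon]
  obtain ⟨i, hi, h1⟩ := vsum v (S := P.support) (MvPolynomial.support_nonempty.2 hP)
    (f := fun i => algebraMap D A (P.coeff i) * ∏ j, x j ^ i j) (by
      intro i hi j hj hij
      rw [hval i hi, hval j hj] at hij
      ext a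
      exact_mod_cast congrFun (h.inj hij) a)
  refine ⟨fun j => (i j : ℤ), ?_⟩
  rw [MvPolynomial.aeval_def, MvPolynomial.eval₂_eq', h1, hval i hi]
theorem VInd.algInd {ι : Type*} [Fintype ι] {x : ι → A} (h : VInd v x) {D : Type*} [CommRing D]
    [Algebra D A] (hD : ∀ d : D, d ≠ 0 → v (algebraMap D A d) = 1) : AlgebraicIndependent D x := by
  rw [algebraicIndependent_iff]
  intro P hP0
  by_contra hP
  obtain ⟨e, he⟩ := h.poly hD P hP
  rw [hP0, map_zero, eq_comm, Valuation.zero_iff] at he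
  exact mon_ne h.1 e he
end A
section B
variable {k A : Type*} [Field k] [Field A] [Algebra k A] {O : ValuationSubring A}
noncomputable abbrev rAlg (hk : ∀ c : k, algebraMap k A c ∈ O) : Algebra k (IsLocalRing.ResidueField O) :=
  (resMap O hk).toAlgebra
theorem res_aeval (hk : ∀ c : k, algebraMap k A c ∈ O) {ι : Type*} {u : ι → A} (hu : ∀ i, u i ∈ O)
    (P : MvPolynomial ι k) : ∃ h : MvPolynomial.aeval u P ∈ O,
      letI := rAlg hk
      IsLocalRing.residue O ⟨_, h⟩ = MvPolynomial.aeval (fun i => IsLocalRing.residue O ⟨u i, hu i⟩) P := by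
  letI := rAlg hk
  letI : Algebra k O := ((algebraMap k A).codRestrict O.toSubring hk).toAlgebra
  haveI : IsScalarTower k O A := IsScalarTower.of_algebraMap_eq fun _ => rfl
  haveI : IsScalarTower k O (IsLocalRing.ResidueField O) := IsScalarTower.of_algebraMap_eq fun _ => rfl
  have h1 : MvPolynomial.aeval u P = ((MvPolynomial.aeval (fun i => (⟨u i, hu i⟩ : O)) P : O) : A) := by
    have := MvPolynomial.aeval_algebraMap_apply A (fun i => (⟨u i, hu i⟩ : O)) P
    exact this
  have hm : MvPolynomial.aeval u P ∈ O := by rw [h1]; exact Subtype.prop _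
  refine ⟨hm, ?_⟩
  have h2 : (⟨_, hm⟩ : O) = MvPolynomial.aeval (fun i => (⟨u i, hu i⟩ : O)) P := Subtype.ext h1
  rw [h2]
  have h3 := MvPolynomial.aeval_algebraMap_apply (R := k) (IsLocalRing.ResidueField O) (fun i => (⟨u i, hu i⟩ : O)) P
  exact h3.symm
theorem unit_adjoin (hk : ∀ c : k, algebraMap k A c ∈ O) {ι : Type*} {u : ι → A} (hu : ∀ i, u i ∈ O)
    (hind : letI := rAlg hk
      AlgebraicIndependent k (fun i => IsLocalRing.residue O ⟨u i, hu i⟩)) :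
    ∀ d : Algebra.adjoin k (Set.range u), d ≠ 0 → O.valuation (algebraMap _ A d) = 1 := by
  letI := rAlg hk
  rintro ⟨d, hd⟩ h0
  rw [Algebra.adjoin_range_eq_range_aeval] at hd
  obtain ⟨P, rfl⟩ := hd
  obtain ⟨hm, h1⟩ := res_aeval hk hu P
  have hP : P ≠ 0 := by rintro rfl; apply h0; apply Subtype.ext; simp
  have h2 : IsLocalRing.residue O ⟨_, hm⟩ ≠ 0 := by
    rw [h1]
    intro h; exact hP ((algebraicIndependent_iff.1 hind) P h)
  rw [Ne, res_zero, not_lt] at h2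
  exact le_antisymm ((O.valuation_le_one_iff _).2 hm) h2
theorem abh (hk : ∀ c : k, algebraMap k A c ∈ O) {ι κ : Type*} [Fintype κ] {u : ι → A} (hu : ∀ i, u i ∈ O)
    (hind : letI := rAlg hk
      AlgebraicIndependent k (fun i => IsLocalRing.residue O ⟨u i, hu i⟩)) {x : κ → A}
    (hx : VInd O.valuation x) : AlgebraicIndependent k (Sum.elim x u) ∧
      ∀ z ∈ IntermediateField.adjoin k (Set.range (Sum.elim x u)), z ≠ 0 →
        ∃ e : κ → ℤ, O.valuation z = O.valuation (mon x e) := by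
  have hD := unit_adjoin hk hu hind
  have hu' : AlgebraicIndependent k u := by
    letI := rAlg hk
    rw [algebraicIndependent_iff]
    intro P hP
    obtain ⟨hm, h1⟩ := res_aeval hk hu P
    refine (algebraicIndependent_iff.1 hind) P ?_
    rw [← h1, res_zero]
    change O.valuation (MvPolynomial.aeval u P) < 1
    rw [hP]; simp
  refine ⟨?_, ?_⟩
  · rw [AlgebraicIndependent.sumElim_iff]
    exact ⟨hu', hx.algInd hD⟩
  · intro z hz hz0
    have key : ∀ y ∈ Algebra.adjoin k (Set.range (Sum.elim x u)), y ≠ 0 →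
        ∃ e : κ → ℤ, O.valuation y = O.valuation (mon x e) := by
      intro y hy hy0
      rw [Set.Sum.elim_range, Set.union_comm, Algebra.adjoin_union_eq_adjoin_adjoin,
        Subalgebra.mem_restrictScalars,
        Algebra.adjoin_range_eq_range_aeval (Algebra.adjoin k (Set.range u)) x] at hy
      obtain ⟨P, rfl⟩ := hy
      change ∃ e : κ → ℤ, O.valuation (MvPolynomial.aeval x P) = O.valuation (mon x e)
      exact hx.poly hD P (by rintro rfl; simp at hy0)
    rw [IntermediateField.mem_adjoin_iff_div] at hz
    obtain ⟨a, ha, b, hb, rfl⟩ := hz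
    rw [div_ne_zero_iff] at hz0
    obtain ⟨e, he⟩ := key a ha hz0.1
    obtain ⟨e', he'⟩ := key b hb hz0.2
    exact ⟨e + -e', by rw [map_div₀, he, he', mon_add hx.1, mon_neg, map_mul, map_inv₀, div_eq_mul_inv]⟩
end B
end S5
namespace S5
section C
variable {ℓ : ℕ} [hℓ : Fact ℓ.Prime] {k N : Type*} [Field k] [Field N] [Algebra k N] {ζ : ℕ → k}
omit hℓ in
theorem vtk (tors : ∀ c : k, c ≠ 0 → ∃ n, n ≠ 0 ∧ c ^ n = 1) (O : ValuationSubring N) {c : k} (h : c ≠ 0) :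
    O.valuation (algebraMap k N c) = 1 := by
  obtain ⟨n, hn, hcn⟩ := tors c h
  have : O.valuation (algebraMap k N c) ^ n = 1 := by
    rw [← map_pow, ← map_pow, hcn, map_one, map_one]
  exact (pow_eq_one_iff.1 this).resolve_right hn
theorem alg_mem [IsAlgClosed k] {z : N} (hz : IsAlgebraic k z) : ∃ a : k, algebraMap k N a = z := by
  have h1 := minpoly.irreducible hz.isIntegral
  exact minpoly.mem_range_of_degree_eq_one k z (IsAlgClosed.degree_eq_one_of_irreducible k h1)
theorem RHyp.mon {E Λ W ι : Type*} [Field Λ] [Field E] [CharZero E] [AddCommGroup W] [Module E W]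
    {ψ : Λ → W} (h : RHyp E ψ) [Fintype ι] {x : ι → Λ} (hx : ∀ i, x i ≠ 0) (e : ι → ℤ) :
    ψ (mon x e) = ∑ i, (e i : E) • ψ (x i) := by
  let f : Λˣ →* Multiplicative W :=
    { toFun := fun u => Multiplicative.ofAdd (ψ u)
      map_one' := by simp [h.one]
      map_mul' := fun u v => by rw [Units.val_mul, h.mul _ _ u.ne_zero v.ne_zero]; rfl }
  have h1 : S5.mon x e = ((∏ i, (Units.mk0 (x i) (hx i)) ^ e i : Λˣ) : Λ) := by
    simp [S5.mon]
  have h2 := map_prod f (fun i => (Units.mk0 (x i) (hx i)) ^ e i) Finset.univ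
  rw [h1]
  change Multiplicative.toAdd (f _) = _
  rw [h2, toAdd_prod]
  refine Finset.sum_congr rfl fun i _ => ?_
  rw [map_zpow, toAdd_zpow, Int.cast_smul_eq_zsmul]; rfl
theorem RHyp.indep {E Λ W : Type*} [Field Λ] [Algebra k Λ] [IsAlgClosed k] [Field E] [CharZero E] [AddCommGroup W] [Module E W]
    [FiniteDimensional E W] (tors : ∀ c : k, c ≠ 0 → ∃ n, n ≠ 0 ∧ c ^ n = 1)
    {ψ : Λ → W} (h : RHyp E ψ) (p : ℕ) [Fact p.Prime] [CharP Λ p] {n : ℕ} (hW : Module.finrank E W = n)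
    {x : Fin n → Λ} (hx : ∀ i, x i ≠ 0) (hli : LinearIndependent E (fun i => ψ (x i))) :
    ∃ f : Fin n → Λ, AlgebraicIndependent k f := by
  obtain ⟨O, w, hw1, hw2⟩ := h.main p
  have hk : ∀ c : k, algebraMap k Λ c ∈ O := fun c => by
    by_cases h : c = 0
    · rw [h, map_zero]; exact zero_mem O
    · rw [← ValuationSubring.valuation_le_one_iff, vtk tors O h]
  by_cases hu : ∀ u : Λ, O.valuation u = 1 → ψ u = 0
  · refine ⟨x, VInd.algInd (v := O.valuation) ⟨hx, fun e he => ?_⟩ fun d hd => vtk tors O hd⟩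
    have h1 := hu _ he
    rw [h.mon hx] at h1
    rw [Fintype.linearIndependent_iff] at hli
    funext i
    exact_mod_cast hli _ h1 i
  push Not at hu
  obtain ⟨u, hu1, hu2⟩ := hu
  have hu0 : u ≠ 0 := by rintro rfl; simp at hu1
  letI := rAlg hk
  have hspan : ∀ y : Λ, O.valuation y = 1 → ∃ b : E, ψ y = b • ψ u := by
    obtain ⟨a, ha⟩ := Submodule.mem_span_singleton.1 (hw1 u hu1)
    have ha0 : a ≠ 0 := by rintro rfl; simp at ha; exact hu2 ha.symm
    intro y hy
    obtain ⟨b, hb⟩ := Submodule.mem_span_singleton.1 (hw1 y hy)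
    refine ⟨b * a⁻¹, ?_⟩
    rw [← ha, smul_smul, inv_mul_cancel_right₀ ha0, hb]
  have huO : u ∈ O := (O.valuation_le_one_iff _).1 hu1.le
  have htr : Transcendental k (IsLocalRing.residue O ⟨u, huO⟩) := by
    intro halg
    obtain ⟨a, ha⟩ := alg_mem halg
    have ha' : IsLocalRing.residue O ⟨algebraMap k Λ a, hk a⟩ = IsLocalRing.residue O ⟨u, huO⟩ := ha
    rw [← sub_eq_zero, ← map_sub, res_zero] at ha'
    have h3 : O.valuation (algebraMap k Λ a - u) < 1 := ha'
    have ha0 : a ≠ 0 := by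
      rintro rfl
      rw [map_zero, zero_sub, Valuation.map_neg, hu1] at h3
      exact lt_irrefl _ h3
    have hA : algebraMap k Λ a ≠ 0 := by simpa using ha0
    have h4 := hw2 ((algebraMap k Λ a - u) / algebraMap k Λ a) (by rw [map_div₀, vtk tors O ha0, div_one]; exact h3)
    rw [show 1 - (algebraMap k Λ a - u) / algebraMap k Λ a = u / algebraMap k Λ a by field_simp; ring,
      h.div hu0 hA] at h4
    obtain ⟨m, hm, hm1⟩ := tors a ha0
    rw [h.root (x := algebraMap k Λ a) hm (by rw [← map_pow, hm1, map_one]), sub_zero] at h4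
    exact hu2 h4
  obtain ⟨i0, hi0⟩ : ∃ i0, ∃ a : Fin n → E, a i0 ≠ 0 ∧ ψ u = ∑ i, a i • ψ (x i) := by
    have hs := hli.span_eq_top_of_card_eq_finrank' (by simp [hW])
    have : ψ u ∈ Submodule.span E (Set.range fun i => ψ (x i)) := by rw [hs]; trivial
    rw [Submodule.mem_span_range_iff_exists_fun] at this
    obtain ⟨a, ha⟩ := this
    by_contra! hcon
    apply hu2
    rw [← ha]
    refine Finset.sum_eq_zero fun i _ => ?_
    by_cases hai : a i = 0
    · rw [hai, zero_smul]
    · exact absurd ha.symm (hcon i a hai)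
  obtain ⟨a, ha0, ha⟩ := hi0
  let x' : {i // i ≠ i0} → Λ := fun i => x i
  have hV : VInd O.valuation x' := by
    refine ⟨fun i => hx i, fun e he => ?_⟩
    obtain ⟨b, hb⟩ := hspan _ he
    rw [h.mon (x := x') (fun i => hx i)] at hb
    rw [Fintype.linearIndependent_iff] at hli
    have h1 := hli (fun i => (if hi : i ≠ i0 then (e ⟨i, hi⟩ : E) else 0) - b * a i) (by
      simp only [sub_smul, Finset.sum_sub_distrib, mul_smul, ← Finset.smul_sum]
      rw [← ha, ← hb, sub_eq_zero]
      refine (Fintype.sum_of_injective Subtype.val Subtype.val_injective _ _ ?_ ?_).symm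
      · intro i hi
        rw [dif_neg, zero_smul]
        intro h; exact hi ⟨⟨i, h⟩, rfl⟩
      · intro i
        rw [dif_pos i.2])
    have hb0 : b = 0 := by
      have := h1 i0
      simpa [ha0] using this
    funext i
    have := h1 i
    simp [hb0, i.2] at this
    exact this
  have hind := (abh (κ := {i // i ≠ i0}) hk (u := fun _ : Unit => u) (fun _ => huO)
    (algebraicIndependent_unique_type_iff.2 htr) hV).1
  have hcard : Fintype.card ({i // i ≠ i0} ⊕ Unit) = n := by
    have : 0 < n := i0.pos
    simp [Fintype.card_subtype_compl]; omega
  exact ⟨_, hind.comp (Fintype.equivFinOfCardEq hcard).symm (Equiv.injective _)⟩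
theorem exists_basis_or {W E X : Type*} [Field E] [AddCommGroup W] [Module E W] [FiniteDimensional E W] {n : ℕ}
    (hW : Module.finrank E W = n) (g : X → W) :
    (∃ x : Fin n → X, LinearIndependent E (fun i => g (x i))) ∨ ∃ f : W →ₗ[E] E, f ≠ 0 ∧ ∀ x, f (g x) = 0 := by
  by_cases hs : Submodule.span E (Set.range g) = ⊤
  · left
    obtain ⟨b, hb, hsp, hli⟩ := exists_linearIndependent E (Set.range g)
    let B := Module.Basis.mk hli (by rw [Subtype.range_coe, hsp, hs])
    haveI := Module.Finite.finite_basis B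
    haveI := Fintype.ofFinite b
    have hcard : Fintype.card b = n := by rw [← hW, Module.finrank_eq_card_basis B]
    let e := (Fintype.equivFinOfCardEq hcard).symm
    choose x hx using fun i => hb (e i).2
    refine ⟨x, ?_⟩
    simp only [hx]
    exact hli.comp e e.injective
  · right
    obtain ⟨f, hf, hle⟩ := Submodule.exists_le_ker_of_lt_top _ (lt_top_iff_ne_top.2 hs)
    exact ⟨f, hf, fun x => hle (Submodule.subset_span ⟨x, rfl⟩)⟩
theorem Cx.indep_or (hc : Cx ℓ N ζ) [IsAlgClosed k] (p : ℕ) [Fact p.Prime] [CharP k p] {n : ℕ}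
    {s : Fin n → (N ≃ₐ[k] N)} (hs : ∀ i j, s i * s j = s j * s i) :
    (∃ f : Fin n → N, AlgebraicIndependent k f) ∨
    ∃ α : Fin n → ℤ_[ℓ], α ≠ 0 ∧ ∀ x, x ≠ 0 → (∀ i, s i x = x) → ∑ i, α i * kap (ℓ := ℓ) ζ (s i) x = 0 := by
  haveI : CharP (fixF s) p := charP_of_injective_algebraMap (algebraMap k _).injective p
  have hfr : Module.finrank ℚ_[ℓ] (Fin n → ℚ_[ℓ]) = n := by simp
  rcases exists_basis_or (E := ℚ_[ℓ]) hfr (fun x : {x : fixF s // x ≠ 0} => psi (ℓ := ℓ) ζ s x) with ⟨x, hx⟩ | ⟨f, hf, hf0⟩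
  · left
    obtain ⟨f, hf⟩ := (hc.rhyp hs).indep hc.tors p hfr (x := fun i => (x i).1) (fun i => (x i).2) hx
    exact ⟨_, hf.map' (f := (fixF s).val) (RingHom.injective _)⟩
  · right
    let a : Fin n → ℚ_[ℓ] := fun i => f (Pi.single i 1)
    have hfa : ∀ w, f w = ∑ i, a i * w i := by
      intro w
      conv_lhs => rw [← Finset.univ_sum_single w]
      rw [map_sum]
      refine Finset.sum_congr rfl fun i _ => ?_
      have : (Pi.single i (w i) : Fin n → ℚ_[ℓ]) = w i • Pi.single i 1 := by
        rw [← Pi.single_smul, smul_eq_mul, mul_one]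
      rw [this, map_smul, smul_eq_mul, mul_comm]
    obtain ⟨d, hd0, hd⟩ : ∃ d : ℚ_[ℓ], d ≠ 0 ∧ ∀ i, ‖d * a i‖ ≤ 1 := by
      by_cases h0 : ∃ i, a i ≠ 0
      · obtain ⟨i, hi⟩ := h0
        obtain ⟨m, -, hm⟩ := Finset.exists_max_image Finset.univ (fun i => ‖a i‖) ⟨i, Finset.mem_univ _⟩
        have hm0 : 0 < ‖a m‖ := lt_of_lt_of_le (norm_pos_iff.2 hi) (hm i (Finset.mem_univ _))
        refine ⟨(a m)⁻¹, inv_ne_zero (norm_pos_iff.1 hm0), fun j => ?_⟩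
        rw [norm_mul, norm_inv, ← div_eq_inv_mul, div_le_one hm0]
        exact hm j (Finset.mem_univ _)
      · push Not at h0
        exact ⟨1, one_ne_zero, fun i => by simp [h0]⟩
    let α : Fin n → ℤ_[ℓ] := fun i => ⟨d * a i, hd i⟩
    have hα : ∀ i, ((α i : ℤ_[ℓ]) : ℚ_[ℓ]) = d * a i := fun _ => rfl
    refine ⟨α, ?_, ?_⟩
    · intro h
      apply hf
      ext i
      have := congrArg (fun z : ℤ_[ℓ] => (z : ℚ_[ℓ])) (congrFun h i)
      simpa [hd0, a, hα] using this
    · intro x hx0 hx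
      have h1 := hf0 ⟨⟨x, hx⟩, fun h => hx0 (congrArg Subtype.val h)⟩
      rw [hfa] at h1
      rw [← PadicInt.coe_eq_zero, PadicInt.coe_sum]
      simp only [PadicInt.coe_mul, hα, mul_assoc, ← Finset.mul_sum]
      rw [show ∑ i, a i * ((kap (ℓ := ℓ) ζ (s i) x : ℤ_[ℓ]) : ℚ_[ℓ]) = 0 from h1, mul_zero]
end C
end S5
namespace S5
section C
variable {ℓ : ℕ} [hℓ : Fact ℓ.Prime] {k N : Type*} [Field k] [Field N] [Algebra k N] {ζ : ℕ → k}
def PL (ℓ : ℕ) (g : N ≃ₐ[k] N) : Prop := ∀ z, ∃ n, (g ^ (ℓ ^ n)) z = z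
omit hℓ in
theorem per_le {g : N ≃ₐ[k] N} {z : N} {n m : ℕ} (h : (g ^ (ℓ ^ n)) z = z) (hm : n ≤ m) : (g ^ (ℓ ^ m)) z = z := by
  obtain ⟨e, rfl⟩ := Nat.exists_eq_add_of_le hm
  rw [pow_add, pow_mul]; exact pow_fix h _
theorem dvd_val (m : ℕ) (α : ℤ_[ℓ]) : (ℓ : ℤ_[ℓ]) ^ m ∣ α - ((PadicInt.toZModPow m α).val : ℤ_[ℓ]) := by
  haveI : NeZero (ℓ ^ m) := ⟨(pow_pos hℓ.out.pos m).ne'⟩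
  rw [← Ideal.mem_span_singleton, ← PadicInt.ker_toZModPow, RingHom.mem_ker, map_sub, map_natCast,
    ZMod.natCast_zmod_val, sub_self]
omit hℓ in
theorem lprod_eig : ∀ {n : ℕ} {h : Fin n → (N ≃ₐ[k] N)} {r : N} {c : Fin n → k} (_ : ∀ i, h i r = c i • r),
    (List.ofFn h).prod r = (∏ i, c i) • r
  | 0, h, r, c, H => by simp
  | n + 1, h, r, c, H => by
    rw [List.ofFn_succ, List.prod_cons, AlgEquiv.mul_apply, lprod_eig (fun i => H i.succ), map_smul, H 0,
      Fin.prod_univ_succ, smul_smul, mul_comm]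
variable (hc : Cx ℓ N ζ)
include hc
theorem Cx.zp_sum {ι : Type*} (S : Finset ι) (n : ℕ) (c : ι → ℤ_[ℓ]) :
    zp ζ n (∑ i ∈ S, c i) = ∏ i ∈ S, zp ζ n (c i) := by
  classical
  induction S using Finset.induction_on with
  | empty => simp [hc.zp_zero]
  | insert i S hi ih => rw [Finset.sum_insert hi, Finset.prod_insert hi, hc.zp_add, ih]
theorem Cx.pw_eig {s h : N ≃ₐ[k] N} {a κ : ℤ_[ℓ]} {m : ℕ} {r : N} (hp : IsPw s a h) (hr : (s ^ (ℓ ^ m)) r = r)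
    (hs : s r = zp ζ m κ • r) : h r = zp ζ m (a * κ) • r := by
  rw [hp r m hr, pow_eig hs, ← hc.zp_nsmul]
  congr 1
  refine hc.zp_congr ?_
  rw [← sub_mul, ← dvd_neg, ← neg_mul, neg_sub]
  exact (dvd_val m a).mul_right _
theorem Cx.eig1 {τ : N ≃ₐ[k] N} (hτ : PL ℓ τ) (h : ∀ r, r ≠ 0 → ∀ c : k, τ r = c • r → c = 1) : τ = 1 := by
  ext z
  obtain ⟨n, hn⟩ := hτ z
  change τ z = z
  conv_lhs => rw [← prj_sum (hc.prim n) (hc.qne n) τ z]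
  conv_rhs => rw [← prj_sum (hc.prim n) (hc.qne n) τ z]
  rw [map_sum]
  refine Finset.sum_congr rfl fun i _ => ?_
  have h1 := prj_eig (hc.prim n).pow_eq_one (hc.zne n) τ i z hn
  by_cases h0 : prj (ℓ ^ n) (ζ n) τ i z = 0
  · rw [h0, map_zero]
  · rw [h1, h _ h0 _ h1, one_smul]
theorem Cx.common {n : ℕ} {s : Fin n → (N ≃ₐ[k] N)} (hs : ∀ i j, s i * s j = s j * s i) (hp : ∀ i, PL ℓ (s i))
    {g : N ≃ₐ[k] N} (hg : ∀ m r, r ≠ 0 → (∀ i, (s i ^ (ℓ ^ m)) r = r) → (∀ i, s i (r ^ (ℓ ^ m)) = r ^ (ℓ ^ m)) → g r = r) : g = 1 := by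
  have key : ∀ m d : ℕ, ∀ z, (∀ i, (s i ^ (ℓ ^ m)) z = z) →
      (∀ i : Fin n, d ≤ i → ∃ a, s i z = ζ m ^ a • z) → g z = z := by
    intro m d
    induction d with
    | zero =>
      intro z hz he
      by_cases h0 : z = 0
      · rw [h0, map_zero]
      refine hg m z h0 hz fun i => ?_
      obtain ⟨a, ha⟩ := he i (Nat.zero_le _)
      rw [map_pow, ha, smul_pow, ← pow_mul, mul_comm, pow_mul, (hc.prim m).pow_eq_one, one_pow, one_smul]
    | succ d ih =>
      intro z hz he
      by_cases hd : d < n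
      · rw [← prj_sum (hc.prim m) (hc.qne m) (s ⟨d, hd⟩) z, map_sum]
        refine Finset.sum_congr rfl fun j _ => ih _ (fun i => ?_) fun i hi => ?_
        · rw [prj_comm ((show Commute _ _ from hs _ _).pow_right _), hz]
        · rcases eq_or_lt_of_le hi with hi | hi
          · have : i = ⟨d, hd⟩ := Fin.ext hi.symm
            exact ⟨j, by rw [this]; exact prj_eig (hc.prim m).pow_eq_one (hc.zne m) _ j z (hz _)⟩
          · obtain ⟨a, ha⟩ := he i hi
            exact ⟨a, by rw [prj_comm (hs _ _), ha, prj_smul]⟩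
      · exact ih z hz fun i hi => absurd i.2 (by omega)
  ext z
  choose m hm using fun i => hp i z
  obtain ⟨M, hM⟩ : ∃ M, ∀ i, m i ≤ M := ⟨∑ i, m i, fun i => Finset.single_le_sum (fun _ _ => Nat.zero_le _) (Finset.mem_univ i)⟩
  exact key M n z (fun i => per_le (hm i) (hM i)) (fun i hi => absurd i.2 (by omega))
theorem Cx.indep_or' [IsAlgClosed k] (p : ℕ) [Fact p.Prime] [CharP k p] {n : ℕ}
    {s : Fin n → (N ≃ₐ[k] N)} (hs : ∀ i j, s i * s j = s j * s i) (hp : ∀ i, PL ℓ (s i)) :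
    (∃ f : Fin n → N, AlgebraicIndependent k f) ∨
    ∃ α : Fin n → ℤ_[ℓ], α ≠ 0 ∧ ∀ h : Fin n → (N ≃ₐ[k] N), (∀ i, IsPw (s i) (α i) (h i)) → (List.ofFn h).prod = 1 := by
  rcases hc.indep_or p hs with h | ⟨α, h0, hα⟩
  · exact .inl h
  refine .inr ⟨α, h0, fun h hh => hc.common hs hp fun m r hr0 hr1 hr2 => ?_⟩
  rw [lprod_eig fun i => hc.pw_eig (hh i) (hr1 i) (hc.kap_spec (hr2 i) rfl), ← hc.zp_sum,
    hα _ (pow_ne_zero _ hr0) hr2, hc.zp_zero, one_smul]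
end C
end S5
namespace S5
section V
variable {ℓ : ℕ} [hℓ : Fact ℓ.Prime] {k Ω : Type*} [Field k] [Field Ω] [Algebra k Ω] {ζ : ℕ → k}
theorem vlt {O : ValuationSubring Ω} {z : Ω} : O.valuation z < 1 ↔ z = 0 ∨ z⁻¹ ∉ O := by
  by_cases h : z = 0
  · simp [h]
  · rw [← ValuationSubring.valuation_le_one_iff, map_inv₀, not_le, one_lt_inv₀ (by simpa [zero_lt_iff] using h)]
    simp [h]
theorem vle {O : ValuationSubring Ω} {a b : Ω} (hb : b ≠ 0) : O.valuation a ≤ O.valuation b ↔ a / b ∈ O := by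
  rw [← ValuationSubring.valuation_le_one_iff, map_div₀, div_le_one₀ (by simpa [zero_lt_iff] using hb)]
theorem st_le {O : ValuationSubring Ω} {g : Ω ≃ₐ[k] Ω} (hg : g ∈ decompSubgroup O) (a b : Ω) :
    O.valuation (g a) ≤ O.valuation (g b) ↔ O.valuation a ≤ O.valuation b := by
  by_cases hb : b = 0
  · simp [hb]
  · rw [vle hb, vle (by simpa using hb), ← map_div₀]; exact hg _
theorem vfix {O : ValuationSubring Ω} {g : Ω ≃ₐ[k] Ω} (hg : g ∈ decompSubgroup O) (hp : PL ℓ g) (w : Ω) :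
    O.valuation (g w) = O.valuation w := by
  obtain ⟨n, hn⟩ := hp w
  obtain ⟨m, hm⟩ := Nat.exists_eq_succ_of_ne_zero (pow_pos hℓ.out.pos n).ne'
  rw [hm] at hn
  refine le_antisymm ?_ ?_
  · by_contra! h
    have : ∀ j, O.valuation w < O.valuation ((g ^ (j + 1)) w) := by
      intro j
      induction j with
      | zero => simpa using h
      | succ j ih =>
        rw [pow_succ', AlgEquiv.mul_apply]
        exact h.trans (not_le.1 fun h' => not_le.2 ih ((st_le hg _ _).1 h'))
    exact absurd (this m) (by rw [hn]; exact lt_irrefl _)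
  · by_contra! h
    have : ∀ j, O.valuation ((g ^ (j + 1)) w) < O.valuation w := by
      intro j
      induction j with
      | zero => simpa using h
      | succ j ih =>
        rw [pow_succ', AlgEquiv.mul_apply]
        exact lt_trans (not_le.1 fun h' => not_le.2 ih ((st_le hg _ _).1 h')) h
    exact absurd (this m) (by rw [hn]; exact lt_irrefl _)
theorem PL.pow {g : Ω ≃ₐ[k] Ω} (h : PL ℓ g) (n : ℕ) : PL ℓ (g ^ n) := fun z => by
  obtain ⟨m, hm⟩ := h z
  exact ⟨m, by rw [← pow_mul, mul_comm, pow_mul]; exact pow_fix hm _⟩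
theorem coarseZ {O O' : ValuationSubring Ω} (h : O ≤ O') {g : Ω ≃ₐ[k] Ω} (hg : g ∈ decompSubgroup O) (hp : PL ℓ g) :
    g ∈ decompSubgroup O' := by
  have key : ∀ g : Ω ≃ₐ[k] Ω, (∀ w, O.valuation (g w) = O.valuation w) → ∀ x ∈ O', g x ∈ O' := by
    intro g hg x hx
    by_cases h0 : x = 0
    · rw [h0, map_zero]; exact zero_mem _
    have h1 : g x / x ∈ O := by rw [← vle h0, hg]
    have := mul_mem (h h1) hx
    rwa [div_mul_cancel₀ _ h0] at this
  have h1 := fun w => vfix hg hp w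
  intro x
  refine ⟨fun hx => ?_, key g h1 x⟩
  have := key g⁻¹ (fun w => by rw [← h1, ← AlgEquiv.mul_apply, mul_inv_cancel, AlgEquiv.one_apply]) _ hx
  rwa [← AlgEquiv.mul_apply, inv_mul_cancel, AlgEquiv.one_apply] at this
theorem vlt_mono {O O' : ValuationSubring Ω} (h : O ≤ O') {z : Ω} (hz : O'.valuation z < 1) : O.valuation z < 1 := by
  rw [vlt] at hz ⊢
  exact hz.imp id fun h1 h2 => h1 (h h2)
theorem coarseT {O O' : ValuationSubring Ω} (h : O ≤ O') {g : Ω ≃ₐ[k] Ω} (hg : g ∈ inertiaSubgroup O') :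
    g ∈ inertiaSubgroup O := by
  have key : ∀ g : Ω ≃ₐ[k] Ω, g ∈ inertiaSubgroup O' → ∀ x ∈ O, g x ∈ O := by
    intro g hg x hx
    have h1 := (O.valuation_le_one_iff _).1 (vlt_mono h (hg.2 x (h hx))).le
    have := add_mem h1 hx
    rwa [sub_add_cancel] at this
  refine ⟨fun x => ⟨fun hx => ?_, key g hg x⟩, fun x hx => vlt_mono h (hg.2 x (h hx))⟩
  have := key g⁻¹ (inv_mem hg) _ hx
  rwa [← AlgEquiv.mul_apply, inv_mul_cancel, AlgEquiv.one_apply] at this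
theorem inertia_top {g : Ω ≃ₐ[k] Ω} (hg : g ∈ inertiaSubgroup (⊤ : ValuationSubring Ω)) : g = 1 := by
  ext x
  have := vlt.1 (hg.2 x (by trivial))
  rcases this with h | h
  · exact sub_eq_zero.1 h
  · exact absurd (by trivial) h
theorem T_le_Z {O : ValuationSubring Ω} {g : Ω ≃ₐ[k] Ω} (hg : g ∈ inertiaSubgroup O) : g ∈ decompSubgroup O := hg.1
theorem prod_lt {O : ValuationSubring Ω} {ι : Type*} (S : Finset ι) (f : ι → Ω) (h : O.valuation (∏ i ∈ S, f i) < 1) :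
    ∃ i ∈ S, O.valuation (f i) < 1 := by
  by_contra! hcon
  rw [map_prod] at h
  exact not_le.2 h (Finset.one_le_prod' hcon)
variable (hc : Cx ℓ Ω ζ)
include hc
theorem Cx.near (O : ValuationSubring Ω) {n : ℕ} {x : Ω} (h : O.valuation (1 - x ^ (ℓ ^ n)) < 1) :
    ∃ c : k, c ≠ 0 ∧ O.valuation (1 - c • x) < 1 := by
  rw [← hc.prod_one_sub (hc.prim n)] at h
  obtain ⟨i, -, hi⟩ := prod_lt _ _ h
  exact ⟨_, pow_ne_zero _ (hc.zne n), hi⟩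
theorem Cx.c1 (O : ValuationSubring Ω) {c : k} {x : Ω} (hx : O.valuation x = 1) (h : O.valuation (c • x - x) < 1) : c = 1 := by
  by_contra h0
  rw [show c • x - x = (c - 1) • x by rw [sub_smul, one_smul], hc.vsm O (sub_ne_zero.2 h0), hx] at h
  exact lt_irrefl _ h
omit hc hℓ in
theorem vone {O : ValuationSubring Ω} {x : Ω} (h : O.valuation (1 - x) < 1) : O.valuation x = 1 := by
  have := Valuation.map_sub_eq_of_lt_right O.valuation (x := 1 - x) (y := 1) (by simpa using h)
  rw [map_one, ← Valuation.map_neg] at this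
  simpa using this
theorem Cx.rig {O : ValuationSubring Ω} {t : Ω ≃ₐ[k] Ω} (ht : t ∈ decompSubgroup O) {u : Ω} {n : ℕ} {c : k}
    (h : O.valuation (1 - u ^ (ℓ ^ n)) < 1) (hu : t u = c • u) : c = 1 := by
  obtain ⟨b, hb, h1⟩ := hc.near O h
  have h2 : O.valuation (t (1 - b • u)) < 1 := by
    have := st_le ht 1 (1 - b • u)
    rw [map_one t, map_one O.valuation] at this
    exact not_le.1 fun h => not_le.2 h1 (this.1 h)
  rw [map_sub, map_one, map_smul, hu, smul_comm] at h2
  refine hc.c1 O (vone h1) ?_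
  have := O.valuation.map_sub_lt h1 h2
  rwa [sub_sub_sub_cancel_left] at this
theorem Cx.E1 {O : ValuationSubring Ω} {s : Ω ≃ₐ[k] Ω} (hs : s ∈ inertiaSubgroup O) (hp : PL ℓ s) {w : Ω} (hw : w ≠ 0) :
    ∃ c : k, O.valuation (s w - c • w) < O.valuation w := by
  set x := s w / w with hx
  have hv0 : O.valuation w ≠ 0 := by simpa using hw
  have hx1 : O.valuation x = 1 := by rw [hx, map_div₀, vfix (T_le_Z hs) hp, div_self hv0]
  have hsw : s w = x * w := by rw [hx, div_mul_cancel₀ _ hw]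
  have key : ∀ m, O.valuation ((s ^ m) w - x ^ m * w) < O.valuation w := by
    intro m
    induction m with
    | zero => simpa using zero_lt_iff.2 hv0
    | succ m ih =>
      have h1 : O.valuation (s ((s ^ m) w - x ^ m * w)) < O.valuation w := by rwa [vfix (T_le_Z hs) hp]
      have h2 : O.valuation ((s (x ^ m) - x ^ m) * (x * w)) < O.valuation w := by
        rw [map_mul, map_mul, hx1, one_mul]
        have := hs.2 (x ^ m) ((O.valuation_le_one_iff _).1 (by rw [map_pow, hx1, one_pow]))
        exact (mul_lt_mul_of_pos_right this (zero_lt_iff.2 hv0)).trans_eq (one_mul _)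
      have h3 := O.valuation.map_add_lt h1 h2
      convert h3 using 2
      rw [map_sub, map_mul, hsw, pow_succ', AlgEquiv.mul_apply]; ring
  obtain ⟨n, hn⟩ := hp w
  have h1 := key (ℓ ^ n)
  rw [hn, ← one_sub_mul, map_mul] at h1
  obtain ⟨c, hc0, h2⟩ := hc.near O (n := n) (x := x) (by
    by_contra! h
    exact not_le.2 h1 (le_mul_of_one_le_left' h))
  refine ⟨c⁻¹, ?_⟩
  have h3 : s w - c⁻¹ • w = -(c⁻¹ • ((1 - c • x) * w)) := by
    rw [sub_mul, one_mul, smul_sub, smul_mul_assoc, smul_smul, inv_mul_cancel₀ hc0, one_smul, ← hsw]; ring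
  rw [h3, Valuation.map_neg, hc.vsm O (inv_ne_zero hc0), map_mul]
  exact (mul_lt_mul_of_pos_right h2 (zero_lt_iff.2 hv0)).trans_eq (one_mul _)
theorem Cx.E {O : ValuationSubring Ω} {s g : Ω ≃ₐ[k] Ω} (hs : s ∈ inertiaSubgroup O) (hg : g ∈ decompSubgroup O)
    (ps : PL ℓ s) (pg : PL ℓ g) (pt : PL ℓ (s⁻¹ * (g * s * g⁻¹))) : g * s = s * g := by
  have : s⁻¹ * (g * s * g⁻¹) = 1 := by
    refine hc.eig1 pt fun r hr c hcr => ?_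
    set w := g⁻¹ r with hw
    have hgw : g w = r := by rw [hw, ← AlgEquiv.mul_apply, mul_inv_cancel, AlgEquiv.one_apply]
    have hw0 : w ≠ 0 := by rintro h; rw [h, map_zero] at hgw; exact hr hgw.symm
    have hvw : O.valuation r = O.valuation w := by rw [← hgw, vfix hg pg]
    have hv0 : O.valuation w ≠ 0 := by simpa using hw0
    obtain ⟨b, hb⟩ := hc.E1 hs ps hw0
    have h1 : O.valuation (g (s w) - b • r) < O.valuation w := by
      rw [← hgw, ← map_smul, ← map_sub, vfix hg pg]; exact hb
    have h2 : O.valuation (s r - b • r) < O.valuation w := by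
      have hu : O.valuation (r / w) = 1 := by rw [map_div₀, hvw, div_self hv0]
      have e : s r - b • r = (s (r / w) - r / w) * s w + (r / w) * (s w - b • w) := by
        rw [map_div₀]
        have : s w ≠ 0 := by simpa using hw0
        simp only [Algebra.smul_def]
        field_simp
        ring
      rw [e]
      refine O.valuation.map_add_lt ?_ (by rwa [map_mul, hu, one_mul])
      rw [map_mul, vfix (T_le_Z hs) ps]
      exact (mul_lt_mul_of_pos_right (hs.2 _ ((O.valuation_le_one_iff _).1 hu.le)) (zero_lt_iff.2 hv0)).trans_eq (one_mul _)
    have h3 := O.valuation.map_sub_lt h1 h2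
    rw [sub_sub_sub_cancel_right] at h3
    have h4 : g (s w) = s (c • r) := by
      rw [← hcr]; change _ = (s * (s⁻¹ * (g * s * g⁻¹))) r
      rw [mul_inv_cancel_left]; rfl
    rw [h4, ← map_sub, vfix (T_le_Z hs) ps, show c • r - r = (c - 1) • r by rw [sub_smul, one_smul]] at h3
    by_contra h0
    rw [hc.vsm O (sub_ne_zero.2 h0), hvw] at h3
    exact lt_irrefl _ h3
  have := (inv_mul_eq_one.1 this)
  conv_rhs => rw [this]
  group
end V
end S5
namespace S5
section V
variable {ℓ : ℕ} [hℓ : Fact ℓ.Prime] {k Ω : Type*} [Field k] [Field Ω] [Algebra k Ω] {ζ : ℕ → k}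
def jn (O1 O2 : ValuationSubring Ω) : ValuationSubring Ω where
  carrier := {z | ∃ b ∈ O2, b ≠ 0 ∧ O1.valuation z ≤ O1.valuation b}
  mul_mem' := by
    rintro x y ⟨b, hb, h0, h⟩ ⟨b', hb', h0', h'⟩
    exact ⟨b * b', mul_mem hb hb', mul_ne_zero h0 h0', by rw [map_mul, map_mul]; exact mul_le_mul' h h'⟩
  one_mem' := ⟨1, one_mem _, one_ne_zero, le_rfl⟩
  zero_mem' := ⟨1, one_mem _, one_ne_zero, by simp⟩
  add_mem' := by
    rintro x y ⟨b, hb, h0, h⟩ ⟨b', hb', h0', h'⟩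
    rcases le_total (O1.valuation b) (O1.valuation b') with h1 | h1
    · exact ⟨b', hb', h0', O1.valuation.map_add_le (h.trans h1) h'⟩
    · exact ⟨b, hb, h0, O1.valuation.map_add_le h (h'.trans h1)⟩
  neg_mem' := by
    rintro x ⟨b, hb, h0, h⟩
    exact ⟨b, hb, h0, by rwa [Valuation.map_neg]⟩
  mem_or_inv_mem' := fun x => by
    refine (O1.mem_or_inv_mem x).imp ?_ ?_ <;>
    exact fun h => ⟨1, one_mem _, one_ne_zero, by simpa using (O1.valuation_le_one_iff _).2 h⟩
theorem jn_left (O1 O2 : ValuationSubring Ω) : O1 ≤ jn O1 O2 := fun x hx =>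
  ⟨1, one_mem _, one_ne_zero, by simpa using (O1.valuation_le_one_iff _).2 hx⟩
theorem jn_right (O1 O2 : ValuationSubring Ω) : O2 ≤ jn O1 O2 := fun x hx => by
  by_cases h : x = 0
  · exact ⟨1, one_mem _, one_ne_zero, by simp [h]⟩
  · exact ⟨x, hx, h, le_rfl⟩
theorem vgt {O : ValuationSubring Ω} {z : Ω} (h : z ∉ O) : 1 < O.valuation z := by
  rwa [← not_le, ValuationSubring.valuation_le_one_iff]
theorem big {O1 O2 : ValuationSubring Ω} {b b1 z : Ω} (hb : b ∈ O2) (hb' : b ∉ O1) (hb1 : b1 ∈ O2)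
    (hz : O1.valuation z ≤ O1.valuation b1) : ∃ β ∈ O2, 1 < O1.valuation β ∧ O1.valuation z < O1.valuation β := by
  have h1 := vgt hb'
  by_cases h : O1.valuation b1 ≤ 1
  · exact ⟨b, hb, h1, hz.trans_lt (h.trans_lt h1)⟩
  · push Not at h
    refine ⟨b1 * b, mul_mem hb1 hb, ?_, ?_⟩ <;> rw [map_mul]
    · exact h.trans (lt_mul_of_one_lt_right (zero_lt_one.trans h) h1)
    · exact hz.trans_lt (lt_mul_of_one_lt_right (zero_lt_one.trans h) h1)
theorem exists_T {O1 O2 : ValuationSubring Ω} (h12 : ¬ O1 ≤ O2) (h21 : ¬ O2 ≤ O1) {y z : Ω} (hy : y ∈ jn O1 O2)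
    (hz : z ∈ jn O1 O2) : ∃ T : Ω, 1 < O1.valuation T ∧ O1.valuation y < O1.valuation T ∧
      O2.valuation T < 1 ∧ O2.valuation (T * z) < 1 := by
  obtain ⟨a, ha, ha'⟩ := SetLike.not_le_iff_exists.1 h12
  obtain ⟨b, hb, hb'⟩ := SetLike.not_le_iff_exists.1 h21
  obtain ⟨b1, hb1, -, h1⟩ := hy
  obtain ⟨b2, hb2, h20, h2⟩ := hz
  obtain ⟨β, hβ, h3, h4⟩ := big hb hb' hb1 h1
  obtain ⟨α, hα, h5, h6⟩ := big (O1 := O2) (O2 := O1) ha ha' (b1 := z / b2) ((vle h20).1 h2) (z := z) (by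
    rw [map_div₀, le_div_iff₀ (by simpa [zero_lt_iff] using h20)]
    exact mul_le_of_le_one_right' ((O2.valuation_le_one_iff _).2 hb2))
  have hα0 : α ≠ 0 := by rintro rfl; simp at h5
  have hα1 : 0 < O1.valuation α := by simpa [zero_lt_iff] using hα0
  have hα2 : 0 < O2.valuation α := by simpa [zero_lt_iff] using hα0
  have hle : O1.valuation β ≤ O1.valuation (β / α) := by
    rw [map_div₀, le_div_iff₀ hα1]; exact mul_le_of_le_one_right' ((O1.valuation_le_one_iff _).2 hα)
  have hb1' := (O2.valuation_le_one_iff _).2 hβ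
  refine ⟨β / α, h3.trans_le hle, h4.trans_le hle, ?_, ?_⟩
  · rw [map_div₀, div_lt_one₀ hα2]; exact hb1'.trans_lt h5
  · rw [map_mul, map_div₀, div_mul_eq_mul_div, div_lt_one₀ hα2]
    exact (mul_le_of_le_one_left' hb1').trans_lt h6
variable (hc : Cx ℓ Ω ζ)
include hc
theorem Cx.avg {O : ValuationSubring Ω} {t : Ω ≃ₐ[k] Ω} (ht : t ∈ decompSubgroup O) (hp : PL ℓ t) {x : Ω} (hx : t x = x)
    {γ : O.ValueGroup} (hγ : γ ≠ 0) (n : ℕ) {z : Ω} (h : O.valuation (z - x) < γ) :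
    O.valuation (prj (ℓ ^ n) (ζ n) t 0 z - x) < γ := by
  have hv : ∀ a, O.valuation ((t ^ a) (z - x)) < γ := fun a => by
    rwa [vfix (ℓ := ℓ) (pow_mem ht a) (hp.pow a)]
  have h1 : prj (ℓ ^ n) (ζ n) t 0 z - x = ∑ a ∈ Finset.range (ℓ ^ n), ((ℓ ^ n : ℕ) : k)⁻¹ • (t ^ a) (z - x) := by
    simp only [prj, zero_mul, pow_zero, inv_one, mul_one, map_sub, pow_fix hx, smul_sub, Finset.sum_sub_distrib]
    rw [Finset.sum_const, Finset.card_range, ← Nat.cast_smul_eq_nsmul k, smul_smul, mul_inv_cancel₀ (hc.qne n), one_smul]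
  rw [h1]
  refine Valuation.map_sum_lt _ hγ fun a _ => ?_
  rw [hc.vsm O (inv_ne_zero (hc.qne n))]
  exact hv a
theorem Cx.exists_eig {O : ValuationSubring Ω} {t : Ω ≃ₐ[k] Ω} (ht : t ∈ decompSubgroup O) (hp : PL ℓ t)
    (h : t ∉ inertiaSubgroup O) : ∃ (j : ℕ) (r : Ω) (c : k), O.valuation r = 1 ∧ (t ^ (ℓ ^ j)) r = c • r ∧ c ^ ℓ = 1 ∧ c ≠ 1 := by
  have : ∃ z ∈ O, ¬ O.valuation (t z - z) < 1 := by
    by_contra! hcon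
    exact h ⟨ht, hcon⟩
  obtain ⟨z, hz, hv⟩ := this
  obtain ⟨n, hn⟩ := hp z
  have h1 : ∃ i, O.valuation (t (prj (ℓ ^ n) (ζ n) t i z) - prj (ℓ ^ n) (ζ n) t i z) = 1 := by
    by_contra! hcon
    apply hv
    conv => enter [1, 2]; rw [← prj_sum (hc.prim n) (hc.qne n) t z]
    rw [map_sum, ← Finset.sum_sub_distrib]
    refine Valuation.map_sum_lt _ one_ne_zero fun i _ => lt_of_le_of_ne ?_ (hcon i)
    have hm : prj (ℓ ^ n) (ζ n) t i z ∈ O := by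
      refine sum_mem fun a _ => ?_
      rw [Algebra.smul_def]
      exact mul_mem (hc.kmem O _) ((pow_mem ht a z).2 hz)
    exact (O.valuation_le_one_iff _).2 (sub_mem ((ht _).2 hm) hm)
  obtain ⟨i, hi⟩ := h1
  have he := prj_eig (hc.prim n).pow_eq_one (hc.zne n) t i z hn
  set r := prj (ℓ ^ n) (ζ n) t i z
  set c := ζ n ^ i with hcdef
  have hc1 : c ≠ 1 := by
    intro h; rw [he, h, one_smul, sub_self, map_zero] at hi; exact zero_ne_one hi
  rw [he, show c • r - r = (c - 1) • r by rw [sub_smul, one_smul], hc.vsm O (sub_ne_zero.2 hc1)] at hi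
  have hcn : c ^ (ℓ ^ n) = 1 := by rw [hcdef, ← pow_mul, mul_comm, pow_mul, (hc.prim n).pow_eq_one, one_pow]
  classical
  have hex : ∃ j, c ^ (ℓ ^ j) = 1 := ⟨n, hcn⟩
  have hpos : Nat.find hex ≠ 0 := by
    intro h
    have := Nat.find_spec hex
    rw [h, pow_zero, pow_one] at this
    exact hc1 this
  obtain ⟨j, hj⟩ := Nat.exists_eq_succ_of_ne_zero hpos
  refine ⟨j, r, c ^ (ℓ ^ j), hi, pow_eig he _, ?_, Nat.find_min hex (by omega)⟩
  rw [← pow_mul, ← pow_succ, ← Nat.succ_eq_add_one, ← hj]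
  exact Nat.find_spec hex
theorem Cx.Dep {O1 O2 : ValuationSubring Ω} (h12 : ¬ O1 ≤ O2) (h21 : ¬ O2 ≤ O1) {t : Ω ≃ₐ[k] Ω} (hp : PL ℓ t)
    (ht1 : t ∈ decompSubgroup O1) (ht2 : t ∈ decompSubgroup O2) : t ∈ inertiaSubgroup (jn O1 O2) := by
  by_contra hcon
  obtain ⟨j, y, c, hy, hty, hcl, hc1⟩ := hc.exists_eig (coarseZ (jn_left O1 O2) ht1 hp) hp hcon
  replace ht1 := pow_mem ht1 (ℓ ^ j)
  replace ht2 := pow_mem ht2 (ℓ ^ j)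
  replace hp := hp.pow (ℓ ^ j)
  generalize t ^ (ℓ ^ j) = t at *
  have hy0 : y ≠ 0 := by rintro rfl; simp at hy
  have hc0 : c ≠ 0 := by rintro rfl; simp [hℓ.out.ne_zero] at hcl
  set x := y ^ ℓ with hx
  have hx0 : x ≠ 0 := pow_ne_zero _ hy0
  have htx : t x = x := by rw [hx, map_pow, hty, smul_pow, hcl, one_smul]
  have hxv : (jn O1 O2).valuation x = 1 := by rw [hx, map_pow, hy, one_pow]
  have hx1 : x ∈ jn O1 O2 := ((jn O1 O2).valuation_le_one_iff _).1 hxv.le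
  have hx2 : x⁻¹ ∈ jn O1 O2 := ((jn O1 O2).valuation_le_one_iff _).1 (by rw [map_inv₀, hxv, inv_one])
  obtain ⟨T, hT1, hT2, hT3, hT4⟩ := exists_T h12 h21 (sub_mem hx1 (one_mem _)) (mul_mem (sub_mem hx1 (one_mem _)) hx2)
  have e1 : O1.valuation (1 + T) = O1.valuation T := by
    rw [add_comm]; exact Valuation.map_add_eq_of_lt_left _ (by rwa [map_one])
  have e2 : O2.valuation (1 + T) = 1 := by
    rw [Valuation.map_add_eq_of_lt_left _ (by rwa [map_one]), map_one]
  have hT0 : 1 + T ≠ 0 := by intro h; rw [h, map_zero] at e2; exact zero_ne_one e2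
  set z := 1 + (x - 1) / (1 + T) with hz
  have hz1 : O1.valuation (z - 1) < 1 := by
    rw [hz, add_sub_cancel_left, map_div₀, e1, div_lt_one₀ (zero_lt_one.trans hT1)]; exact hT2
  have hz2 : O2.valuation (z - x) < O2.valuation x := by
    have : z - x = -(T * ((x - 1) * x⁻¹) / (1 + T) * x) := by rw [hz]; field_simp; ring
    rw [this, Valuation.map_neg, map_mul, map_div₀, e2, div_one]
    exact (mul_lt_mul_of_pos_right hT4 (by simpa [zero_lt_iff] using hx0)).trans_eq (one_mul _)
  obtain ⟨n, hn⟩ := hp z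
  have a1 := hc.avg ht1 hp (map_one t) one_ne_zero n hz1
  have a2 := hc.avg ht2 hp htx (by simpa using hx0) n hz2
  have a3 := prj_eig (hc.prim n).pow_eq_one (hc.zne n) t 0 z hn
  set w := prj (ℓ ^ n) (ζ n) t 0 z
  rw [pow_zero, one_smul] at a3
  obtain ⟨ρ, hρ⟩ := hc.root 1 w
  have hρt := hc.kap_spec a3 hρ
  have b1 := hc.rig ht1 (n := 1) (u := ρ) (by rw [hρ, Valuation.map_sub_swap]; exact a1) hρt
  rw [b1, one_smul] at hρt
  have b2 := hc.rig ht2 (n := 1) (u := ρ / y) (c := c⁻¹) (by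
    rw [div_pow, hρ, pow_one, ← hx, show 1 - w / x = -((w - x) / x) by field_simp; ring, Valuation.map_neg, map_div₀,
      div_lt_one₀ (by simpa [zero_lt_iff] using hx0)]
    exact a2) (by
    rw [map_div₀, hρt, hty, Algebra.smul_def, Algebra.smul_def, map_inv₀]
    have : algebraMap k Ω c ≠ 0 := by simpa using hc0
    field_simp)
  exact hc1 (inv_eq_one.1 b2)
theorem Cx.Ostar {O : ValuationSubring Ω} {t : Ω ≃ₐ[k] Ω} (hp : PL ℓ t) (ht : t ∈ inertiaSubgroup O) :
    ∃ U : ValuationSubring Ω, t ∈ inertiaSubgroup U ∧ ∀ g : Ω ≃ₐ[k] Ω, g * t = t * g → g ∈ decompSubgroup U := by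
  have dir : ∀ O1 O2 : ValuationSubring Ω, t ∈ inertiaSubgroup O1 → t ∈ inertiaSubgroup O2 →
      ∃ O3 : ValuationSubring Ω, t ∈ inertiaSubgroup O3 ∧ O1 ≤ O3 ∧ O2 ≤ O3 := by
    intro O1 O2 h1 h2
    by_cases h12 : O1 ≤ O2
    · exact ⟨O2, h2, h12, le_rfl⟩
    by_cases h21 : O2 ≤ O1
    · exact ⟨O1, h1, le_rfl, h21⟩
    · exact ⟨_, hc.Dep h12 h21 hp h1.1 h2.1, jn_left _ _, jn_right _ _⟩
  let U : ValuationSubring Ω :=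
    { carrier := {z | ∃ O1 : ValuationSubring Ω, t ∈ inertiaSubgroup O1 ∧ z ∈ O1}
      mul_mem' := by
        rintro x y ⟨O1, h1, hx⟩ ⟨O2, h2, hy⟩
        obtain ⟨O3, h3, l1, l2⟩ := dir O1 O2 h1 h2
        exact ⟨O3, h3, mul_mem (l1 hx) (l2 hy)⟩
      one_mem' := ⟨O, ht, one_mem _⟩
      zero_mem' := ⟨O, ht, zero_mem _⟩
      add_mem' := by
        rintro x y ⟨O1, h1, hx⟩ ⟨O2, h2, hy⟩
        obtain ⟨O3, h3, l1, l2⟩ := dir O1 O2 h1 h2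
        exact ⟨O3, h3, add_mem (l1 hx) (l2 hy)⟩
      neg_mem' := fun ⟨O1, h1, hx⟩ => ⟨O1, h1, neg_mem hx⟩
      mem_or_inv_mem' := fun x => (O.mem_or_inv_mem x).imp (fun h => ⟨O, ht, h⟩) fun h => ⟨O, ht, h⟩ }
  have key : ∀ g : Ω ≃ₐ[k] Ω, g * t = t * g → ∀ x, g x ∈ U → x ∈ U := by
    rintro g hg x ⟨O1, h1, hx⟩
    have hg' : ∀ y, g (t y) = t (g y) := fun y => by
      rw [← AlgEquiv.mul_apply, hg]; rfl
    refine ⟨O1.comap (g : Ω →+* Ω), ⟨fun y => ?_, fun y hy => ?_⟩, hx⟩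
    · change g (t y) ∈ O1 ↔ g y ∈ O1
      rw [hg']; exact h1.1 _
    · rw [vlt]
      have := h1.2 (g y) hy
      rw [← hg', ← map_sub, vlt] at this
      refine this.imp (map_eq_zero g).1 fun h h' => h ?_
      rw [← map_inv₀]; exact h'
  have key2 : ∀ g : Ω ≃ₐ[k] Ω, g * t = t * g → g ∈ decompSubgroup U := by
    intro g hg x
    refine ⟨key g hg x, fun hx => key g⁻¹ ?_ _ ?_⟩
    · rw [inv_mul_eq_iff_eq_mul, ← mul_assoc, hg, mul_inv_cancel_right]
    · rwa [← AlgEquiv.mul_apply, inv_mul_cancel, AlgEquiv.one_apply]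
  refine ⟨U, ⟨key2 t rfl, ?_⟩, key2⟩
  rintro z ⟨O1, h1, hz⟩
  rw [vlt]
  by_contra! hcon
  obtain ⟨h0, O2, h2, hi⟩ := hcon
  obtain ⟨O3, h3, l1, l2⟩ := dir O1 O2 h1 h2
  exact (vlt.1 (h3.2 z (l1 hz))).elim h0 fun h => h (l2 hi)
end V
end S5
namespace S5
section V
variable {ℓ : ℕ} [hℓ : Fact ℓ.Prime] {k Ω : Type*} [Field k] [Field Ω] [Algebra k Ω] {ζ : ℕ → k}
structure Gx (ℓ : ℕ) (Kb : IntermediateField k Ω) : Prop where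
  pl : ∀ σ : Ω ≃ₐ[k] Ω, (∀ x ∈ Kb, σ x = x) → PL ℓ σ
  mv : ∀ E : IntermediateField k Ω, Kb ≤ E → ∀ x, x ∉ E → ∃ σ : Ω ≃ₐ[k] Ω, (∀ y ∈ E, σ y = y) ∧ σ x ≠ x
  ku : ∀ E E' : IntermediateField k Ω, Kb ≤ E → E < E' → ∃ r ∈ E', r ∉ E ∧ r ^ ℓ ∈ E
structure Chi (O : ValuationSubring Ω) (χ : Ω → ℚ_[ℓ]) : Prop where
  mul : ∀ x y, x ≠ 0 → y ≠ 0 → χ (x * y) = χ x + χ y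
  unit : ∀ x, O.valuation x = 1 → χ x = 0
theorem Chi.eq {O : ValuationSubring Ω} {χ : Ω → ℚ_[ℓ]} (h : Chi O χ) {x y : Ω} (hx : x ≠ 0)
    (hxy : O.valuation x = O.valuation y) : χ x = χ y := by
  have hy : y ≠ 0 := by rintro rfl; simp [hx] at hxy
  have h1 := h.mul (x / y) y (div_ne_zero hx hy) hy
  rwa [div_mul_cancel₀ _ hy, h.unit (x / y) (by rw [map_div₀, hxy, div_self (by simpa using hy)]), zero_add] at h1
theorem Chi.pow {O : ValuationSubring Ω} {χ : Ω → ℚ_[ℓ]} (h : Chi O χ) {x : Ω} (hx : x ≠ 0) (n : ℕ) :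
    χ (x ^ n) = n * χ x := by
  induction n with
  | zero => simpa using h.unit 1 (map_one _)
  | succ n ih => rw [pow_succ, h.mul _ _ (pow_ne_zero _ hx) hx, ih]; push_cast; ring
theorem Chi.div {O : ValuationSubring Ω} {χ : Ω → ℚ_[ℓ]} (h : Chi O χ) {x y : Ω} (hx : x ≠ 0) (hy : y ≠ 0) :
    χ (x / y) = χ x - χ y := by
  have h1 := h.mul (x / y) y (div_ne_zero hx hy) hy
  rw [div_mul_cancel₀ _ hy] at h1
  rw [h1, add_sub_cancel_right]
theorem rep_adj {E : IntermediateField k Ω} {r z : Ω} (hr : r ^ ℓ ∈ E) (hz : z ∈ IntermediateField.adjoin E {r}) :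
    IsIntegral E z ∧ ∃ c : ℕ → Ω, (∀ j, c j ∈ E) ∧ z = ∑ j ∈ Finset.range ℓ, c j * r ^ j := by
  have hmon := Polynomial.monic_X_pow_sub_C (⟨r ^ ℓ, hr⟩ : E) hℓ.out.ne_zero
  have h0 : Polynomial.aeval r (Polynomial.X ^ ℓ - Polynomial.C (⟨r ^ ℓ, hr⟩ : E)) = 0 := by
    simp [IntermediateField.algebraMap_apply]
  have hint : IsIntegral E r := ⟨_, hmon, h0⟩
  have hz' : z ∈ Algebra.adjoin E {r} := by
    rw [← IntermediateField.adjoin_simple_toSubalgebra_of_isAlgebraic hint.isAlgebraic]; exact hz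
  refine ⟨IsIntegral.of_mem_of_fg _ hint.fg_adjoin_singleton _ hz', ?_⟩
  rw [Algebra.adjoin_singleton_eq_range_aeval] at hz'
  obtain ⟨P, rfl⟩ := hz'
  refine ⟨fun j => ((P %ₘ (Polynomial.X ^ ℓ - Polynomial.C (⟨r ^ ℓ, hr⟩ : E))).coeff j : E), fun j => SetLike.coe_mem _, ?_⟩
  change Polynomial.aeval r P = _
  rw [← Polynomial.aeval_modByMonic_eq_self_of_root h0]
  rw [Polynomial.aeval_eq_sum_range' (n := ℓ)]
  · rfl
  · refine (Polynomial.natDegree_modByMonic_lt _ hmon ?_).trans_eq (by simp)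
    intro h
    have := congrArg Polynomial.natDegree h
    simp [hℓ.out.ne_zero] at this
variable (hc : Cx ℓ Ω ζ)
include hc
theorem Cx.Qa1 (O : ValuationSubring Ω) {E : IntermediateField k Ω} {r : Ω} (hr : r ^ ℓ ∈ E) (hr0 : r ≠ 0)
    (hm : ∀ m, 0 < m → m < ℓ → ∀ c ∈ E, ¬ O.valuation (r ^ m - c) < O.valuation (r ^ m))
    {c : ℕ → Ω} (hE : ∀ j, c j ∈ E) (hz : ∑ j ∈ Finset.range ℓ, c j * r ^ j ≠ 0) :
    ∃ j, c j ≠ 0 ∧ O.valuation (∑ j ∈ Finset.range ℓ, c j * r ^ j) = O.valuation (c j * r ^ j) := by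
  classical
  set S := (Finset.range ℓ).filter fun j => c j ≠ 0 with hS
  have hsum : ∑ j ∈ Finset.range ℓ, c j * r ^ j = ∑ j ∈ S, c j * r ^ j := by
    rw [hS, Finset.sum_filter]
    refine Finset.sum_congr rfl fun j _ => ?_
    split_ifs with h
    · rfl
    · push Not at h; rw [h, zero_mul]
  have hc0 : ∀ i ∈ S, c i ≠ 0 := fun i hi => (Finset.mem_filter.1 hi).2
  have hlt : ∀ i ∈ S, i < ℓ := fun i hi => by simpa using (Finset.mem_filter.1 hi).1
  rw [hsum] at hz ⊢
  have hV := hc.VKI O E (n := 1) S (fun j => c j * r ^ j) (fun i _ => by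
    rw [pow_one, mul_pow, ← pow_mul, mul_comm i, pow_mul]
    exact mul_mem (pow_mem (hE i) _) (pow_mem hr _)) (fun i hi j hj hij d hd hlt' => by
      rcases lt_or_gt_of_ne hij with h | h
      · have hd0 : d ≠ 0 := by rintro rfl; simp at hlt'
        refine hm (j - i) (by omega) (by have := hlt j hj; omega) (c i / (d * c j))
          (div_mem (hE i) (mul_mem hd (hE j))) ?_
        have h1 : O.valuation (c i * r ^ i) = O.valuation (d * c j * r ^ j) := by
          refine (Valuation.map_eq_of_sub_lt _ ?_).symm
          rw [Valuation.map_sub_swap, mul_assoc]; exact hlt'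
        have h2 : r ^ j = r ^ (j - i) * r ^ i := by rw [← pow_add]; congr 1; omega
        have h3 : r ^ (j - i) - c i / (d * c j) = -(c i * r ^ i - d * (c j * r ^ j)) / (d * c j * r ^ i) := by
          rw [h2]; have := hc0 j hj; field_simp; ring
        have h4 : r ^ (j - i) = (d * c j * r ^ j) / (d * c j * r ^ i) := by
          rw [h2]; have := hc0 j hj; field_simp
        rw [h3, h4, map_div₀, map_div₀, Valuation.map_neg, ← h1]
        exact div_lt_div_of_pos_right hlt' (by simp [zero_lt_iff, hd0, hc0 j hj, hr0])
      · refine hm (i - j) (by omega) (by have := hlt i hi; omega) (d * c j / c i)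
          (div_mem (mul_mem hd (hE j)) (hE i)) ?_
        have h2 : r ^ i = r ^ (i - j) * r ^ j := by rw [← pow_add]; congr 1; omega
        have h3 : r ^ (i - j) - d * c j / c i = (c i * r ^ i - d * (c j * r ^ j)) / (c i * r ^ j) := by
          rw [h2]; have := hc0 i hi; field_simp
        have h4 : r ^ (i - j) = (c i * r ^ i) / (c i * r ^ j) := by
          rw [h2]; have := hc0 i hi; field_simp
        rw [h3, h4, map_div₀, map_div₀]
        exact div_lt_div_of_pos_right hlt' (by simp [zero_lt_iff, hc0 i hi, hr0]))
  obtain ⟨i, hi, hmax⟩ := Finset.exists_max_image S (fun j => O.valuation (c j * r ^ j)) (by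
    by_contra h; rw [Finset.not_nonempty_iff_eq_empty] at h; rw [h] at hz; simp at hz)
  exact ⟨i, hc0 i hi, le_antisymm (O.valuation.map_sum_le fun j hj => hmax j hj) (hV i hi)⟩
theorem Cx.Qa2 (O : ValuationSubring Ω) {E : IntermediateField k Ω} {r : Ω} (hr : r ^ ℓ ∈ E)
    (hr1 : O.valuation (r - 1) < 1) {g : Ω ≃ₐ[k] Ω} (hg : ∀ x ∈ E, g x = x) (hgr : g r ≠ r)
    {z : Ω} (hz0 : z ≠ 0) (hz : z ∈ IntermediateField.adjoin E {r}) : ∃ y ∈ E, O.valuation y = O.valuation z := by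
  classical
  obtain ⟨a, ha⟩ := hc.root_ratio (n := 1) (r := r) (r' := g r) (by rw [pow_one, ← map_pow, hg _ hr])
  set ω := ζ 1 ^ a with hω
  have hωl : ω ^ ℓ = 1 := by
    rw [hω, ← pow_mul, mul_comm, pow_mul]; have := (hc.prim 1).pow_eq_one; rw [pow_one] at this; rw [this, one_pow]
  have hω1 : ω ≠ 1 := by rintro h; rw [h, one_smul] at ha; exact hgr ha
  have hprim : IsPrimitiveRoot ω ℓ := by
    rw [← orderOf_eq_prime hωl hω1]; exact IsPrimitiveRoot.orderOf ω
  have hω0 : ω ≠ 0 := hprim.ne_zero hℓ.out.ne_zero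
  clear_value ω
  have hgi : ∀ i, (g ^ i) r = ω ^ i • r := by
    intro i
    induction i with
    | zero => simp
    | succ i ih => rw [pow_succ', AlgEquiv.mul_apply, ih, map_smul, ha, smul_smul, pow_succ]
  have hgE : ∀ i, ∀ x ∈ E, (g ^ i) x = x := fun i x hx => pow_fix (hg x hx) i
  have htr : ∀ y ∈ IntermediateField.adjoin E {r}, ∑ i ∈ Finset.range ℓ, (g ^ i) y ∈ E := by
    intro y hy
    obtain ⟨-, c, hcE, rfl⟩ := rep_adj hr hy
    have : ∑ i ∈ Finset.range ℓ, (g ^ i) (∑ j ∈ Finset.range ℓ, c j * r ^ j) =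
        ∑ j ∈ Finset.range ℓ, (∑ i ∈ Finset.range ℓ, (ω ^ j) ^ i) • (c j * r ^ j) := by
      simp only [map_sum, Finset.sum_smul]
      rw [Finset.sum_comm]
      refine Finset.sum_congr rfl fun j _ => Finset.sum_congr rfl fun i _ => ?_
      rw [map_mul, map_pow, hgE i _ (hcE j), hgi, smul_pow, ← pow_mul, ← pow_mul, mul_comm i j, mul_smul_comm]
    rw [this]
    refine sum_mem fun j hj => ?_
    rcases Nat.eq_zero_or_pos j with rfl | hj0
    · exact E.smul_mem (by simpa using hcE 0)
    · have h1 : ω ^ j ≠ 1 := hprim.pow_ne_one_of_pos_of_lt hj0.ne' (by simpa using hj)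
      have h2 : ∑ i ∈ Finset.range ℓ, (ω ^ j) ^ i = 0 := by
        have := mul_geom_sum (ω ^ j) ℓ
        rw [← pow_mul, mul_comm j, pow_mul, hωl, one_pow, sub_self] at this
        exact (mul_eq_zero.1 this).resolve_left (sub_ne_zero.2 h1)
      rw [h2, zero_smul]; exact zero_mem _
  have hvc : ∀ c : k, c ≠ 1 → O.valuation (r - algebraMap k Ω c) = 1 := by
    intro c hc1
    have : r - algebraMap k Ω c = (r - 1) + algebraMap k Ω (1 - c) := by rw [map_sub, map_one]; ring
    rw [this, Valuation.map_add_eq_of_lt_right, hc.vk O (sub_ne_zero.2 (Ne.symm hc1))]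
    rwa [hc.vk O (sub_ne_zero.2 (Ne.symm hc1))]
  set q := ∏ i ∈ Finset.Ico 1 ℓ, (r - algebraMap k Ω (ω ^ i)) with hq
  have hωi : ∀ i ∈ Finset.Ico 1 ℓ, ω ^ i ≠ 1 := fun i hi => by
    rw [Finset.mem_Ico] at hi; exact hprim.pow_ne_one_of_pos_of_lt (by omega) hi.2
  have hvq : O.valuation q = 1 := by
    rw [hq, map_prod]; exact Finset.prod_eq_one fun i hi => hvc _ (hωi i hi)
  have hq0 : q ≠ 0 := by intro h; rw [h] at hvq; simp at hvq
  have hqr : q ∈ IntermediateField.adjoin E {r} := prod_mem fun i _ =>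
    sub_mem (IntermediateField.mem_adjoin_simple_self _ _) (by
      have := (IntermediateField.adjoin E {r}).algebraMap_mem (algebraMap k E (ω ^ i))
      rwa [← IsScalarTower.algebraMap_apply] at this)
  have hgq : ∀ i ∈ Finset.Ico 1 ℓ, O.valuation ((g ^ i) q) < 1 := by
    intro i hi
    have h1 : (g ^ i) q = ∏ j ∈ Finset.Ico 1 ℓ, (ω ^ i • r - algebraMap k Ω (ω ^ j)) := by
      rw [hq, map_prod]; refine Finset.prod_congr rfl fun j _ => ?_
      rw [map_sub, hgi, AlgEquiv.commutes]
    have h2 : ∀ j, O.valuation (ω ^ i • r - algebraMap k Ω (ω ^ j)) ≤ 1 := fun j => by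
      refine (O.valuation.map_sub _ _).trans (max_le ?_ (hc.vk O (pow_ne_zero _ hω0)).le)
      rw [hc.vsm O (pow_ne_zero _ hω0), vone (x := r) (by rwa [Valuation.map_sub_swap])]
    rw [h1, ← Finset.mul_prod_erase _ _ hi, map_mul]
    refine mul_lt_one_of_lt_of_le ?_ (by rw [map_prod]; exact Finset.prod_le_one' fun j _ => h2 j)
    rw [show ω ^ i • r - algebraMap k Ω (ω ^ i) = ω ^ i • (r - 1) by
      rw [smul_sub, Algebra.algebraMap_eq_smul_one], hc.vsm O (pow_ne_zero _ hω0)]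
    exact hr1
  obtain ⟨z', hz'0, hz'r, hvz', hne⟩ : ∃ z', z' ≠ 0 ∧ z' ∈ IntermediateField.adjoin E {r} ∧
      O.valuation z' = O.valuation z ∧ ∀ i ∈ Finset.Ico 1 ℓ, O.valuation ((g ^ i) z') ≠ O.valuation z' := by
    by_contra hcon
    push Not at hcon
    choose f hf1 hf2 using fun m => hcon (z * q ^ m) (mul_ne_zero hz0 (pow_ne_zero _ hq0))
      (mul_mem hz (pow_mem hqr _)) (by rw [map_mul, map_pow, hvq, one_pow, mul_one])
    obtain ⟨m, -, m', -, hmm, hff⟩ := Finset.exists_ne_map_eq_of_card_lt_of_maps_to (s := Finset.range ℓ)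
      (t := Finset.Ico 1 ℓ) (f := f) (by simp [hℓ.out.pos]) (fun m _ => hf1 m)
    have h1 := hf2 m
    have h2 := hf2 m'
    rw [← hff] at h2
    simp only [map_mul, map_pow, hvq, one_pow, mul_one] at h1 h2
    have h3 : O.valuation ((g ^ f m) z) ≠ 0 := (map_ne_zero _).2 ((map_ne_zero_iff _ (g ^ f m).injective).2 hz0)
    have h4 := mul_left_cancel₀ h3 (h1.trans h2.symm)
    exact hmm ((pow_right_strictAnti₀ (zero_lt_iff.2 ((map_ne_zero _).2 ((map_ne_zero_iff _ (g ^ f m).injective).2 hq0)))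
      (hgq _ (hf1 m))).injective h4)
  rw [← hvz']
  obtain ⟨P, hPm, hP0⟩ := (rep_adj hr hz'r).1
  obtain ⟨i, hi0, -, c, hc0, hci⟩ := vtors O.valuation hz'0 P hPm.ne_zero hP0
  set n := 2 * i with hn
  set c' : Ω := (algebraMap E Ω c) ^ 2 with hc'
  have hc'E : c' ∈ E := pow_mem c.2 2
  have hc'0 : c' ≠ 0 := pow_ne_zero _ (by simpa using hc0)
  have hvn : O.valuation z' ^ n = O.valuation c' := by
    rw [hc', map_pow, ← hci, map_pow, ← pow_mul, mul_comm i 2]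
  have hvz0 : O.valuation z' ≠ 0 := by simpa using hz'0
  set t := z' ^ n / c' with ht
  have hvt : O.valuation t = 1 := by
    rw [ht, map_div₀, map_pow, hvn, div_self (by simpa using hc'0)]
  obtain ⟨lam, hl0, hl⟩ : ∃ lam : k, lam ≠ 0 ∧ O.valuation (t + algebraMap k Ω lam) = 1 := by
    by_cases h : O.valuation (t + 1) = 1
    · exact ⟨1, one_ne_zero, by simpa using h⟩
    · refine ⟨ω, hω0, ?_⟩
      have h1 : O.valuation (t + 1) < 1 := lt_of_le_of_ne
        ((O.valuation.map_add _ _).trans (by rw [hvt, map_one, max_self])) h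
      have h2 : O.valuation (algebraMap k Ω (ω - 1)) = 1 := hc.vk O (sub_ne_zero.2 hω1)
      rw [show t + algebraMap k Ω ω = (t + 1) + algebraMap k Ω (ω - 1) by rw [map_sub, map_one]; ring,
        Valuation.map_add_eq_of_lt_right _ (by rwa [h2]), h2]
  have hlE : algebraMap k Ω lam ∈ IntermediateField.adjoin E {r} := by
    have := (IntermediateField.adjoin E {r}).algebraMap_mem (algebraMap k E lam)
    rwa [← IsScalarTower.algebraMap_apply] at this
  have hcr : c' ∈ IntermediateField.adjoin E {r} := (IntermediateField.adjoin E {r}).algebraMap_mem ⟨c', hc'E⟩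
  set y := z' * t / (t + algebraMap k Ω lam) ^ 2 with hy
  have htr' : t ∈ IntermediateField.adjoin E {r} := div_mem (pow_mem hz'r _) hcr
  have hyr : y ∈ IntermediateField.adjoin E {r} :=
    div_mem (mul_mem hz'r htr') (pow_mem (add_mem htr' hlE) 2)
  have hvy : O.valuation y = O.valuation z' := by
    rw [hy, map_div₀, map_mul, map_pow, hl, hvt]; simp
  refine ⟨_, htr y hyr, ?_⟩
  obtain ⟨l', hl'⟩ : ∃ l', ℓ = l' + 1 := ⟨ℓ - 1, by have := hℓ.out.pos; omega⟩
  have hsm : O.valuation (∑ i ∈ Finset.Ico 1 ℓ, (g ^ i) y) < O.valuation y := by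
    refine O.valuation.map_sum_lt (by rw [hvy]; exact hvz0) fun i hi => ?_
    rw [hvy]
    have hgt : (g ^ i) t = ((g ^ i) z') ^ n / c' := by rw [ht, map_div₀, map_pow, hgE i _ hc'E]
    have hgy : (g ^ i) y = (g ^ i) z' * (g ^ i) t / ((g ^ i) t + algebraMap k Ω lam) ^ 2 := by
      rw [hy, map_div₀, map_mul, map_pow, map_add, AlgEquiv.commutes]
    have hgz0 : O.valuation ((g ^ i) z') ≠ 0 := (map_ne_zero _).2 ((map_ne_zero_iff _ (g ^ i).injective).2 hz'0)
    have hvgt : O.valuation ((g ^ i) t) = (O.valuation ((g ^ i) z') / O.valuation z') ^ n := by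
      rw [hgt, map_div₀, map_pow, ← hvn, div_pow]
    rw [hgy, map_div₀, map_mul, map_pow]
    rcases lt_or_gt_of_ne (hne i hi) with h | h
    · have h1 : O.valuation ((g ^ i) t) < 1 := by
        rw [hvgt]; exact pow_lt_one₀ zero_le' ((div_lt_one₀ (zero_lt_iff.2 hvz0)).2 h) (by omega)
      rw [Valuation.map_add_eq_of_lt_right _ (by rwa [hc.vk O hl0]), hc.vk O hl0, one_pow, div_one]
      exact (mul_le_of_le_one_right' h1.le).trans_lt h
    · have h0 : 1 < O.valuation ((g ^ i) z') / O.valuation z' := (one_lt_div₀ (zero_lt_iff.2 hvz0)).2 h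
      have h1 : 1 < O.valuation ((g ^ i) t) := by
        rw [hvgt]; exact one_lt_pow₀ h0 (by omega)
      have h1' : O.valuation ((g ^ i) t) ≠ 0 := (zero_lt_one.trans h1).ne'
      rw [Valuation.map_add_eq_of_lt_left _ (by rwa [hc.vk O hl0]), sq, mul_div_mul_right _ _ h1', hvgt]
      rw [div_lt_iff₀ (zero_lt_iff.2 (by rw [← hvgt]; exact h1'))]
      have h2 : O.valuation ((g ^ i) z') = O.valuation z' * (O.valuation ((g ^ i) z') / O.valuation z') := by
        rw [mul_div_cancel₀ _ hvz0]
      conv_lhs => rw [h2]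
      refine (mul_lt_mul_iff_right₀ (zero_lt_iff.2 hvz0)).2 ?_
      calc O.valuation ((g ^ i) z') / O.valuation z' = (O.valuation ((g ^ i) z') / O.valuation z') ^ 1 := (pow_one _).symm
        _ < _ := pow_lt_pow_right₀ h0 (by omega)
  rw [Finset.range_eq_Ico, Finset.sum_eq_sum_Ico_succ_bot hℓ.out.pos, pow_zero, AlgEquiv.one_apply,
    Valuation.map_add_eq_of_lt_left _ hsm, hvy]
end V
end S5
namespace S5
section V
variable {ℓ : ℕ} [hℓ : Fact ℓ.Prime] {k Ω : Type*} [Field k] [Field Ω] [Algebra k Ω] {ζ : ℕ → k}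
theorem nle1 {x : ℚ_[ℓ]} : ‖x‖ < ℓ ↔ ‖x‖ ≤ 1 := by
  have := Padic.norm_le_pow_iff_norm_lt_pow_add_one x 0
  simpa using this.symm
theorem bez {r : Ω} (hr : r ≠ 0) {m : ℕ} (hm0 : 0 < m) (hm : m < ℓ) {g : Ω ≃ₐ[k] Ω} (h1 : g (r ^ m) = r ^ m)
    (h2 : g (r ^ ℓ) = r ^ ℓ) : g r = r := by
  have hco : Int.gcd m ℓ = 1 := by
    have := (Nat.coprime_of_lt_prime (Nat.pos_iff_ne_zero.1 hm0) hm hℓ.out); simpa [Int.gcd] using this.symm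
  have hb := Int.gcd_eq_gcd_ab (m : ℤ) ℓ
  rw [hco] at hb
  have : r = (r ^ m) ^ (Int.gcdA m ℓ) * (r ^ ℓ) ^ (Int.gcdB m ℓ) := by
    rw [← zpow_natCast, ← zpow_natCast, ← zpow_mul, ← zpow_mul, ← zpow_add₀ hr, ← hb]; simp
  rw [this, map_mul, map_zpow₀, map_zpow₀, h1, h2]
theorem lt_adj {E : IntermediateField k Ω} {r : Ω} (hr : r ∉ E) :
    E < (IntermediateField.adjoin E {r}).restrictScalars k := by
  refine lt_of_le_of_ne (fun x hx => ?_) (fun h => hr ?_)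
  · rw [IntermediateField.mem_restrictScalars]
    exact (IntermediateField.adjoin E {r}).algebraMap_mem (⟨x, hx⟩ : E)
  · have h1 : r ∈ (IntermediateField.adjoin E {r}).restrictScalars k := by
      rw [IntermediateField.mem_restrictScalars]
      exact IntermediateField.mem_adjoin_simple_self E r
    rw [← h] at h1; exact h1
theorem chain_ub (P : Ω → Prop) (K' : IntermediateField k Ω) (hK : ∀ x ∈ K', P x) :
    ∃ E : IntermediateField k Ω, K' ≤ E ∧ (∀ x ∈ E, P x) ∧ ∀ E', E < E' → ∃ x ∈ E', ¬ P x := by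
  obtain ⟨E, hKE, hmax⟩ := zorn_le_nonempty₀ {E : IntermediateField k Ω | ∀ x ∈ E, P x} (fun c hcs hch E0 hE0 => by
    haveI : Nonempty c := ⟨⟨E0, hE0⟩⟩
    refine ⟨⨆ i : c, i.1, fun x hx => ?_, fun z hz => le_iSup (fun i : c => i.1) ⟨z, hz⟩⟩
    have hd : Directed (· ≤ ·) (fun i : c => i.1) := hch.directed
    rw [← SetLike.mem_coe, IntermediateField.coe_iSup_of_directed hd, Set.mem_iUnion] at hx
    obtain ⟨i, hi⟩ := hx
    exact hcs i.2 x hi) K' hK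
  refine ⟨E, hKE, hmax.1, fun E' hE => ?_⟩
  by_contra h
  push Not at h
  exact hE.not_ge (hmax.2 h hE.le)
variable (hc : Cx ℓ Ω ζ)
include hc
theorem Cx.Qa {Kb E : IntermediateField k Ω} (G : Gx ℓ Kb) {O : ValuationSubring Ω} {χ : Ω → ℚ_[ℓ]} (hχ : Chi O χ)
    (hKE : Kb ≤ E) (hE : ∀ x ∈ E, x ≠ 0 → ‖χ x‖ ≤ 1) (hmax : ∀ E', E < E' → ∃ x ∈ E', ¬ (x ≠ 0 → ‖χ x‖ ≤ 1))
    {r : Ω} (hr : r ∉ E) (hrl : r ^ ℓ ∈ E) : 1 < ‖χ r‖ := by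
  have hr0 : r ≠ 0 := by rintro rfl; exact hr (zero_mem _)
  have key : ∀ r', r' ∉ E → ∃ x ∈ IntermediateField.adjoin E {r'}, x ≠ 0 ∧ 1 < ‖χ x‖ := by
    intro r' hr'
    obtain ⟨x, hx, h⟩ := hmax _ (lt_adj hr')
    push Not at h
    exact ⟨x, hx, h⟩
  by_cases hm : ∀ m, 0 < m → m < ℓ → ∀ c ∈ E, ¬ O.valuation (r ^ m - c) < O.valuation (r ^ m)
  · obtain ⟨z, hz, hz0, hz1⟩ := key r hr
    obtain ⟨-, c, hcE, rfl⟩ := rep_adj hrl hz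
    obtain ⟨j, hj, hv⟩ := hc.Qa1 O hrl hr0 hm hcE hz0
    rw [hχ.eq hz0 hv, hχ.mul _ _ hj (pow_ne_zero _ hr0), hχ.pow hr0] at hz1
    by_contra hcon
    push Not at hcon
    refine hz1.not_ge ((Padic.nonarchimedean _ _).trans (max_le (hE _ (hcE j) hj) ?_))
    rw [norm_mul]
    exact mul_le_one₀ (Padic.norm_int_le_one j) (norm_nonneg _) hcon
  · exfalso
    push Not at hm
    obtain ⟨m, hm0, hml, c, hcE, hlt⟩ := hm
    have hvc : O.valuation c = O.valuation (r ^ m) := by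
      refine Valuation.map_eq_of_sub_lt _ ?_; rwa [Valuation.map_sub_swap]
    have hc0 : c ≠ 0 := by rintro rfl; simp at hlt
    obtain ⟨g, hg, hgr⟩ := G.mv E hKE r hr
    have hgr' : g (r ^ m / c) ≠ r ^ m / c := by
      intro h
      rw [map_div₀, hg c hcE, div_left_inj' hc0] at h
      exact hgr (bez hr0 hm0 hml h (hg _ hrl))
    have hr'l : (r ^ m / c) ^ ℓ ∈ E := by
      rw [div_pow, ← pow_mul, mul_comm, pow_mul]; exact div_mem (pow_mem hrl _) (pow_mem hcE _)
    obtain ⟨z, hz, hz0, hz1⟩ := key (r ^ m / c) (fun h => hgr' (hg _ h))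
    obtain ⟨y, hy, hvy⟩ := hc.Qa2 O hr'l (by
      rw [div_sub_one hc0, map_div₀, hvc]
      exact (div_lt_one₀ (by rw [zero_lt_iff]; exact (map_ne_zero _).2 (pow_ne_zero _ hr0))).2 hlt) hg hgr' hz0 hz
    rw [hχ.eq hz0 hvy.symm] at hz1
    exact hz1.not_ge (hE y hy (by rintro rfl; rw [map_zero, eq_comm, map_eq_zero] at hvy; exact hz0 hvy))
theorem Cx.Qc {Kb E : IntermediateField k Ω} (G : Gx ℓ Kb) {O : ValuationSubring Ω} {χ : Ω → ℚ_[ℓ]} (hχ : Chi O χ)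
    (hKE : Kb ≤ E) (hE : ∀ x ∈ E, x ≠ 0 → ‖χ x‖ ≤ 1) (hmax : ∀ E', E < E' → ∃ x ∈ E', ¬ (x ≠ 0 → ‖χ x‖ ≤ 1))
    (n : ℕ) {u : Ω} (hu0 : u ≠ 0) (hu : u ^ (ℓ ^ n) ∈ E) (h : ‖χ u‖ ≤ 1) : u ∈ E := by
  induction n with
  | zero => simpa using hu
  | succ n ih =>
    refine ih ?_
    by_contra hcon
    have := hc.Qa G hχ hKE hE hmax hcon (by rwa [← pow_mul, ← pow_succ])
    rw [hχ.pow hu0, norm_mul] at this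
    exact this.not_ge (mul_le_one₀ (Padic.norm_int_le_one _) (norm_nonneg _) h)
theorem Cx.Q {Kb K' : IntermediateField k Ω} (G : Gx ℓ Kb) {O : ValuationSubring Ω} {χ : Ω → ℚ_[ℓ]} (hχ : Chi O χ)
    (hK : Kb ≤ K') (hK' : ∀ x ∈ K', x ≠ 0 → ‖χ x‖ ≤ 1) :
    ∃ s : Ω ≃ₐ[k] Ω, s ∈ inertiaSubgroup O ∧ (∀ x ∈ K', s x = x) ∧
      ∀ (n : ℕ) (r : Ω), r ≠ 0 → r ^ (ℓ ^ n) ∈ K' → (s r = r ↔ ‖χ r‖ ≤ 1) := by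
  obtain ⟨E, hKE, hE, hmax⟩ := chain_ub (fun x => x ≠ 0 → ‖χ x‖ ≤ 1) K' hK'
  have hbE := hK.trans hKE
  suffices h : ∃ s : Ω ≃ₐ[k] Ω, ∀ x, s x = x ↔ x ∈ E by
    obtain ⟨s, hs⟩ := h
    have hpl : PL ℓ s := G.pl s fun x hx => (hs x).2 (hbE hx)
    have hf : ∀ x, x ∈ fixF ![s, s] ↔ x ∈ E := fun x => by rw [mem_fix2, and_self, hs]
    have hcl : ∀ (u : Ω) (n : ℕ), u ^ (ℓ ^ n) ∈ fixF ![s, s] → O.valuation u = 1 → u ∈ E := fun u n hu hv =>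
      hc.Qc G hχ hbE hE hmax n (by rintro rfl; simp at hv) ((hf _).1 hu) (by rw [hχ.unit u hv]; simp)
    have h1 := hc.R1 (s := s) (t := s) (g := s) rfl O (fun z => by simpa using hpl z)
      (fun u n hu hv => (hf u).2 (hcl u n hu (vone (by rwa [Valuation.map_sub_swap]))))
      (fun z => ⟨1, 0, by simp⟩)
    refine ⟨s, ⟨h1.1, h1.2 fun u n hu hv => (hs u).2 (hcl u n hu hv)⟩, fun x hx => (hs x).2 (hKE hx), ?_⟩
    exact fun n r hr0 hr => ⟨fun h => hE r ((hs r).1 h) hr0, fun h =>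
      (hs r).2 (hc.Qc G hχ hbE hE hmax n hr0 (hKE hr) h)⟩
  by_cases hT : E = ⊤
  · exact ⟨1, fun x => by simp [hT]⟩
  obtain ⟨r, -, hr, hrl⟩ := G.ku E ⊤ hbE (lt_top_iff_ne_top.2 hT)
  have hr0 : r ≠ 0 := by rintro rfl; exact hr (zero_mem _)
  obtain ⟨s, hs, hsr⟩ := G.mv E hbE r hr
  refine ⟨s, fun x => ⟨fun hx => ?_, hs x⟩⟩
  by_contra hxE
  obtain ⟨r', hr', hr'E, hr'l⟩ := G.ku E (fixF ![s, s]) hbE (lt_of_le_of_ne (fun y hy => by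
    rw [mem_fix2]; exact ⟨hs y hy, hs y hy⟩) (fun h => hxE (by rw [h, mem_fix2]; exact ⟨hx, hx⟩)))
  have hr'0 : r' ≠ 0 := by rintro rfl; exact hr'E (zero_mem _)
  have hl0 : (0 : ℝ) < ℓ := by exact_mod_cast hℓ.out.pos
  have hn : ∀ y, y ≠ 0 → y ∉ E → y ^ ℓ ∈ E → ‖χ y‖ = ℓ := by
    intro y hy0 hy hyl
    have h1 := hc.Qa G hχ hbE hE hmax hy hyl
    have h2 := hE _ hyl (pow_ne_zero _ hy0)
    rw [hχ.pow hy0, norm_mul, Padic.norm_p, inv_mul_le_iff₀ hl0, mul_one] at h2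
    refine le_antisymm h2 ?_
    by_contra hcon
    exact h1.not_ge (nle1.1 (not_le.1 hcon))
  have e1 := hn r hr0 hr hrl
  have e2 := hn r' hr'0 hr'E hr'l
  have hχ0 : χ r' ≠ 0 := by intro h; rw [h, norm_zero] at e2; exact hl0.ne e2
  obtain ⟨a, -, ha⟩ := PadicInt.exists_mem_range (p := ℓ) ⟨χ r / χ r', by
    rw [norm_div, e1, e2, div_self hl0.ne']⟩
  rw [IsLocalRing.mem_maximalIdeal, PadicInt.mem_nonunits, PadicInt.norm_def] at ha
  push_cast at ha
  have h3 : ‖χ (r / r' ^ a)‖ ≤ 1 := by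
    rw [hχ.div hr0 (pow_ne_zero _ hr'0), hχ.pow hr'0, ← nle1]
    have : χ r - a * χ r' = (χ r / χ r' - a) * χ r' := by field_simp
    rw [this, norm_mul, e2]
    exact mul_lt_of_lt_one_left hl0 ha
  have h4 : r / r' ^ a ∈ E := hc.Qc G hχ hbE hE hmax 1 (div_ne_zero hr0 (pow_ne_zero _ hr'0)) (by
    rw [pow_one, div_pow, ← pow_mul, mul_comm, pow_mul]; exact div_mem hrl (pow_mem hr'l _)) h3
  have h5 := hs _ h4
  rw [map_div₀, map_pow, (mem_fix2.1 hr').1, div_left_inj' (pow_ne_zero _ hr'0)] at h5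
  exact hsr h5
end V
end S5
namespace S5
section P
variable {ℓ : ℕ} [hℓ : Fact ℓ.Prime]
def plF {F M : Type*} [Field F] [Field M] [Algebra F M] (ℓ : ℕ) (σ : M ≃ₐ[F] M) : IntermediateField F M where
  carrier := {z | ∃ n, (σ ^ (ℓ ^ n)) z = z}
  mul_mem' := by
    rintro a b ⟨n, hn⟩ ⟨m, hm⟩
    exact ⟨n + m, by rw [map_mul, per_le hn (Nat.le_add_right n m), per_le hm (Nat.le_add_left m n)]⟩
  add_mem' := by
    rintro a b ⟨n, hn⟩ ⟨m, hm⟩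
    exact ⟨n + m, by rw [map_add, per_le hn (Nat.le_add_right n m), per_le hm (Nat.le_add_left m n)]⟩
  algebraMap_mem' c := ⟨0, by simp⟩
  inv_mem' := by rintro a ⟨n, hn⟩; exact ⟨n, by rw [map_inv₀, hn]⟩
theorem mem_plF {F M : Type*} [Field F] [Field M] [Algebra F M] {σ : M ≃ₐ[F] M} {z : M} :
    z ∈ plF ℓ σ ↔ ∃ n, (σ ^ (ℓ ^ n)) z = z := Iff.rfl
theorem pgroup {F M : Type*} [Field F] [Field M] [Algebra F M] [Normal F M] (L : IntermediateField F M)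
    [FiniteDimensional F L] [IsGalois F L] (h : ∀ σ : M ≃ₐ[F] M, L ≤ plF ℓ σ) : IsPGroup ℓ (L ≃ₐ[F] L) := by
  intro g
  obtain ⟨α, hα⟩ := Field.exists_primitive_element F L
  obtain ⟨n, hn⟩ := h (g.liftNormal M) α.2
  have hlift : ∀ (m : ℕ) (x : L), ((g.liftNormal M) ^ m) x = ((g ^ m) x : L) := by
    intro m
    induction m with
    | zero => intro x; simp
    | succ m ih =>
      intro x
      rw [pow_succ, AlgEquiv.mul_apply, pow_succ, AlgEquiv.mul_apply, ← ih]
      congr 1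
      exact g.liftNormal_commutes M x
  rw [hlift] at hn
  refine ⟨n, ?_⟩
  have h1 : (g ^ ℓ ^ n : L ≃ₐ[F] L).toAlgHom = AlgHom.id F L := by
    refine AlgHom.ext_of_adjoin_eq_top (s := {α}) ?_ ?_
    · rw [← IntermediateField.adjoin_simple_toSubalgebra_of_isAlgebraic (Algebra.IsAlgebraic.isAlgebraic α), hα]; rfl
    · rintro x rfl; exact Subtype.ext hn
  ext x
  exact congrArg _ (DFunLike.congr_fun h1 x)
theorem ku0 {E M : Type*} [Field E] [Field M] [Algebra E M] [IsGalois E M] (hp : ∀ σ : M ≃ₐ[E] M, ∀ z, z ∈ plF ℓ σ)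
    {ζ : E} (hζ : IsPrimitiveRoot ζ ℓ) {z : M} (hz : z ∉ Set.range (algebraMap E M)) :
    ∃ r ∈ IntermediateField.adjoin E {z}, r ∉ Set.range (algebraMap E M) ∧ r ^ ℓ ∈ Set.range (algebraMap E M) := by
  let L := (FiniteGaloisIntermediateField.adjoin E {z}).toIntermediateField
  have hzL : z ∈ L := FiniteGaloisIntermediateField.subset_adjoin E {z} rfl
  have hP : IsPGroup ℓ (L ≃ₐ[E] L) := pgroup L (fun σ x _ => hp σ x)
  obtain ⟨n, hn⟩ := IsPGroup.iff_card.1 hP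
  set B := IntermediateField.adjoin E {(⟨z, hzL⟩ : L)} with hB
  obtain ⟨a, ha⟩ := IsPGroup.iff_card.1 (hP.to_subgroup B.fixingSubgroup)
  have hlt : a < n := by
    refine lt_of_le_of_ne ?_ ?_
    · have := Subgroup.card_le_card_group B.fixingSubgroup
      rw [ha, hn] at this
      exact (Nat.pow_le_pow_iff_right hℓ.out.one_lt).1 this
    · rintro rfl
      have h1 : B.fixingSubgroup = ⊤ := Subgroup.eq_top_of_card_eq _ (ha.trans hn.symm)
      have h2 := IsGalois.fixedField_fixingSubgroup B
      have h3 : (⟨z, hzL⟩ : L) ∈ B := IntermediateField.mem_adjoin_simple_self _ _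
      rw [h1, IsGalois.fixedField_top] at h2
      rw [← h2, IntermediateField.mem_bot] at h3
      obtain ⟨c, hc⟩ := h3
      exact hz ⟨c, congrArg Subtype.val hc⟩
  obtain ⟨n', rfl⟩ : ∃ n', n = n' + 1 := ⟨n - 1, by omega⟩
  obtain ⟨Mx, hMc, hHM⟩ := Sylow.exists_subgroup_card_pow_prime_le ℓ (m := n') (by rw [hn]; exact pow_dvd_pow _ (by omega))
    B.fixingSubgroup ha (by omega)
  have hidx : Mx.index = ℓ := by
    have := Mx.card_mul_index
    rw [hMc, hn, pow_succ] at this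
    exact Nat.eq_of_mul_eq_mul_left (pow_pos hℓ.out.pos _) this
  haveI : Mx.Normal := Subgroup.normal_of_index_eq_minFac_card (by
    rw [hidx, hn, hℓ.out.pow_minFac (by omega)])
  set Fx := IntermediateField.fixedField Mx with hFx
  haveI : IsGalois E Fx := IsGalois.of_fixedField_normal_subgroup Mx
  have hfr : Module.finrank E Fx = ℓ := by
    have h1 := Module.finrank_mul_finrank E Fx L
    rw [IntermediateField.finrank_fixedField_eq_card, hMc, ← IsGalois.card_aut_eq_finrank E L, hn, pow_succ, mul_comm] at h1
    exact Nat.eq_of_mul_eq_mul_left (pow_pos hℓ.out.pos _) h1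
  haveI : IsCyclic (Fx ≃ₐ[E] Fx) := isCyclic_of_prime_card (p := ℓ) (by rw [IsGalois.card_aut_eq_finrank, hfr])
  obtain ⟨α, ⟨c, hc⟩, hα⟩ := exists_root_adjoin_eq_top_of_isCyclic E Fx ⟨ζ, by
    rw [hfr, mem_primitiveRoots hℓ.out.pos]; exact hζ⟩
  rw [hfr] at hc
  refine ⟨((α : L) : M), ?_, ?_, ⟨c, ?_⟩⟩
  · have h1 : (α : L) ∈ B := by
      rw [← IsGalois.fixedField_fixingSubgroup B]
      exact (IntermediateField.mem_fixedField_iff _ _).2 fun f hf => (IntermediateField.mem_fixedField_iff _ _).1 α.2 f (hHM hf)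
    have h2 : ((α : L) : M) ∈ B.map L.val := ⟨_, h1, rfl⟩
    rw [hB, IntermediateField.adjoin_map] at h2
    simpa using h2
  · rintro ⟨d, hd⟩
    have h1 : α ∈ (⊥ : IntermediateField E Fx) := by
      rw [IntermediateField.mem_bot]; exact ⟨d, Subtype.ext (Subtype.ext hd)⟩
    rw [IntermediateField.adjoin_simple_eq_bot_iff.2 h1] at hα
    have h2 := IntermediateField.bot_eq_top_iff_finrank_eq_one.1 hα
    rw [hfr] at h2
    exact hℓ.out.one_lt.ne' h2
  · have := congrArg (fun x : Fx => ((x : L) : M)) hc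
    exact this
variable (K : Type*) [Field K]
theorem proL_le (σ : AlgebraicClosure K ≃ₐ[K] AlgebraicClosure K) : proL ℓ K ≤ plF ℓ σ := by
  refine iSup₂_le ?_
  rintro L ⟨hL, n, hn⟩ z hz
  haveI := hL
  haveI : FiniteDimensional K L := Module.finite_of_finrank_pos (by rw [hn]; exact pow_pos hℓ.out.pos n)
  refine ⟨n, ?_⟩
  have h0 : ∀ (m : ℕ) (x : L), (σ ^ m) x = (((σ.restrictNormal L) ^ m) x : L) := by
    intro m
    induction m with
    | zero => intro x; simp
    | succ m ih =>
      intro x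
      rw [pow_succ, AlgEquiv.mul_apply, pow_succ, AlgEquiv.mul_apply, ← ih]
      congr 1
      exact (σ.restrictNormal_commutes L x).symm
  have h1 := h0 (ℓ ^ n) ⟨z, hz⟩
  rw [← hn, ← IsGalois.card_aut_eq_finrank, pow_card_eq_one', IsGalois.card_aut_eq_finrank, hn] at h1
  exact h1
theorem proL_sep : proL ℓ K ≤ separableClosure K (AlgebraicClosure K) := by
  refine iSup₂_le ?_
  rintro L ⟨hL, n, hn⟩
  rw [le_separableClosure_iff]; exact hL.1
theorem mem_proL {z : AlgebraicClosure K} (hs : IsSeparable K z)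
    (h : ∀ σ : AlgebraicClosure K ≃ₐ[K] AlgebraicClosure K, z ∈ plF ℓ σ) : z ∈ proL ℓ K := by
  set L := IntermediateField.adjoin K ((minpoly K z).rootSet (AlgebraicClosure K)) with hL
  haveI hsp : Polynomial.IsSplittingField K L (minpoly K z) :=
    IntermediateField.adjoin_rootSet_isSplittingField (IsAlgClosed.splits _)
  haveI : IsGalois K L := IsGalois.of_separable_splitting_field (p := minpoly K z) hs
  haveI : FiniteDimensional K L := Polynomial.IsSplittingField.finiteDimensional L (minpoly K z)
  have hint : IsIntegral K z := hs.isIntegral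
  have hzL : z ∈ L := IntermediateField.subset_adjoin _ _ (by
    rw [Polynomial.mem_rootSet]; exact ⟨minpoly.ne_zero hint, minpoly.aeval _ _⟩)
  have hP := pgroup (ℓ := ℓ) L (fun σ => by
    rw [hL, IntermediateField.adjoin_le_iff]
    intro y hy
    rw [Polynomial.mem_rootSet] at hy
    obtain ⟨τ, hτ⟩ := (Normal.minpoly_eq_iff_mem_orbit (F := K) (E := AlgebraicClosure K) (x := z) (y := y)).1
      (minpoly.eq_of_irreducible_of_monic (minpoly.irreducible hint) hy.2 (minpoly.monic hint))
    obtain ⟨n, hn⟩ := h (τ * σ * τ⁻¹)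
    refine ⟨n, τ.injective ?_⟩
    rw [conj_pow] at hn
    replace hτ : τ y = z := hτ
    rw [← hτ] at hn
    simpa [AlgEquiv.mul_apply] using hn)
  obtain ⟨n, hn⟩ := IsPGroup.iff_card.1 hP
  rw [IsGalois.card_aut_eq_finrank] at hn
  exact (le_iSup₂_of_le (f := fun (L : IntermediateField K (AlgebraicClosure K)) (_ : L ∈ {L : IntermediateField K (AlgebraicClosure K) |
      IsGalois K L ∧ ∃ n : ℕ, Module.finrank K L = ℓ ^ n}) => L) L ⟨inferInstance, n, hn⟩ le_rfl) hzL
end P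
end S5
namespace S5
section P
variable {ℓ : ℕ} [hℓ : Fact ℓ.Prime]
theorem proL_norm (K : Type*) [Field K] : IsGalois K (proL ℓ K) := by
  have hs : Algebra.IsSeparable K (proL ℓ K) := (le_separableClosure_iff _ _ _).1 (proL_sep K)
  have hn : Normal K (proL ℓ K) := by
    rw [IntermediateField.normal_iff_forall_map_le']
    rintro τ _ ⟨z, hz, rfl⟩
    refine mem_proL K ?_ fun σ => ?_
    · have h1 : IsSeparable K z := proL_sep K hz
      unfold IsSeparable at h1 ⊢
      change (minpoly K (τ z)).Separable
      rwa [minpoly.algEquiv_eq]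
    · obtain ⟨n, hn⟩ := proL_le (ℓ := ℓ) K (τ⁻¹ * σ * τ) hz
      refine ⟨n, ?_⟩
      have h2 : (τ⁻¹ * σ * τ) ^ ℓ ^ n = τ⁻¹ * σ ^ ℓ ^ n * τ := by simpa using conj_pow (a := τ⁻¹) (b := σ) (i := ℓ ^ n)
      rw [h2] at hn
      have := congrArg τ hn
      simp only [AlgEquiv.mul_apply] at this
      rw [← AlgEquiv.mul_apply τ τ⁻¹, mul_inv_cancel] at this
      exact this
  exact { }
theorem proL_PL (K : Type*) [Field K] (σ : proL ℓ K ≃ₐ[K] proL ℓ K) (z : proL ℓ K) :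
    ∃ n, (σ ^ (ℓ ^ n)) z = z := by
  obtain ⟨n, hn⟩ := proL_le (ℓ := ℓ) K (σ.liftNormal (AlgebraicClosure K)) z.2
  refine ⟨n, Subtype.ext ?_⟩
  have hlift : ∀ (m : ℕ) (x : proL ℓ K), ((σ.liftNormal (AlgebraicClosure K)) ^ m) x = ((σ ^ m) x : proL ℓ K) := by
    intro m
    induction m with
    | zero => intro x; simp
    | succ m ih =>
      intro x
      rw [pow_succ, AlgEquiv.mul_apply, pow_succ, AlgEquiv.mul_apply, ← ih]
      congr 1
      exact σ.liftNormal_commutes _ x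
  rw [← hlift]; exact hn
theorem proL_div {K : Type*} [Field K] {ω : K} (hω : IsPrimitiveRoot ω ℓ) (hl0 : (ℓ : K) ≠ 0) (x : proL ℓ K) :
    ∃ y, y ^ ℓ = x := by
  by_cases hx0 : x = 0
  · exact ⟨0, by rw [hx0, zero_pow hℓ.out.ne_zero]⟩
  obtain ⟨y, hy⟩ := IsAlgClosed.exists_pow_nat_eq (x : AlgebraicClosure K) hℓ.out.pos
  haveI hs : Algebra.IsSeparable K (proL ℓ K) := (proL_norm K).1
  suffices h : y ∈ proL ℓ K from ⟨⟨y, h⟩, Subtype.ext hy⟩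
  refine mem_proL K ?_ fun σ => ?_
  · refine IsSeparable.of_algebra_isSeparable_of_isSeparable K (E := proL ℓ K) ?_
    have h1 : (Polynomial.X ^ ℓ - Polynomial.C x).Separable :=
      Polynomial.separable_X_pow_sub_C x (by
        intro h; apply hl0
        rw [← map_natCast (algebraMap K (proL ℓ K))] at h
        exact (map_eq_zero _).1 h) hx0
    refine h1.of_dvd (minpoly.dvd _ _ ?_)
    simp [hy, IntermediateField.algebraMap_apply]
  · obtain ⟨n, hn⟩ := proL_le (ℓ := ℓ) K σ x.2
    have hy0 : y ≠ 0 := by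
      rintro rfl
      rw [zero_pow hℓ.out.ne_zero] at hy
      exact hx0 (Subtype.ext hy.symm)
    set τ := σ ^ ℓ ^ n with hτ
    have h1 : (τ y / y) ^ ℓ = 1 := by
      rw [div_pow, ← map_pow, hy, hn, div_self (by simpa using hx0)]
    obtain ⟨i, -, hi⟩ := (hω.map_of_injective (algebraMap K (AlgebraicClosure K)).injective).eq_pow_of_pow_eq_one h1
    have h2 : τ y = ω ^ i • y := by
      rw [Algebra.smul_def, map_pow, hi, div_mul_cancel₀ _ hy0]
    have h3 : ∀ m, (τ ^ m) y = (ω ^ i) ^ m • y := by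
      intro m
      induction m with
      | zero => simp
      | succ m ih => rw [pow_succ', AlgEquiv.mul_apply, ih, map_smul, h2, smul_smul, pow_succ]
    refine ⟨n + 1, ?_⟩
    rw [pow_succ, pow_mul, ← hτ, h3, ← pow_mul, mul_comm, pow_mul, hω.pow_eq_one, one_pow, one_smul]
theorem exists_zeta (k : Type*) [Field k] [IsAlgClosed k] (hl0 : (ℓ : k) ≠ 0) :
    ∃ ζ : ℕ → k, (∀ n, IsPrimitiveRoot (ζ n) (ℓ ^ n)) ∧ ∀ n, ζ (n + 1) ^ ℓ = ζ n := by
  haveI : NeZero (ℓ : k) := ⟨hl0⟩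
  have h1 : ∀ a : k, ∃ b : k, b ^ ℓ = a ∧ (a = 1 → b ≠ 1) := by
    intro a
    by_cases ha : a = 1
    · have := IsSepClosed.exists_root (Polynomial.cyclotomic ℓ k) (by
        rw [Polynomial.degree_cyclotomic]; have := Nat.totient_pos.2 hℓ.out.pos; exact_mod_cast this.ne')
        (Polynomial.separable_cyclotomic ℓ k)
      obtain ⟨b, hb⟩ := this
      rw [Polynomial.isRoot_cyclotomic_iff] at hb
      exact ⟨b, by rw [hb.pow_eq_one, ha], fun _ => hb.ne_one hℓ.out.one_lt⟩
    · obtain ⟨b, hb⟩ := IsAlgClosed.exists_pow_nat_eq a hℓ.out.pos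
      exact ⟨b, hb, fun h => absurd h ha⟩
  choose f hf hf1 using h1
  refine ⟨fun n => f^[n] 1, fun n => ?_, fun n => by simp only [Function.iterate_succ_apply', hf]⟩
  have hp : ∀ n m, (f^[n + m] 1) ^ ℓ ^ m = f^[n] 1 := by
    intro n m
    induction m with
    | zero => simp
    | succ m ih => rw [← add_assoc, Function.iterate_succ_apply', pow_succ', pow_mul, hf, ih]
  cases n with
  | zero => simp
  | succ n =>
    have : orderOf (f^[n + 1] 1) = ℓ ^ (n + 1) := orderOf_eq_prime_pow (by
      rw [add_comm, hp]; exact hf1 _ rfl) (by simpa using hp 0 (n + 1))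
    rw [← this]; exact IsPrimitiveRoot.orderOf _
theorem k_tors (p : ℕ) [Fact p.Prime] (k : Type*) [Field k] [CharP k p] (hk : Algebra.IsAlgebraic (⊥ : Subfield k) k)
    (c : k) (hc : c ≠ 0) : ∃ n, n ≠ 0 ∧ c ^ n = 1 := by
  letI : Algebra (ZMod p) k := ZMod.algebra k p
  haveI : Finite (⊥ : Subfield k) := by
    have hle : (⊥ : Subfield k) ≤ (algebraMap (ZMod p) k).fieldRange := bot_le
    haveI : Finite (algebraMap (ZMod p) k).fieldRange := Set.finite_range (algebraMap (ZMod p) k)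
    exact Finite.of_injective (Subfield.inclusion hle) (Subfield.inclusion hle).injective
  have hi : IsIntegral (⊥ : Subfield k) c := (hk.isAlgebraic c).isIntegral
  haveI := IntermediateField.adjoin.finiteDimensional hi
  haveI : Finite (IntermediateField.adjoin (⊥ : Subfield k) {c}) := Module.finite_of_finite (⊥ : Subfield k)
  set c' : (IntermediateField.adjoin (⊥ : Subfield k) {c}) := ⟨c, IntermediateField.mem_adjoin_simple_self _ _⟩
  have h0 : c' ≠ 0 := fun h => hc (congrArg Subtype.val h)
  obtain ⟨n, hn, h⟩ := isOfFinOrder_iff_pow_eq_one.1 (isOfFinOrder_of_finite (Units.mk0 c' h0))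
  exact ⟨n, hn.ne', by simpa [c'] using congrArg (fun u : _ˣ => ((u : IntermediateField.adjoin (⊥ : Subfield k) {c}) : k)) h⟩
section K
variable {k K : Type*} [Field k] [Field K] [Algebra k K]
theorem proL_cx (p : ℕ) [Fact p.Prime] [IsAlgClosed k] [CharP k p] (hpl : p ≠ ℓ) (hk : Algebra.IsAlgebraic (⊥ : Subfield k) k) :
    ∃ ζ : ℕ → k, Cx ℓ (proL ℓ K) ζ := by
  have hl0 : (ℓ : k) ≠ 0 := by
    rw [Ne, CharP.cast_eq_zero_iff k p, Nat.prime_dvd_prime_iff_eq Fact.out hℓ.out]; exact hpl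
  obtain ⟨ζ, h1, h2⟩ := exists_zeta (ℓ := ℓ) k hl0
  refine ⟨ζ, h1, h2, ?_, k_tors p k hk, hl0⟩
  have := h1 1
  rw [pow_one] at this
  exact proL_div (this.map_of_injective (algebraMap k K).injective) (by
    rw [← map_natCast (algebraMap k K)]; exact (map_ne_zero _).2 hl0)
noncomputable def Kb (ℓ : ℕ) (k K : Type*) [Field k] [Field K] [Algebra k K] : IntermediateField k (proL ℓ K) :=
  (⊥ : IntermediateField K (proL ℓ K)).restrictScalars k
theorem mem_Kb {x : proL ℓ K} : x ∈ Kb ℓ k K ↔ ∃ y, algebraMap K (proL ℓ K) y = x := by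
  unfold Kb; rw [IntermediateField.mem_restrictScalars, IntermediateField.mem_bot]; rfl
def upF {E : IntermediateField k (proL ℓ K)} (h : Kb ℓ k K ≤ E) : IntermediateField K (proL ℓ K) :=
  { E with algebraMap_mem' := fun c => h (mem_Kb.2 ⟨c, rfl⟩) }
theorem mem_upF {E : IntermediateField k (proL ℓ K)} {h : Kb ℓ k K ≤ E} {x : proL ℓ K} : x ∈ upF h ↔ x ∈ E := Iff.rfl
noncomputable def toK (σ : proL ℓ K ≃ₐ[k] proL ℓ K) (h : ∀ x ∈ Kb ℓ k K, σ x = x) : proL ℓ K ≃ₐ[K] proL ℓ K :=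
  AlgEquiv.ofRingEquiv (f := σ.toRingEquiv) (fun c => h _ (mem_Kb.2 ⟨c, rfl⟩))
theorem toK_pow (σ : proL ℓ K ≃ₐ[k] proL ℓ K) (h : ∀ x ∈ Kb ℓ k K, σ x = x) (n : ℕ) (x : proL ℓ K) :
    (toK σ h ^ n) x = (σ ^ n) x := by
  induction n with
  | zero => simp
  | succ n ih => rw [pow_succ', pow_succ', AlgEquiv.mul_apply, AlgEquiv.mul_apply, ih]; rfl
theorem proL_gx {ζ : ℕ → k} (hc : Cx ℓ (proL ℓ K) ζ) : Gx ℓ (Kb ℓ k K) := by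
  haveI := proL_norm (ℓ := ℓ) K
  refine ⟨fun σ h z => ?_, fun E hE x hx => ?_, fun E E' hE hEE => ?_⟩
  · obtain ⟨n, hn⟩ := proL_PL K (toK σ h) z
    rw [toK_pow] at hn
    exact ⟨n, hn⟩
  · have h1 : x ∉ Set.range (algebraMap (upF hE) (proL ℓ K)) := by
      rintro ⟨y, rfl⟩; exact hx y.2
    rw [InfiniteGalois.mem_range_algebraMap_iff_fixed] at h1
    push Not at h1
    obtain ⟨f, hf⟩ := h1
    exact ⟨(f.restrictScalars K).restrictScalars k, fun y hy => f.commutes ⟨y, hy⟩, hf⟩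
  · obtain ⟨z, hz, hzE⟩ := Set.exists_of_ssubset hEE
    have hpr := hc.prim 1
    rw [pow_one] at hpr
    obtain ⟨r, hr, hr1, c, hr2⟩ := ku0 (ℓ := ℓ) (E := upF hE) (M := proL ℓ K) (fun σ z => by
      obtain ⟨n, hn⟩ := proL_PL K (σ.restrictScalars K) z
      refine ⟨n, ?_⟩
      have h0 : ∀ m, ((σ.restrictScalars K) ^ m) z = (σ ^ m) z := by
        intro m
        induction m with
        | zero => simp
        | succ m ih => rw [pow_succ', pow_succ', AlgEquiv.mul_apply, AlgEquiv.mul_apply, ih]; rfl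
      rw [← h0]; exact hn) (ζ := (⟨algebraMap k _ (ζ 1), E.algebraMap_mem _⟩ : upF hE)) (by
        refine IsPrimitiveRoot.of_map_of_injective (f := algebraMap (upF hE) (proL ℓ K)) ?_ (algebraMap (upF hE) (proL ℓ K)).injective
        exact hpr.map_of_injective (algebraMap k (proL ℓ K)).injective) (z := z) (by
        rintro ⟨y, rfl⟩; exact hzE y.2)
    refine ⟨r, ?_, fun h => hr1 ⟨⟨r, h⟩, rfl⟩, by rw [← hr2]; exact c.2⟩
    have hle : IntermediateField.adjoin (upF hE) {z} ≤
        IntermediateField.extendScalars (F := upF hE) (E := upF (hE.trans hEE.le)) (fun x hx => hEE.le hx) := by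
      rw [IntermediateField.adjoin_simple_le_iff]; exact hz
    exact hle hr
end K
end P
end S5
namespace S5
section H
theorem exists_W {k N : Type*} [Field k] [Field N] [Algebra k N] {r : ℕ} {t : Fin r → N} (ht : AlgebraicIndependent k t) :
    ∃ W : ValuationSubring N, VInd W.valuation t ∧ ∀ i, W.valuation (t i) < 1 := by
  let Γ := Lex (Fin r → ℤ)
  let H := HahnSeries Γ k
  let γ : Fin r → Γ := fun i => toLex (Pi.single i 1)
  let X : Fin r → H := fun i => HahnSeries.single (γ i) 1
  let v : Valuation H (Multiplicative (WithTop Γ)ᵒᵈ) := AddValuation.toValuation (HahnSeries.addVal Γ k)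
  have hX0 : ∀ i, X i ≠ 0 := fun i => HahnSeries.single_ne_zero one_ne_zero
  have hz : ∀ i (n : ℤ), X i ^ n = HahnSeries.single (n • γ i) 1 := by
    intro i n
    cases n with
    | ofNat n => rw [Int.ofNat_eq_natCast, zpow_natCast, natCast_zsmul, HahnSeries.single_pow, one_pow]
    | negSucc n =>
      rw [zpow_negSucc, negSucc_zsmul, HahnSeries.single_pow, one_pow]
      refine inv_eq_of_mul_eq_one_right ?_
      rw [HahnSeries.single_mul_single, add_neg_cancel, one_mul]; rfl
  have hm : ∀ e, mon X e = HahnSeries.single (∑ i, e i • γ i) 1 := by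
    intro e
    unfold mon
    simp only [hz]
    induction (Finset.univ : Finset (Fin r)) using Finset.induction_on with
    | empty => simp
    | insert i S hi ih => rw [Finset.prod_insert hi, ih, HahnSeries.single_mul_single, one_mul, Finset.sum_insert hi]
  have hs : ∀ e : Fin r → ℤ, ∑ i, e i • γ i = toLex e := by
    intro e
    refine ofLex.injective (funext fun j => ?_)
    have h1 : ∀ S : Finset (Fin r), ofLex (∑ i ∈ S, e i • γ i) j = ∑ i ∈ S, e i * (Pi.single i 1 : Fin r → ℤ) j := by
      intro S
      induction S using Finset.induction_on with
      | empty => rfl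
      | insert i S hi ih => rw [Finset.sum_insert hi, Finset.sum_insert hi, ← ih]; rfl
    rw [h1]
    simp [Pi.single_apply]
  have hv : ∀ (g : Γ) (c : k), c ≠ 0 → v (HahnSeries.single g c) = Multiplicative.ofAdd (OrderDual.toDual (g : WithTop Γ)) := by
    intro g c hc
    change Multiplicative.ofAdd (OrderDual.toDual (HahnSeries.addVal Γ k _)) = _
    rw [HahnSeries.addVal_apply, HahnSeries.orderTop_single hc]
  have hXV : VInd v X := ⟨hX0, fun e he => by
    rw [hm, hs, hv _ _ one_ne_zero] at he
    have h1 : (toLex e : Γ) = 0 := WithTop.coe_injective (OrderDual.toDual.injective (Multiplicative.ofAdd.injective he))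
    exact toLex.injective h1⟩
  have hX : AlgebraicIndependent k X := hXV.algInd (fun d hd => by
    rw [HahnSeries.algebraMap_apply, HahnSeries.C_apply]
    exact hv 0 _ hd)
  let f : IntermediateField.adjoin k (Set.range t) →+* H :=
    ((IntermediateField.adjoin k (Set.range X)).val.toRingHom).comp
      ((hX.aevalEquivField.toRingEquiv.toRingHom).comp ht.aevalEquivField.symm.toRingEquiv.toRingHom)
  have hf : ∀ i, f ⟨t i, IntermediateField.subset_adjoin _ _ ⟨i, rfl⟩⟩ = X i := by
    intro i
    have h1 : ht.aevalEquivField.symm ⟨t i, IntermediateField.subset_adjoin _ _ ⟨i, rfl⟩⟩ =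
        algebraMap (MvPolynomial (Fin r) k) _ (MvPolynomial.X i) := by
      rw [AlgEquiv.symm_apply_eq]
      refine Subtype.ext ?_
      rw [ht.aevalEquivField_algebraMap_apply_coe]; simp
    change ((hX.aevalEquivField (ht.aevalEquivField.symm _) : IntermediateField.adjoin k (Set.range X)) : H) = X i
    rw [h1, hX.aevalEquivField_algebraMap_apply_coe]; simp
  obtain ⟨W, hW⟩ := ExtV (algebraMap (IntermediateField.adjoin k (Set.range t)) N) (v.valuationSubring.comap f)
  have hW' : ∀ y, (algebraMap (IntermediateField.adjoin k (Set.range t)) N) y ∈ W ↔ v (f y) ≤ 1 := by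
    intro y
    rw [← ValuationSubring.mem_comap, hW]; rfl
  have ht0 : ∀ i, t i ≠ 0 := ht.ne_zero
  have hlt : ∀ i, W.valuation (t i) < 1 := by
    intro i
    rw [vlt]
    right
    have := hW' (⟨t i, IntermediateField.subset_adjoin _ _ ⟨i, rfl⟩⟩⁻¹)
    rw [map_inv₀, map_inv₀, hf, map_inv₀] at this
    rw [show (t i)⁻¹ = (algebraMap (IntermediateField.adjoin k (Set.range t)) N ⟨t i, IntermediateField.subset_adjoin _ _ ⟨i, rfl⟩⟩)⁻¹ from rfl, this, not_le, one_lt_inv₀ (zero_lt_iff.2 (by simpa using hX0 i)), hv _ _ one_ne_zero]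
    change Multiplicative.ofAdd (OrderDual.toDual ((γ i : Γ) : WithTop Γ)) < Multiplicative.ofAdd (OrderDual.toDual ((0 : Γ) : WithTop Γ))
    rw [Multiplicative.ofAdd_lt, OrderDual.toDual_lt_toDual, WithTop.coe_lt_coe]
    exact ⟨i, fun j hj => by
      change (0 : ℤ) = (Pi.single i 1 : Fin r → ℤ) j
      rw [Pi.single_eq_of_ne (ne_of_lt hj)], by
      change (0 : ℤ) < (Pi.single i 1 : Fin r → ℤ) i
      simp⟩
  refine ⟨W, ⟨ht0, fun e he => hXV.2 e ?_⟩, hlt⟩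
  let y : IntermediateField.adjoin k (Set.range t) := mon (fun i => ⟨t i, IntermediateField.subset_adjoin _ _ ⟨i, rfl⟩⟩) e
  have hy : algebraMap _ N y = mon t e := by simp [y, mon]
  have hfy : f y = mon X e := by simp [y, mon, hf]
  have h1 := hW' y
  have h2 := hW' y⁻¹
  rw [hy, hfy] at h1
  rw [map_inv₀, map_inv₀, hy, hfy, map_inv₀] at h2
  rw [← ValuationSubring.valuation_le_one_iff, he] at h1
  rw [← ValuationSubring.valuation_le_one_iff, map_inv₀, he, inv_one] at h2
  have h3 := h1.1 le_rfl
  have h4 := h2.1 le_rfl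
  have h5 : v (mon X e) ≠ 0 := by simpa using mon_ne hX0 e
  refine le_antisymm h3 ?_
  rwa [inv_le_one₀ (zero_lt_iff.2 h5)] at h4
def cmp {Ω : Type*} [Field Ω] (O : ValuationSubring Ω) (W : ValuationSubring (IsLocalRing.ResidueField O)) : ValuationSubring Ω where
  carrier := {x | ∃ h : x ∈ O, IsLocalRing.residue O ⟨x, h⟩ ∈ W}
  mul_mem' := by rintro a b ⟨h, h'⟩ ⟨g, g'⟩; exact ⟨mul_mem h g, by have := mul_mem h' g'; rw [← map_mul] at this; exact this⟩
  one_mem' := ⟨one_mem _, by have := one_mem W; rw [← map_one (IsLocalRing.residue O)] at this; exact this⟩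
  add_mem' := by rintro a b ⟨h, h'⟩ ⟨g, g'⟩; exact ⟨add_mem h g, by have := add_mem h' g'; rw [← map_add] at this; exact this⟩
  zero_mem' := ⟨zero_mem _, by have := zero_mem W; rw [← map_zero (IsLocalRing.residue O)] at this; exact this⟩
  neg_mem' := by rintro a ⟨h, h'⟩; exact ⟨neg_mem h, by have := neg_mem h'; rw [← map_neg] at this; exact this⟩
  mem_or_inv_mem' := by
    intro x
    by_cases hx : x ∈ O
    · by_cases hx' : x⁻¹ ∈ O
      · by_cases h0 : x = 0
        · subst h0; exact .inl ⟨zero_mem _, by have := zero_mem W; rw [← map_zero (IsLocalRing.residue O)] at this; exact this⟩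
        have h2 : IsLocalRing.residue O ⟨x⁻¹, hx'⟩ = (IsLocalRing.residue O ⟨x, hx⟩)⁻¹ := by
          refine eq_inv_of_mul_eq_one_left ?_
          rw [← map_mul, ← map_one (IsLocalRing.residue O)]
          congr 1
          exact Subtype.ext (inv_mul_cancel₀ h0)
        rcases W.mem_or_inv_mem (IsLocalRing.residue O ⟨x, hx⟩) with h | h
        · exact .inl ⟨hx, h⟩
        · exact .inr ⟨hx', h2 ▸ h⟩
      · left
        refine ⟨hx, ?_⟩
        have : IsLocalRing.residue O ⟨x, hx⟩ = 0 := (res_zero _).2 (vlt.2 (.inr hx'))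
        rw [this]; exact zero_mem _
    · right
      have hx' := (O.mem_or_inv_mem x).resolve_left hx
      refine ⟨hx', ?_⟩
      have : IsLocalRing.residue O ⟨x⁻¹, hx'⟩ = 0 := (res_zero _).2 (vlt.2 (.inr (by simpa using hx)))
      rw [this]; exact zero_mem _
theorem mem_cmp {Ω : Type*} [Field Ω] {O : ValuationSubring Ω} {W : ValuationSubring (IsLocalRing.ResidueField O)} {x : Ω} :
    x ∈ cmp O W ↔ ∃ h : x ∈ O, IsLocalRing.residue O ⟨x, h⟩ ∈ W := Iff.rfl
end H
end S5
namespace S5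
section V
variable {ℓ : ℕ} [hℓ : Fact ℓ.Prime] {k Ω : Type*} [Field k] [Field Ω] [Algebra k Ω] {ζ : ℕ → k}
theorem chi_ext {O : ValuationSubring Ω} {ι : Type*} [Fintype ι] {x : ι → Ω} (hx : VInd O.valuation x) (c : ι → ℤ) :
    ∃ χ : Ω → ℚ_[ℓ], Chi O χ ∧ ∀ e, χ (mon x e) = ((∑ i, e i * c i : ℤ) : ℚ_[ℓ]) := by
  classical
  letI : DivisibleBy ℚ_[ℓ] ℤ :=
    { div := fun a n => a / n
      div_zero := fun a => by simp
      div_cancel := fun {n} a hn => by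
        have : (n : ℚ_[ℓ]) ≠ 0 := Int.cast_ne_zero.2 hn
        rw [zsmul_eq_mul, mul_div_cancel₀ _ this] }
  have h0 : ∀ y : Ω, y ≠ 0 → O.valuation y ≠ 0 := fun y hy => by simpa using hy
  let f : (ι → ℤ) →+ Additive (O.ValueGroup)ˣ :=
    { toFun := fun e => Additive.ofMul (Units.mk0 (O.valuation (mon x e)) (h0 _ (mon_ne hx.1 e)))
      map_zero' := by
        refine Additive.toMul.injective (Units.ext ?_)
        simp [mon]
      map_add' := fun e e' => by
        refine Additive.toMul.injective (Units.ext ?_)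
        simp [mon_add hx.1] }
  let g : (ι → ℤ) →+ ℚ_[ℓ] :=
    { toFun := fun e => ((∑ i, e i * c i : ℤ) : ℚ_[ℓ])
      map_zero' := by simp
      map_add' := fun e e' => by simp [add_mul, Finset.sum_add_distrib] }
  have hf : Function.Injective f := fun e e' h => hx.inj (by
    have := congrArg (fun a => ((Additive.toMul a : (O.ValueGroup)ˣ) : O.ValueGroup)) h
    exact this)
  obtain ⟨h, hh⟩ := (Module.Baer.of_divisible ℚ_[ℓ]).extension_property_addMonoidHom f hf g
  refine ⟨fun y => if hy : y = 0 then 0 else h (Additive.ofMul (Units.mk0 (O.valuation y) (h0 y hy))), ⟨?_, ?_⟩, ?_⟩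
  · intro y z hy hz
    rw [dif_neg hy, dif_neg hz, dif_neg (mul_ne_zero hy hz), ← map_add]
    congr 1
    refine Additive.toMul.injective (Units.ext ?_)
    simp
  · intro y hy
    have hy0 : y ≠ 0 := by rintro rfl; simp at hy
    rw [dif_neg hy0, ← map_zero h]
    congr 1
    refine Additive.toMul.injective (Units.ext ?_)
    simpa using hy
  · intro e
    exact (dif_neg (mon_ne hx.1 e)).trans (DFunLike.congr_fun hh e)
theorem cmp_le {O : ValuationSubring Ω} {W : ValuationSubring (IsLocalRing.ResidueField O)} : cmp O W ≤ O := fun _ h => h.1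
theorem vmono {O O' : ValuationSubring Ω} (h : O ≤ O') {x : Ω} (hx : O.valuation x = 1) : O'.valuation x = 1 := by
  refine le_antisymm ((O'.valuation_le_one_iff _).2 (h ((O.valuation_le_one_iff _).1 hx.le))) ?_
  by_contra! h1
  exact (vlt_mono h h1).ne hx
theorem cmp_vind {O : ValuationSubring Ω} {W : ValuationSubring (IsLocalRing.ResidueField O)} {ι : Type*} [Fintype ι]
    {T : ι → Ω} (hT : ∀ i, O.valuation (T i) = 1) (hT' : ∀ i, T i ∈ O)
    (hW : VInd W.valuation (fun i => IsLocalRing.residue O ⟨T i, hT' i⟩)) {π : Ω} (hπ0 : π ≠ 0) (hπ : O.valuation π < 1) :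
    VInd (cmp O W).valuation (Sum.elim T (fun _ : Unit => π)) := by
  have hT0 : ∀ i, T i ≠ 0 := fun i h => by have := hT i; rw [h] at this; simp at this
  refine ⟨Sum.rec hT0 (fun _ => hπ0), fun e he => ?_⟩
  have hm : mon (Sum.elim T (fun _ : Unit => π)) e = mon T (fun i => e (.inl i)) * π ^ e (.inr ()) := by
    simp [mon, Fintype.prod_sum_type]
  rw [hm] at he
  have hvm : ∀ e, O.valuation (mon T e) = 1 := by intro e; simp [mon, map_prod, hT]
  have h1 := vmono cmp_le he
  rw [map_mul, hvm, one_mul, map_zpow₀] at h1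
  have hm0 : e (.inr ()) = 0 := by
    by_contra hne
    have hp0 : (0 : O.ValueGroup) < O.valuation π := zero_lt_iff.2 (by simpa using hπ0)
    rcases lt_or_gt_of_ne hne with h | h
    · exact (one_lt_zpow_of_neg₀ hp0 hπ h).ne' h1
    · exact (zpow_lt_one₀ hp0 hπ h).ne h1
  rw [hm0, zpow_zero, mul_one] at he
  have hu : ∀ i, ∃ u : Oˣ, ((u : O) : Ω) = T i := fun i =>
    ⟨⟨⟨T i, hT' i⟩, ⟨(T i)⁻¹, (O.valuation_le_one_iff _).1 (by rw [map_inv₀, hT, inv_one])⟩,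
      Subtype.ext (mul_inv_cancel₀ (hT0 i)), Subtype.ext (inv_mul_cancel₀ (hT0 i))⟩, rfl⟩
  choose U hU using hu
  have key : ∀ e : ι → ℤ, ∃ h : mon T e ∈ O, IsLocalRing.residue O ⟨mon T e, h⟩ = mon (fun i => IsLocalRing.residue O ⟨T i, hT' i⟩) e := by
    intro e
    have hcoe : (((∏ i, U i ^ e i : Oˣ) : O) : Ω) = mon T e := by
      have : ∀ a : Oˣ, ((a : O) : Ω) = ((Units.map O.subtype.toMonoidHom a : Ωˣ) : Ω) := fun _ => rfl
      rw [this, map_prod, Units.coe_prod]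
      refine Finset.prod_congr rfl fun i _ => ?_
      rw [map_zpow, Units.val_zpow_eq_zpow_val, ← this, hU]
    refine ⟨hcoe ▸ ((∏ i, U i ^ e i : Oˣ) : O).2, ?_⟩
    rw [show (⟨mon T e, hcoe ▸ ((∏ i, U i ^ e i : Oˣ) : O).2⟩ : O) = ((∏ i, U i ^ e i : Oˣ) : O) from Subtype.ext hcoe.symm]
    have : ∀ a : Oˣ, IsLocalRing.residue O (a : O) = ((Units.map (IsLocalRing.residue O).toMonoidHom a : (IsLocalRing.ResidueField O)ˣ) : IsLocalRing.ResidueField O) := fun _ => rfl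
    rw [this, map_prod, Units.coe_prod]
    refine Finset.prod_congr rfl fun i _ => ?_
    rw [map_zpow, Units.val_zpow_eq_zpow_val, ← this]
    congr 2
    exact Subtype.ext (hU i)
  have h3 : (fun i => e (.inl i)) = 0 := by
    refine hW.2 _ ?_
    have a1 := ((cmp O W).valuation_le_one_iff _).1 he.le
    have a2 := ((cmp O W).valuation_le_one_iff (mon T (fun i => e (.inl i)))⁻¹).1 (by rw [map_inv₀, he, inv_one])
    rw [← mon_neg] at a2
    obtain ⟨b1, b1'⟩ := a1
    obtain ⟨b2, b2'⟩ := a2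
    rw [(key _).2, ← ValuationSubring.valuation_le_one_iff] at b1' b2'
    refine le_antisymm b1' ?_
    rw [mon_neg, map_inv₀, inv_le_one₀] at b2'
    · exact b2'
    · exact zero_lt_iff.2 (by simpa using mon_ne hW.1 _)
  funext j
  rcases j with i | j
  · exact congrFun h3 i
  · exact hm0
variable (hc : Cx ℓ Ω ζ)
include hc
theorem Cx.QQ {Kb K' : IntermediateField k Ω} (G : Gx ℓ Kb) {w : ValuationSubring Ω} (hK : Kb ≤ K') {ι κ : Type*} [Fintype ι]
    {x : ι → Ω} (hx : VInd w.valuation x) {u : κ → Ω} (hu : ∀ i, u i ∈ w)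
    (hind : letI := rAlg (hc.kmem w)
      AlgebraicIndependent k (fun i => IsLocalRing.residue w ⟨u i, hu i⟩)) {n : ℕ}
    (hn : ∀ y ∈ K', ∃ P : Polynomial (IntermediateField.adjoin k (Set.range (Sum.elim x u))), P ≠ 0 ∧ P.natDegree ≤ n ∧
      Polynomial.aeval y P = 0) (i0 : ι) :
    ∃ (s : Ω ≃ₐ[k] Ω) (χ : Ω → ℚ_[ℓ]), s ∈ inertiaSubgroup w ∧ (∀ y ∈ K', s y = y) ∧ Chi w χ ∧ χ (x i0) ≠ 0 ∧
      (∀ j, j ≠ i0 → χ (x j) = 0) ∧ ∀ y ∈ K', y ≠ 0 → (kap (ℓ := ℓ) ζ s y = 0 ↔ χ y = 0) := by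
  classical
  obtain ⟨χ, hχ, hχx⟩ := chi_ext (ℓ := ℓ) hx (fun i => if i = i0 then (n.factorial : ℤ) else 0)
  have hχe : ∀ e, χ (mon x e) = (e i0 : ℚ_[ℓ]) * n.factorial := by intro e; rw [hχx]; simp
  have hχj : ∀ j, χ (x j) = if j = i0 then (n.factorial : ℚ_[ℓ]) else 0 := by
    intro j
    have h1 : mon x (Pi.single j 1) = x j := by
      unfold mon
      rw [Finset.prod_eq_single j (fun i _ hi => by rw [Pi.single_eq_of_ne hi, zpow_zero]) (by simp)]
      simp
    rw [← h1, hχe]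
    by_cases h : j = i0
    · subst h; simp
    · rw [Pi.single_eq_of_ne (Ne.symm h), if_neg h]; simp
  have hint : ∀ y ∈ K', y ≠ 0 → ‖χ y‖ ≤ 1 := by
    intro y hy hy0
    obtain ⟨P, hP, hdeg, hroot⟩ := hn y hy
    obtain ⟨i, hi0, hi, c, hc0, hv⟩ := vtors w.valuation hy0 P hP hroot
    obtain ⟨e, he⟩ := (abh (hc.kmem w) hu hind hx).2 c c.2 (by simpa using hc0)
    have h1 : χ (y ^ i) = χ (mon x e) := hχ.eq (pow_ne_zero _ hy0) (hv.trans he)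
    rw [hχ.pow hy0, hχe] at h1
    obtain ⟨m, hm⟩ := Nat.dvd_factorial hi0 (hi.trans hdeg)
    rw [hm] at h1
    have hi' : (i : ℚ_[ℓ]) ≠ 0 := Nat.cast_ne_zero.2 hi0.ne'
    have h2 : χ y = ((e i0 * m : ℤ) : ℚ_[ℓ]) := by
      push_cast at h1 ⊢
      refine mul_left_cancel₀ hi' (h1.trans (by ring))
    rw [h2]
    exact Padic.norm_int_le_one _
  obtain ⟨s, hs, hsK, hsr⟩ := hc.Q G hχ hK hint
  refine ⟨s, χ, hs, hsK, hχ, ?_, fun j hj => by rw [hχj, if_neg hj], fun y hy hy0 => ?_⟩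
  · rw [hχj, if_pos rfl]; exact Nat.cast_ne_zero.2 (Nat.factorial_ne_zero n)
  have key : ∀ m, (ℓ : ℤ_[ℓ]) ^ m ∣ kap (ℓ := ℓ) ζ s y ↔ ‖χ y‖ ≤ ‖(ℓ : ℚ_[ℓ]) ^ m‖ := by
    intro m
    obtain ⟨r, hr⟩ := hc.root m y
    have hr0 : r ≠ 0 := by rintro rfl; rw [zero_pow (hc.lpos m).ne'] at hr; exact hy0 hr.symm
    have hl0 : (ℓ : ℚ_[ℓ]) ^ m ≠ 0 := pow_ne_zero _ (Nat.cast_ne_zero.2 hℓ.out.ne_zero)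
    rw [← hc.fix_iff (hsK y hy) hy0 hr, hsr m r hr0 (hr ▸ hy), ← hr, hχ.pow hr0, Nat.cast_pow, norm_mul]
    have : 0 < ‖(ℓ : ℚ_[ℓ]) ^ m‖ := norm_pos_iff.2 hl0
    constructor
    · intro h; nlinarith
    · intro h; by_contra! h'; nlinarith
  constructor
  · intro h
    rw [h] at key
    have h1 : ∀ m : ℕ, ‖χ y‖ ≤ ((ℓ : ℝ)⁻¹) ^ m := fun m => by
      have := (key m).1 (dvd_zero _)
      simpa using this
    have h2 := tendsto_pow_atTop_nhds_zero_of_lt_one (r := (ℓ : ℝ)⁻¹) (by positivity) (inv_lt_one_of_one_lt₀ (by exact_mod_cast hℓ.out.one_lt))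
    exact norm_le_zero_iff.1 (ge_of_tendsto' h2 h1)
  · intro h
    refine eq_zero_of_forall_dvd fun m => (key m).2 ?_
    rw [h, norm_zero]; exact norm_nonneg _
end V
end S5
namespace S5
section V
variable {ℓ : ℕ} [hℓ : Fact ℓ.Prime] {k Ω : Type*} [Field k] [Field Ω] [Algebra k Ω] {ζ : ℕ → k}
structure Fx (Kb : IntermediateField k Ω) (d : ℕ) : Prop where
  gen : ∃ S : Set Ω, S.Finite ∧ Kb = IntermediateField.adjoin k S
  td : Algebra.trdeg k Ω = d
theorem Fx.le {Kb : IntermediateField k Ω} {d : ℕ} (F : Fx Kb d) {ι : Type*} [Fintype ι] {b : ι → Ω}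
    (hb : AlgebraicIndependent k b) : Fintype.card ι ≤ d := by
  have := hb.lift_cardinalMk_le_trdeg
  rw [F.td] at this
  simpa using this
theorem Fx.basis {Kb : IntermediateField k Ω} {d : ℕ} (F : Fx Kb d) {ι : Type*} [Fintype ι] {b : ι → Ω}
    (hb : AlgebraicIndependent k b) (hd : Fintype.card ι = d) : IsTranscendenceBasis k b :=
  hb.isTranscendenceBasis_of_lift_trdeg_le_of_finite (by rw [F.td]; simp [hd])
theorem Fx.deg {Kb : IntermediateField k Ω} {d : ℕ} (F : Fx Kb d) {ι : Type*} [Fintype ι] {b : ι → Ω}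
    (hb : AlgebraicIndependent k b) (hd : Fintype.card ι = d) {S : Set Ω} (hS : S.Finite) :
    ∃ n, ∀ y ∈ Kb ⊔ IntermediateField.adjoin k S, ∃ P : Polynomial (IntermediateField.adjoin k (Set.range b)),
      P ≠ 0 ∧ P.natDegree ≤ n ∧ Polynomial.aeval y P = 0 := by
  obtain ⟨S0, hS0, rfl⟩ := F.gen
  have hA := (F.basis hb hd).isAlgebraic_field
  set M := IntermediateField.adjoin k (Set.range b)
  haveI : Finite ↑(S0 ∪ S) := (hS0.union hS).to_subtype
  haveI : FiniteDimensional M (IntermediateField.adjoin M (S0 ∪ S)) :=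
    IntermediateField.finiteDimensional_adjoin fun x _ => (hA.isAlgebraic x).isIntegral
  refine ⟨Module.finrank M (IntermediateField.adjoin M (S0 ∪ S)), fun y hy => ?_⟩
  have hy' : y ∈ (IntermediateField.adjoin M (S0 ∪ S)).restrictScalars k := by
    rw [← IntermediateField.adjoin_union] at hy
    have h1 : IntermediateField.adjoin k (S0 ∪ S) ≤ (IntermediateField.adjoin M (S0 ∪ S)).restrictScalars k :=
      IntermediateField.adjoin_le_iff.2 (fun z hz => IntermediateField.subset_adjoin M _ hz)
    exact h1 hy
  let y' : IntermediateField.adjoin M (S0 ∪ S) := ⟨y, hy'⟩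
  refine ⟨minpoly M y', minpoly.ne_zero (Algebra.IsIntegral.isIntegral y'), minpoly.natDegree_le _, ?_⟩
  have := congrArg (algebraMap (IntermediateField.adjoin M (S0 ∪ S)) Ω) (minpoly.aeval M y')
  rwa [← Polynomial.aeval_algebraMap_apply, map_zero] at this
variable (hc : Cx ℓ Ω ζ)
include hc
theorem Cx.QF {Kb : IntermediateField k Ω} {d : ℕ} (G : Gx ℓ Kb) (F : Fx Kb d) {w : ValuationSubring Ω} {ι κ : Type*} [Fintype ι]
    [Fintype κ] {x : ι → Ω} (hx : VInd w.valuation x) {u : κ → Ω} (hu : ∀ i, u i ∈ w)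
    (hind : letI := rAlg (hc.kmem w)
      AlgebraicIndependent k (fun i => IsLocalRing.residue w ⟨u i, hu i⟩)) (hd : Fintype.card ι + Fintype.card κ = d)
    {S : Set Ω} (hS : S.Finite) (i0 : ι) :
    ∃ (s : Ω ≃ₐ[k] Ω) (χ : Ω → ℚ_[ℓ]), s ∈ inertiaSubgroup w ∧ (∀ y ∈ Kb ⊔ IntermediateField.adjoin k S, s y = y) ∧ Chi w χ ∧
      χ (x i0) ≠ 0 ∧ (∀ j, j ≠ i0 → χ (x j) = 0) ∧
      ∀ y ∈ Kb ⊔ IntermediateField.adjoin k S, y ≠ 0 → (kap (ℓ := ℓ) ζ s y = 0 ↔ χ y = 0) := by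
  obtain ⟨n, hn⟩ := F.deg (abh (hc.kmem w) hu hind hx).1 (by simpa using hd) hS
  exact hc.QQ G le_sup_left hx hu hind hn i0
structure Wx (Kb : IntermediateField k Ω) (O : ValuationSubring Ω) (r : ℕ) : Prop where
  G : Gx ℓ Kb
  F : Fx Kb (r + 1)
  pi : ∃ π, π ≠ 0 ∧ O.valuation π < 1
  t : letI := rAlg (hc.kmem O)
    ∃ t : Fin r → IsLocalRing.ResidueField O, AlgebraicIndependent k t
  r1 : 1 ≤ r
variable {Kb : IntermediateField k Ω} {O : ValuationSubring Ω} {r : ℕ}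
omit hc in
theorem vunit {x : Ω} (hx : x ∈ O) (h : IsLocalRing.residue O ⟨x, hx⟩ ≠ 0) : O.valuation x = 1 :=
  le_antisymm ((O.valuation_le_one_iff _).2 hx) (not_lt.1 fun h' => h ((res_zero _).2 h'))
theorem Wx.core (H : Wx hc Kb O r) {t : Fin r → IsLocalRing.ResidueField O}
    (ht : letI := rAlg (hc.kmem O); AlgebraicIndependent k t) {T : Fin r → Ω} (hT : ∀ i, T i ∈ O)
    (hTt : ∀ i, IsLocalRing.residue O ⟨T i, hT i⟩ = t i) :
    ∃ w ≤ O, (∀ i, w.valuation (T i) < 1) ∧ ∀ (S : Set Ω) (_ : S.Finite) (i0 : Fin r), ∃ (s : Ω ≃ₐ[k] Ω) (χ : Ω → ℚ_[ℓ]),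
      s ∈ inertiaSubgroup w ∧ (∀ y ∈ Kb ⊔ IntermediateField.adjoin k S, s y = y) ∧ Chi w χ ∧
      χ (T i0) ≠ 0 ∧ (∀ j, j ≠ i0 → χ (T j) = 0) ∧
      ∀ y ∈ Kb ⊔ IntermediateField.adjoin k S, y ≠ 0 → (kap (ℓ := ℓ) ζ s y = 0 ↔ χ y = 0) := by
  letI := rAlg (hc.kmem O)
  obtain ⟨W, hW, hW1⟩ := exists_W ht
  obtain ⟨π, hπ0, hπ⟩ := H.pi
  have hTt' : (fun i => IsLocalRing.residue O ⟨T i, hT i⟩) = t := funext hTt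
  have h1 : ∀ i, O.valuation (T i) = 1 := fun i => vunit (hT i) (by rw [hTt]; exact hW.1 i)
  refine ⟨cmp O W, cmp_le, fun i => ?_, fun S hS i0 => ?_⟩
  · have hT0 : T i ≠ 0 := by intro h; have := h1 i; rw [h] at this; simp at this
    refine vlt.2 (.inr ?_)
    rintro ⟨h, h'⟩
    rcases vlt.1 (hW1 i) with h2 | h2
    · exact hW.1 i h2
    · refine h2 ?_
      have : IsLocalRing.residue O ⟨_, h⟩ * t i = 1 := by
        rw [← hTt, ← map_mul, ← map_one (IsLocalRing.residue O)]
        congr 1; exact Subtype.ext (inv_mul_cancel₀ hT0)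
      rwa [← eq_inv_of_mul_eq_one_left this]
  · letI := rAlg (hc.kmem (cmp O W))
    obtain ⟨s, χ, a1, a2, a3, a4, a5, a6⟩ := hc.QF H.G H.F (cmp_vind h1 hT (hTt' ▸ hW) hπ0 hπ) (u := fun i : Empty => i.elim)
      (fun i => i.elim) algebraicIndependent_empty_type (by simp) hS (.inl i0)
    exact ⟨s, χ, a1, a2, a3, a4, fun j hj => a5 (.inl j) (by simpa using hj), a6⟩
theorem Wx.pl (H : Wx hc Kb O r) {S : Set Ω} {s : Ω ≃ₐ[k] Ω} (h : ∀ y ∈ Kb ⊔ IntermediateField.adjoin k S, s y = y) : PL ℓ s :=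
  H.G.pl s fun x hx => h x ((le_sup_left : Kb ≤ Kb ⊔ _) hx)
theorem Cx.vpi {π : Ω} (hπ0 : π ≠ 0) (hπ : O.valuation π < 1) : VInd O.valuation (fun _ : Unit => π) := by
  have := cmp_vind (O := O) (W := ⊤) (T := fun i : Empty => i.elim) (fun i => i.elim) (fun i => i.elim) ⟨fun i => i.elim, fun e _ => Subsingleton.elim _ _⟩ hπ0 hπ
  refine ⟨fun _ => hπ0, fun e he => ?_⟩
  have h2 := this.2 (Sum.elim 0 e) ?_
  · funext i; exact congrFun h2 (.inr i)
  · rw [show cmp O ⊤ = O from le_antisymm cmp_le fun x hx => ⟨hx, trivial⟩, ← he]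
    simp [mon]
theorem Wx.A0 (H : Wx hc Kb O r) : ∃ s : Ω ≃ₐ[k] Ω, s ∈ inertiaSubgroup O ∧ (∀ y ∈ Kb, s y = y) ∧ s ≠ 1 := by
  letI := rAlg (hc.kmem O)
  obtain ⟨t, ht⟩ := H.t
  obtain ⟨π, hπ0, hπ⟩ := H.pi
  choose T hT using fun i => IsLocalRing.residue_surjective (R := O) (t i)
  obtain ⟨s, χ, a1, a2, a3, a4, a5, a6⟩ := hc.QF H.G H.F (hc.vpi hπ0 hπ) (u := fun i => (T i : Ω)) (fun i => (T i).2)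
    (by convert ht using 2 with i; exact hT i) (by simp [add_comm]) (Set.finite_singleton π) ()
  refine ⟨s, a1, fun y hy => a2 y ((le_sup_left : Kb ≤ Kb ⊔ _) hy), ?_⟩
  rintro rfl
  refine a4 ((a6 π ((le_sup_right : _ ≤ Kb ⊔ _) (IntermediateField.subset_adjoin k _ rfl)) hπ0).1 ?_)
  exact hc.kap_one_left hπ0
end V
end S5
namespace S5
section V
variable {ℓ : ℕ} [hℓ : Fact ℓ.Prime] {k Ω : Type*} [Field k] [Field Ω] [Algebra k Ω] {ζ : ℕ → k}
variable (hc : Cx ℓ Ω ζ)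
include hc
variable {Kb : IntermediateField k Ω} {O : ValuationSubring Ω} {r : ℕ}
theorem Cx.smul_lt {c : k} {R : Ω} (hR : O.valuation R = 1) (h : O.valuation (c • R - R) < 1) : c = 1 := by
  by_contra h1
  have : c • R - R = (c - 1) • R := by rw [sub_smul, one_smul]
  rw [this, hc.vsm O (sub_ne_zero.2 h1), hR] at h
  exact lt_irrefl _ h
theorem Cx.kap0 {s : Ω ≃ₐ[k] Ω} {x : Ω} (hx : s x = x) (hx0 : x ≠ 0) :
    kap (ℓ := ℓ) ζ s x = 0 ↔ ∀ n R, R ^ (ℓ ^ n) = x → s R = R := by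
  constructor
  · intro h n R hR
    rw [hc.fix_iff hx hx0 hR, h]; exact dvd_zero _
  · intro h
    refine eq_zero_of_forall_dvd fun n => ?_
    obtain ⟨R, hR⟩ := hc.root n x
    exact (hc.fix_iff hx hx0 hR).1 (h n R hR)
theorem Wx.A2 (H : Wx hc Kb O r) : ∃ s : Fin r → (Ω ≃ₐ[k] Ω), (∀ i, s i ∈ decompSubgroup O) ∧ (∀ i, ∀ y ∈ Kb, s i y = y) ∧
    (∀ i j, s i * s j = s j * s i) ∧ ∀ α : Fin r → ℤ_[ℓ], α ≠ 0 → ∀ h : Fin r → (Ω ≃ₐ[k] Ω), (∀ i, IsPw (s i) (α i) (h i)) →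
      (List.ofFn h).prod ∉ inertiaSubgroup O := by
  letI := rAlg (hc.kmem O)
  obtain ⟨t, ht⟩ := H.t
  choose T hT using fun i => IsLocalRing.residue_surjective (R := O) (t i)
  have hT1 : ∀ i, O.valuation (T i : Ω) = 1 := fun i => vunit (T i).2 (by
    rw [show IsLocalRing.residue O ⟨(T i : Ω), (T i).2⟩ = t i from hT i]; exact ht.ne_zero i)
  have hT0 : ∀ i, (T i : Ω) ≠ 0 := fun i h => by have := hT1 i; rw [h] at this; simp at this
  obtain ⟨w, hw, -, hw2⟩ := H.core hc ht (T := fun i => (T i : Ω)) (fun i => (T i).2) hT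
  choose s χ a1 a2 a3 a4 a5 a6 using hw2 _ (Set.finite_range fun i => (T i : Ω))
  have hTm : ∀ i, (T i : Ω) ∈ Kb ⊔ IntermediateField.adjoin k (Set.range fun i => (T i : Ω)) := fun i =>
    (le_sup_right : _ ≤ Kb ⊔ _) (IntermediateField.subset_adjoin k _ ⟨i, rfl⟩)
  have hK : ∀ i, ∀ y ∈ Kb, s i y = y := fun i y hy => a2 i y ((le_sup_left : Kb ≤ Kb ⊔ _) hy)
  have hp : ∀ i, PL ℓ (s i) := fun i => H.G.pl _ (hK i)
  refine ⟨s, fun i => coarseZ hw (T_le_Z (a1 i)) (hp i), hK, fun i j => ?_, ?_⟩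
  · refine hc.E (a1 j) (T_le_Z (a1 i)) (hp j) (hp i) (H.G.pl _ fun x hx => ?_)
    have : ∀ i, (s i)⁻¹ x = x := fun i => by
      conv_lhs => rw [← hK i x hx]
      exact (s i).symm_apply_apply x
    simp only [AlgEquiv.mul_apply, hK _ x hx, this]
  · intro α hα h hh hin
    obtain ⟨j, hj⟩ : ∃ j, α j ≠ 0 := by by_contra! hcon; exact hα (funext hcon)
    have hk0 : kap (ℓ := ℓ) ζ (s j) (T j : Ω) ≠ 0 := fun h => a4 j ((a6 j _ (hTm j) (hT0 j)).1 h)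
    refine mul_ne_zero hj hk0 (eq_zero_of_forall_dvd fun n => ?_)
    obtain ⟨R, hR⟩ := hc.root n (T j : Ω)
    have hR1 : O.valuation R = 1 := by
      have := hT1 j
      rw [← hR, map_pow] at this
      exact (pow_eq_one_iff.1 this).resolve_right (hc.lpos n).ne'
    have key := lprod_eig (h := h) (r := R) (c := fun i => zp ζ n (α i * kap ζ (s i) (T j : Ω))) (fun i => by
      have h1 := hc.kap_spec (a2 i _ (hTm j)) hR
      refine hc.pw_eig (hh i) ?_ h1
      rw [pow_eig h1, hc.zp_pow, one_smul])
    rw [Finset.prod_eq_single j (fun i _ hi => by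
      rw [(a6 i _ (hTm j) (hT0 j)).2 (a5 i j (Ne.symm hi)), mul_zero, hc.zp_zero]) (by simp)] at key
    rw [← hc.zp_eq_one]
    refine hc.smul_lt hR1 ?_
    rw [← key]
    exact hin.2 R ((O.valuation_le_one_iff _).1 hR1.le)
theorem Wx.td (H : Wx hc Kb O r) : letI := rAlg (hc.kmem O)
    Algebra.trdeg k (IsLocalRing.ResidueField O) = r := by
  letI := rAlg (hc.kmem O)
  obtain ⟨t, ht⟩ := H.t
  refine le_antisymm ?_ (by have := ht.lift_cardinalMk_le_trdeg; simpa using this)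
  by_contra! hcon
  obtain ⟨B, hB⟩ := exists_isTranscendenceBasis k (IsLocalRing.ResidueField O)
  rw [← hB.cardinalMk_eq_trdeg, ← Cardinal.natCast_add_one_le_iff] at hcon
  obtain ⟨e⟩ : Nonempty (Fin (r + 1) ↪ B) := by
    rw [← Cardinal.lift_mk_le']; simpa using hcon
  obtain ⟨π, hπ0, hπ⟩ := H.pi
  choose T hT using fun i => IsLocalRing.residue_surjective (R := O) (e i : IsLocalRing.ResidueField O)
  have := H.F.le (abh (hc.kmem O) (u := fun i => (T i : Ω)) (fun i => (T i).2)
    (by convert hB.1.comp _ e.injective using 2 with i; exact hT i) (hc.vpi hπ0 hπ)).1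
  simp at this
variable [IsAlgClosed k]
theorem Wx.NCg (H : Wx hc Kb O r) {Y : Ω} (hY : Y ∈ O) (hYk : ∀ b : k, ¬ O.valuation (Y - algebraMap k Ω b) < 1) :
    ∃ g : Ω ≃ₐ[k] Ω, g ∈ decompSubgroup O ∧ (∀ y ∈ Kb, g y = y) ∧ g Y = Y ∧ kap (ℓ := ℓ) ζ g Y = 0 ∧ kap (ℓ := ℓ) ζ g (1 - Y) ≠ 0 ∧
      ∀ c : k, c ≠ 0 → c ≠ 1 → kap (ℓ := ℓ) ζ g (1 - c • Y) = 0 := by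
  letI := rAlg (hc.kmem O)
  have hY1 : 1 - Y ∈ O := sub_mem (one_mem _) hY
  have htr : Transcendental k (IsLocalRing.residue O ⟨1 - Y, hY1⟩) := by
    intro hal
    obtain ⟨a, ha⟩ := alg_mem hal
    refine hYk (1 - a) ?_
    have h1 : IsLocalRing.residue O (⟨algebraMap k Ω a, hc.kmem O a⟩ - ⟨1 - Y, hY1⟩) = 0 := by
      rw [map_sub, sub_eq_zero]; exact ha
    rw [res_zero] at h1
    convert h1 using 2
    simp only [map_sub, map_one]
    push_cast
    ring
  obtain ⟨t, i0, ht, hti⟩ : ∃ (t : Fin r → IsLocalRing.ResidueField O) (i0 : Fin r), AlgebraicIndependent k t ∧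
      t i0 = IsLocalRing.residue O ⟨1 - Y, hY1⟩ := by
    obtain ⟨B, hB, hB'⟩ := exists_isTranscendenceBasis_superset (R := k) (s := {IsLocalRing.residue O ⟨1 - Y, hY1⟩})
      ((algebraicIndependent_singleton_iff (ι := ({IsLocalRing.residue O ⟨1 - Y, hY1⟩} : Set _)) ⟨_, rfl⟩).2 htr)
    have h1 := hB'.cardinalMk_eq_trdeg.trans (H.td hc)
    obtain ⟨e⟩ : Nonempty (B ≃ Fin r) := by
      rw [← Cardinal.lift_mk_eq']; simpa using h1
    exact ⟨fun i => e.symm i, e ⟨_, hB rfl⟩, hB'.1.comp _ e.symm.injective, by simp⟩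
  have : ∀ i, ∃ X : O, IsLocalRing.residue O X = t i ∧ (i = i0 → (X : Ω) = 1 - Y) := fun i => by
    by_cases h : i = i0
    · exact ⟨⟨1 - Y, hY1⟩, by rw [h, hti], fun _ => rfl⟩
    · obtain ⟨X, hX⟩ := IsLocalRing.residue_surjective (R := O) (t i)
      exact ⟨X, hX, fun h' => absurd h' h⟩
  choose T hT hT' using this
  obtain ⟨w, hw, hw1, hw2⟩ := H.core hc ht (T := fun i => (T i : Ω)) (fun i => (T i).2) hT
  obtain ⟨g, χ, a1, a2, a3, a4, a5, a6⟩ := hw2 _ (Set.finite_singleton Y) i0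
  have hlt := hw1 i0
  simp only [hT' i0 rfl] at a4 hlt
  have hYm : Y ∈ Kb ⊔ IntermediateField.adjoin k {Y} :=
    (le_sup_right : _ ≤ Kb ⊔ _) (IntermediateField.subset_adjoin k _ rfl)
  have hK : ∀ y ∈ Kb, g y = y := fun y hy => a2 y ((le_sup_left : Kb ≤ Kb ⊔ _) hy)
  have v0 : ∀ x : Ω, w.valuation x = 1 → x ≠ 0 := by rintro x h rfl; simp at h
  refine ⟨g, coarseZ hw (T_le_Z a1) (H.G.pl _ hK), hK, a2 Y hYm, ?_, ?_, fun c h0 h1 => ?_⟩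
  · exact (a6 Y hYm (v0 _ (vone hlt))).2 (a3.unit _ (vone hlt))
  · refine fun h => a4 ((a6 _ (sub_mem (one_mem _) hYm) ?_).1 h)
    intro h
    exact ht.ne_zero i0 (by rw [hti, res_zero]; simp [h])
  · have h2 : w.valuation (1 - c • Y) = 1 := by
      have e : 1 - c • Y = algebraMap k Ω (1 - c) + c • (1 - Y) := by
        rw [map_sub, map_one, smul_sub, Algebra.algebraMap_eq_smul_one]; ring
      have := hc.vk w (sub_ne_zero.2 (Ne.symm h1))
      rw [e, Valuation.map_add_eq_of_lt_left, this]
      rw [this, hc.vsm w h0]; exact hlt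
    exact (a6 _ (sub_mem (one_mem _) (IntermediateField.smul_mem _ hYm)) (v0 _ h2)).2 (a3.unit _ h2)
theorem Wx.data (H : Wx hc Kb O r) {a : Ω ≃ₐ[k] Ω} (ha : a ∈ decompSubgroup O) (hp : PL ℓ a) (h : a ∉ inertiaSubgroup O) :
    ∃ (j : ℕ) (Y : Ω) (c : k) (g : Ω ≃ₐ[k] Ω), Y ≠ 0 ∧ 1 - Y ≠ 0 ∧ (a ^ (ℓ ^ j)) Y = c • Y ∧ c ^ ℓ = 1 ∧ c ≠ 1 ∧
      g ∈ decompSubgroup O ∧ (∀ y ∈ Kb, g y = y) ∧ g Y = Y ∧ kap (ℓ := ℓ) ζ g Y = 0 ∧ kap (ℓ := ℓ) ζ g (1 - Y) ≠ 0 ∧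
      ∀ c : k, c ≠ 0 → c ≠ 1 → kap (ℓ := ℓ) ζ g (1 - c • Y) = 0 := by
  obtain ⟨j, Y, c, h1, h2, h3, h4⟩ := hc.exists_eig ha hp h
  have hY : ∀ b : k, ¬ O.valuation (Y - algebraMap k Ω b) < 1 := by
    intro b hb
    have h5 : O.valuation (c • Y - algebraMap k Ω b) < 1 := by
      rw [← h2, ← AlgEquiv.commutes (a ^ (ℓ ^ j)) b, ← map_sub, vfix (pow_mem ha _) (hp.pow _)]; exact hb
    refine h4 (hc.smul_lt h1 ?_)
    rw [show c • Y - Y = (c • Y - algebraMap k Ω b) - (Y - algebraMap k Ω b) by ring]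
    exact Valuation.map_sub_lt _ h5 hb
  obtain ⟨g, a1, a2, a3, a4, a5, a6⟩ := H.NCg hc ((O.valuation_le_one_iff _).1 h1.le) hY
  refine ⟨j, Y, c, g, ?_, ?_, h2, h3, h4, a1, a2, a3, a4, a5, a6⟩
  · rintro rfl; simp at h1
  · intro h; refine hY 1 ?_
    rw [map_one, ← neg_sub, h]; simp
theorem Wx.NC (H : Wx hc Kb O r) {a : Ω ≃ₐ[k] Ω} (ha : a ∈ decompSubgroup O) (hp : PL ℓ a) (h : a ∉ inertiaSubgroup O) :
    ∃ g : Ω ≃ₐ[k] Ω, g ∈ decompSubgroup O ∧ (∀ y ∈ Kb, g y = y) ∧ ∀ m, m ≠ 0 → g ^ m * a ≠ a * g ^ m := by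
  obtain ⟨j, Y, c, g, hY0, hY1, hY, hcl, hc1, a1, a2, a3, a4, a5, a6⟩ := H.data hc ha hp h
  refine ⟨g, a1, a2, fun m hm hcom => ?_⟩
  have hc0 : c ≠ 0 := by rintro rfl; rw [zero_pow hℓ.out.ne_zero] at hcl; exact zero_ne_one hcl
  have hcom' : a ^ (ℓ ^ j) * g ^ m * (a ^ (ℓ ^ j))⁻¹ = g ^ m := by
    rw [mul_inv_eq_iff_eq_mul]; exact ((show Commute (g ^ m) a from hcom).pow_right _).eq.symm
  have hg : (g ^ m) (1 - Y) = 1 - Y := by rw [map_sub, map_one, pow_fix a3]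
  have h1 := hc.kap_conj' (g := a ^ (ℓ ^ j)) hg hY1
  have g1 : g (1 - Y) = 1 - Y := by rw [map_sub, map_one, a3]
  have g2 : g (1 - c • Y) = 1 - c • Y := by rw [map_sub, map_one, map_smul, a3]
  have h0 : 1 - c • Y ≠ 0 := by
    intro h0
    refine hY1 ((a ^ (ℓ ^ j)).injective ?_)
    rw [map_sub, map_one, hY, h0, map_zero]
  rw [hcom', map_sub, map_one, hY, hc.kap_pow g1 hY1, hc.kap_pow g2 h0, a6 c hc0 hc1, mul_zero] at h1
  exact mul_ne_zero (Nat.cast_ne_zero.2 hm) a5 h1.symm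
theorem Wx.A3 (H : Wx hc Kb O r) {T : Subgroup (Ω ≃ₐ[k] Ω)} (hT : ∀ a ∈ T, a ∈ decompSubgroup O) (hTK : ∀ a ∈ T, ∀ y ∈ Kb, a y = y)
    (hab : ∀ a ∈ T, ∀ b ∈ T, a * b = b * a)
    (hn : ∀ g : Ω ≃ₐ[k] Ω, g ∈ decompSubgroup O → (∀ y ∈ Kb, g y = y) → ∀ a ∈ T, g * a * g⁻¹ ∈ T) :
    ∀ a ∈ T, a ∈ inertiaSubgroup O := by
  intro a haT
  by_contra h
  obtain ⟨j, Y, c, g, hY0, hY1, hY, hcl, hc1, a1, a2, a3, a4, a5, a6⟩ := H.data hc (hT a haT) (H.G.pl _ (hTK a haT)) h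
  have hc0 : c ≠ 0 := by rintro rfl; rw [zero_pow hℓ.out.ne_zero] at hcl; exact zero_ne_one hcl
  have ha' := pow_mem haT (ℓ ^ j)
  generalize a ^ (ℓ ^ j) = a' at hY ha'
  have hYi : a'⁻¹ Y = c⁻¹ • Y := by
    refine a'.injective ?_
    rw [map_smul, hY, smul_smul, inv_mul_cancel₀ hc0, one_smul]
    exact a'.apply_symm_apply Y
  have hai : ∀ x, a' (a'⁻¹ x) = x := a'.apply_symm_apply
  have gi : ∀ x, g x = x → g⁻¹ x = x := fun x hx => by
    conv_lhs => rw [← hx]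
    exact g.symm_apply_apply x
  set b := g * a' * g⁻¹ * a'⁻¹ with hb
  have hbT : b ∈ T := mul_mem (hn g a1 a2 a' ha') (inv_mem ha')
  have hbx : ∀ x, g (a'⁻¹ x) = a'⁻¹ x → b x = g x := fun x hx => by
    simp only [hb, AlgEquiv.mul_apply, gi _ hx, hai]
  have gc : ∀ d : k, g (d • Y) = d • Y := fun d => by rw [map_smul, a3]
  have hbY : b Y = Y := by rw [hbx _ (by rw [hYi, gc]), a3]
  have kb : kap (ℓ := ℓ) ζ b Y = 0 := by
    refine (hc.kap0 hbY hY0).2 fun n R hR => ?_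
    rw [hbx, (hc.kap0 a3 hY0).1 a4 n R hR]
    refine (hc.kap0 (gc c⁻¹) (smul_ne_zero (inv_ne_zero hc0) hY0)).1 ?_ n _ (by rw [← map_pow, hR, hYi])
    rw [hc.kap_smul (n := ℓ) hℓ.out.ne_zero (by rw [inv_pow, hcl, inv_one]) a3 hY0, a4]
  have hsY : (a' ^ ℓ) Y = Y := by rw [pow_eig hY, hcl, one_smul]
  have ks : kap (ℓ := ℓ) ζ (a' ^ ℓ) Y ≠ 0 := by
    intro h0
    obtain ⟨R, hR⟩ := hc.root 1 Y
    have hsR := (hc.kap0 hsY hY0).1 h0 1 R hR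
    have hR0 : R ≠ 0 := by rintro rfl; rw [zero_pow (hc.lpos 1).ne'] at hR; exact hY0 hR.symm
    obtain ⟨d, hd⟩ := IsAlgClosed.exists_pow_nat_eq c hℓ.out.pos
    obtain ⟨e, he⟩ := hc.root_ratio (n := 1) (r := d • R) (r' := a' R) (by
      rw [smul_pow, hR, ← map_pow, hR, hY, pow_one, hd])
    rw [smul_smul] at he
    have := pow_eig he ℓ
    rw [hsR, mul_pow, hd, ← pow_mul, mul_comm e, pow_mul, ← pow_one ℓ, (hc.prim 1).pow_eq_one, one_pow, one_mul] at this
    refine hc1 (smul_left_injective k hR0 ?_)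
    simp only [← this, one_smul]
  have h1 := hc.cpair (hab _ (pow_mem ha' ℓ) _ hbT) hsY hbY hY0 hY1
  rw [kb, zero_mul] at h1
  have h2 := (mul_eq_zero.1 h1).resolve_left ks
  have gY : g (1 - Y) = 1 - Y := by rw [map_sub, map_one, a3]
  have bY : b (1 - Y) = 1 - Y := by rw [map_sub, map_one, hbY]
  have hai1 : a'⁻¹ (1 - Y) = 1 - c⁻¹ • Y := by rw [map_sub, map_one, hYi]
  refine a5 ((hc.kap0 gY hY1).2 fun n R hR => ?_)
  rw [← hbx, (hc.kap0 bY hY1).1 h2 n R hR]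
  refine (hc.kap0 (x := 1 - c⁻¹ • Y) (by rw [map_sub, map_one, gc]) ?_).1 (a6 c⁻¹ (inv_ne_zero hc0) (by simpa using hc1)) n _ (by rw [← map_pow, hR, hai1])
  rw [← hai1]; exact fun h => hY1 (a'⁻¹.injective (h.trans (map_zero _).symm))
end V
end S5
namespace S5
section V
variable {ℓ : ℕ} [hℓ : Fact ℓ.Prime] {k Ω : Type*} [Field k] [Field Ω] [Algebra k Ω] {ζ : ℕ → k}
omit hℓ in
theorem pow_mod {g : Ω ≃ₐ[k] Ω} {z : Ω} {q : ℕ} (hz : (g ^ q) z = z) (a : ℕ) : (g ^ a) z = (g ^ (a % q)) z := by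
  conv_lhs => rw [← Nat.mod_add_div a q, pow_add, AlgEquiv.mul_apply, pow_mul, pow_fix hz]
theorem pow_cong {g : Ω ≃ₐ[k] Ω} {z : Ω} {n : ℕ} (hz : (g ^ (ℓ ^ n)) z = z) {a b : ℕ} (h : (ℓ : ℤ_[ℓ]) ^ n ∣ (a : ℤ_[ℓ]) - b) :
    (g ^ a) z = (g ^ b) z := by
  rw [pow_mod hz a, pow_mod hz b]
  have : ((ℓ ^ n : ℕ) : ℤ) ∣ (a : ℤ) - b := by
    push_cast
    rw [← PadicInt.pow_p_dvd_int_iff]; push_cast; exact h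
  rw [(Nat.modEq_iff_dvd.2 this : b ≡ a [MOD ℓ ^ n])]
theorem IsPw.eq {g h : Ω ≃ₐ[k] Ω} {c : ℤ_[ℓ]} (H : IsPw g c h) {z : Ω} {n : ℕ} (hz : (g ^ (ℓ ^ n)) z = z) {e : ℕ}
    (he : (ℓ : ℤ_[ℓ]) ^ n ∣ c - e) : h z = (g ^ e) z := by
  rw [H z n hz]
  refine pow_cong hz ?_
  have := dvd_sub he (dvd_val n c)
  rwa [sub_sub_sub_cancel_left] at this
theorem IsPw.of {g h : Ω ≃ₐ[k] Ω} {c : ℤ_[ℓ]} (H : ∀ z n, (g ^ (ℓ ^ n)) z = z → ∃ e : ℕ, (ℓ : ℤ_[ℓ]) ^ n ∣ c - e ∧ h z = (g ^ e) z) :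
    IsPw g c h := by
  intro z n hz
  obtain ⟨e, he, h1⟩ := H z n hz
  rw [h1]
  refine pow_cong hz ?_
  have := dvd_sub (dvd_val n c) he
  rwa [sub_sub_sub_cancel_left] at this
theorem IsPw.uniq {g h h' : Ω ≃ₐ[k] Ω} {c : ℤ_[ℓ]} (hp : PL ℓ g) (H : IsPw g c h) (H' : IsPw g c h') : h = h' := by
  ext z
  obtain ⟨n, hn⟩ := hp z
  rw [H z n hn, H' z n hn]
theorem IsPw.nat (g : Ω ≃ₐ[k] Ω) (m : ℕ) : IsPw g (m : ℤ_[ℓ]) (g ^ m) :=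
  .of fun z n _ => ⟨m, by simp, rfl⟩
theorem IsPw.comp {g h m : Ω ≃ₐ[k] Ω} {a b : ℤ_[ℓ]} (H : IsPw g a h) (H' : IsPw h b m) : IsPw g (a * b) m := by
  refine .of fun z n hz => ?_
  have h1 : ∀ j, (h ^ j) z = (g ^ ((PadicInt.toZModPow n a).val * j)) z := by
    intro j
    induction j with
    | zero => simp
    | succ j ih =>
      rw [pow_succ', AlgEquiv.mul_apply, ih, H _ n, ← AlgEquiv.mul_apply, ← pow_add]
      · congr 2; ring
      · rw [← AlgEquiv.mul_apply, ← pow_add, add_comm, pow_add, AlgEquiv.mul_apply, hz]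
  refine ⟨(PadicInt.toZModPow n a).val * (PadicInt.toZModPow n b).val, ?_, ?_⟩
  · have := dvd_add ((dvd_val n a).mul_right b) ((dvd_val n b).mul_left ((PadicInt.toZModPow n a).val : ℤ_[ℓ]))
    convert this using 1
    push_cast; ring
  · rw [H' z n, h1]
    rw [h1, mul_comm, pow_mul]; exact pow_fix hz _
theorem IsPw.comm {x y z : Ω ≃ₐ[k] Ω} {c : ℤ_[ℓ]} (hp : PL ℓ x) (H : IsPw x c y) (h : x * z = z * x) : y * z = z * y := by
  ext w
  obtain ⟨n, hn⟩ := hp w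
  have hc : ∀ m, (x ^ m) (z w) = z ((x ^ m) w) := fun m => by
    rw [← AlgEquiv.mul_apply, ← AlgEquiv.mul_apply, ((show Commute x z from h).pow_left m).eq]
  rw [AlgEquiv.mul_apply, AlgEquiv.mul_apply, H w n hn, H (z w) n (by rw [hc, hn]), hc]
theorem IsPw.memT {O : ValuationSubring Ω} {x y : Ω ≃ₐ[k] Ω} {c : ℤ_[ℓ]} (hp : PL ℓ x) (H : IsPw x c y) (h : x ∈ inertiaSubgroup O) :
    y ∈ inertiaSubgroup O := by
  have : ∀ z, ∃ m, y z = (x ^ m) z := fun z => by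
    obtain ⟨n, hn⟩ := hp z
    exact ⟨_, H z n hn⟩
  constructor
  · intro z
    obtain ⟨m, hm⟩ := this z
    rw [hm]; exact (pow_mem h m).1 z
  · intro z
    obtain ⟨m, hm⟩ := this z
    rw [hm]; exact (pow_mem h m).2 z
variable (hc : Cx ℓ Ω ζ)
include hc
noncomputable def ract (O : ValuationSubring Ω) : letI := rAlg (hc.kmem O)
    decompSubgroup (F := k) O →* (IsLocalRing.ResidueField O ≃ₐ[k] IsLocalRing.ResidueField O) :=
  letI := rAlg (hc.kmem O)
  let f : decompSubgroup (F := k) O → (O ≃+* O) := fun g => (g : Ω ≃ₐ[k] Ω).toRingEquiv.restrict O O fun x => (g.2 x).symm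
  { toFun := fun g => AlgEquiv.ofRingEquiv (f := IsLocalRing.ResidueField.mapEquiv (f g)) fun c => by
      change IsLocalRing.residue O (f g ⟨algebraMap k Ω c, hc.kmem O c⟩) = IsLocalRing.residue O ⟨algebraMap k Ω c, hc.kmem O c⟩
      congr 1
      exact Subtype.ext ((g : Ω ≃ₐ[k] Ω).commutes c)
    map_one' := by
      ext x
      obtain ⟨x, rfl⟩ := IsLocalRing.residue_surjective x
      rfl
    map_mul' := fun g g' => by
      ext x
      obtain ⟨x, rfl⟩ := IsLocalRing.residue_surjective x
      rfl }
theorem ract_res (O : ValuationSubring Ω) (g : decompSubgroup (F := k) O) (x : O) :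
    ract hc O g (IsLocalRing.residue O x) = IsLocalRing.residue O ⟨(g : Ω ≃ₐ[k] Ω) x, (g.2 x).2 x.2⟩ := rfl
theorem ract_one {O : ValuationSubring Ω} {g : decompSubgroup (F := k) O} (h : ract hc O g = 1) : (g : Ω ≃ₐ[k] Ω) ∈ inertiaSubgroup O := by
  letI := rAlg (hc.kmem O)
  refine ⟨g.2, fun x hx => ?_⟩
  have h1 := ract_res hc O g ⟨x, hx⟩
  rw [h, AlgEquiv.one_apply, eq_comm, ← sub_eq_zero, ← map_sub, res_zero] at h1
  exact h1
theorem Cx.resCx (O : ValuationSubring Ω) : letI := rAlg (hc.kmem O)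
    Cx ℓ (IsLocalRing.ResidueField O) ζ := by
  letI := rAlg (hc.kmem O)
  refine ⟨hc.prim, hc.succ, fun x => ?_, hc.tors, hc.lne⟩
  obtain ⟨x, rfl⟩ := IsLocalRing.residue_surjective x
  obtain ⟨y, hy⟩ := hc.div (x : Ω)
  have hyO : y ∈ O := by
    rw [← ValuationSubring.valuation_le_one_iff]
    by_contra! h
    have h1 := (O.valuation_le_one_iff _).2 x.2
    rw [← hy, map_pow] at h1
    exact (one_lt_pow₀ h hℓ.out.ne_zero).not_ge h1
  exact ⟨IsLocalRing.residue O ⟨y, hyO⟩, by rw [← map_pow]; congr 1; exact Subtype.ext hy⟩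
theorem ract_pw {O : ValuationSubring Ω} {g h : decompSubgroup (F := k) O} {c : ℤ_[ℓ]} (hp : PL ℓ (g : Ω ≃ₐ[k] Ω))
    (H : IsPw (g : Ω ≃ₐ[k] Ω) c (h : Ω ≃ₐ[k] Ω)) : letI := rAlg (hc.kmem O)
    IsPw (ract hc O g) c (ract hc O h) := by
  letI := rAlg (hc.kmem O)
  refine .of fun z n hz => ?_
  obtain ⟨x, rfl⟩ := IsLocalRing.residue_surjective z
  obtain ⟨m, hm⟩ := hp (x : Ω)
  have h1 := H x _ (per_le hm (le_max_left m n))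
  refine ⟨_, (pow_dvd_pow _ (le_max_right m n)).trans (dvd_val (max m n) c), ?_⟩
  rw [← map_pow, ract_res, ract_res]
  congr 1
  exact Subtype.ext h1
theorem ract_PL {O : ValuationSubring Ω} {g : decompSubgroup (F := k) O} (hp : PL ℓ (g : Ω ≃ₐ[k] Ω)) : letI := rAlg (hc.kmem O)
    PL ℓ (ract hc O g) := by
  letI := rAlg (hc.kmem O)
  intro z
  obtain ⟨x, rfl⟩ := IsLocalRing.residue_surjective z
  obtain ⟨m, hm⟩ := hp (x : Ω)
  refine ⟨m, ?_⟩
  rw [← map_pow, ract_res]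
  congr 1
  exact Subtype.ext hm
end V
end S5
namespace S5
section V
variable {ℓ : ℕ} [hℓ : Fact ℓ.Prime] {k Ω : Type*} [Field k] [Field Ω] [Algebra k Ω] {ζ : ℕ → k}
variable {l Θ : Type*} [Field l] [Field Θ] [Algebra l Θ] {ξ : ℕ → l}
structure Px (hd : Cx ℓ Θ ξ) (Kb : IntermediateField k Ω) (Z : Subgroup (Ω ≃ₐ[k] Ω)) (Lb : IntermediateField l Θ) (O₁ : ValuationSubring Θ)
    (r : ℕ) {Z₁ : Subgroup (Θ ≃ₐ[l] Θ)} (φ : Z ≃* Z₁) : Prop where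
  G : Gx ℓ Kb
  hZ : ∀ g ∈ Z, ∀ y ∈ Kb, g y = y
  H : Wx hd Lb O₁ r
  hZ₁ : ∀ g, g ∈ Z₁ ↔ g ∈ decompSubgroup O₁ ∧ ∀ y ∈ Lb, g y = y
  pw : ∀ (g : Z) (c : ℤ_[ℓ]), ∃ h : Z, IsPw (g : Ω ≃ₐ[k] Ω) c h ∧ IsPw (φ g : Θ ≃ₐ[l] Θ) c (φ h)
variable (hc : Cx ℓ Ω ζ) {hd : Cx ℓ Θ ξ} {Kb : IntermediateField k Ω} {Z : Subgroup (Ω ≃ₐ[k] Ω)} {Lb : IntermediateField l Θ}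
  {O₁ : ValuationSubring Θ} {r : ℕ} {Z₁ : Subgroup (Θ ≃ₐ[l] Θ)} {φ : Z ≃* Z₁} (P : Px (ℓ := ℓ) hd Kb Z Lb O₁ r φ)
include P
theorem Px.pl (g : Z) : PL ℓ (g : Ω ≃ₐ[k] Ω) := P.G.pl _ (P.hZ g g.2)
theorem Px.pl₁ (g : Z₁) : PL ℓ (g : Θ ≃ₐ[l] Θ) := P.H.G.pl _ ((P.hZ₁ g).1 g.2).2
theorem Px.cent {t : Z} (ht : (φ t : Θ ≃ₐ[l] Θ) ∈ inertiaSubgroup O₁) (g : Z) : g * t = t * g := by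
  refine φ.injective ?_
  rw [map_mul, map_mul]
  exact Subtype.ext (hd.E ht ((P.hZ₁ _).1 (φ g).2).1 (P.pl₁ _) (P.pl₁ _) (P.pl₁ ((φ t)⁻¹ * (φ g * φ t * (φ g)⁻¹))))
theorem Px.one_pow {t u : Z} {b : ℤ_[ℓ]} (hb : IsUnit b) (h : IsPw (t : Ω ≃ₐ[k] Ω) b u) {O : ValuationSubring Ω} (hu : (u : Ω ≃ₐ[k] Ω) ∈ inertiaSubgroup O) :
    (t : Ω ≃ₐ[k] Ω) ∈ inertiaSubgroup O := by
  obtain ⟨b, rfl⟩ := hb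
  obtain ⟨m, hm, -⟩ := P.pw u ↑b⁻¹
  have h1 := h.comp hm
  rw [Units.mul_inv] at h1
  have h2 : (m : Ω ≃ₐ[k] Ω) = t := h1.uniq (P.pl t) (by simpa using IsPw.nat (t : Ω ≃ₐ[k] Ω) 1)
  rw [← h2]
  exact hm.memT (P.pl u) hu
theorem Px.npow {s u : Z} {a : ℤ_[ℓ]} (ha : a ≠ 0) (h : IsPw (s : Ω ≃ₐ[k] Ω) a u) {z : Ω ≃ₐ[k] Ω} (hz : (u : Ω ≃ₐ[k] Ω) * z = z * u) :
    (s : Ω ≃ₐ[k] Ω) ^ (ℓ ^ a.valuation) * z = z * (s : Ω ≃ₐ[k] Ω) ^ (ℓ ^ a.valuation) := by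
  obtain ⟨m, hm, -⟩ := P.pw u ↑(PadicInt.unitCoeff ha)⁻¹
  have h1 := h.comp hm
  have e : a * ↑(PadicInt.unitCoeff ha)⁻¹ = ((ℓ ^ a.valuation : ℕ) : ℤ_[ℓ]) := by
    rw [Units.mul_inv_eq_iff_eq_mul, mul_comm]; push_cast; exact PadicInt.unitCoeff_spec ha
  rw [e] at h1
  rw [← h1.uniq (P.pl s) (IsPw.nat _ _)]
  exact hm.comm (P.pl u) hz
include hc
theorem Px.rp (p : ℕ) [Fact p.Prime] [CharP k p] {t : Z} (ht : ∀ g : Z, g * t = t * g) (s : Z) :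
    ∃ O : ValuationSubring Ω, (t : Ω ≃ₐ[k] Ω) ∈ decompSubgroup O ∧ ((t : Ω ≃ₐ[k] Ω) ∈ inertiaSubgroup O ∨
      ∃ (a : ℤ_[ℓ]) (u v : Z), a ≠ 0 ∧ IsPw (s : Ω ≃ₐ[k] Ω) a u ∧ (∀ g : Z, v * g = g * v) ∧ ((u * v : Z) : Ω ≃ₐ[k] Ω) ∈ inertiaSubgroup O) := by
  obtain ⟨O, a, b, hab, -, h2, h3⟩ := hc.Rpair p (s := s) (t := t) (congrArg Subtype.val (ht s)) (fun z => by
    obtain ⟨n, hn⟩ := P.pl s z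
    obtain ⟨m, hm⟩ := P.pl t z
    exact ⟨max n m, per_le hn (le_max_left _ _), per_le hm (le_max_right _ _)⟩)
  refine ⟨O, h2, ?_⟩
  obtain ⟨u, hu, -⟩ := P.pw s a
  obtain ⟨v, hv, -⟩ := P.pw t b
  have h4 := h3 u v hu hv
  by_cases ha : a = 0
  · subst ha
    left
    have hu1 : (u : Ω ≃ₐ[k] Ω) = 1 := hu.uniq (P.pl s) (by simpa using IsPw.nat (s : Ω ≃ₐ[k] Ω) 0)
    rw [hu1, one_mul] at h4
    exact P.one_pow (hab.resolve_left (by simp)) hv h4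
  · refine .inr ⟨a, u, v, ha, hu, fun g => Subtype.ext (hv.comm (P.pl t) (congrArg Subtype.val (ht g).symm)), h4⟩
variable [IsAlgClosed l]
theorem Px.B2 (p : ℕ) [Fact p.Prime] [CharP k p] {t : Z} (ht : (φ t : Θ ≃ₐ[l] Θ) ∈ inertiaSubgroup O₁) :
    ∃ O : ValuationSubring Ω, (t : Ω ≃ₐ[k] Ω) ∈ inertiaSubgroup O := by
  have hct := P.cent ht
  obtain ⟨s, hs1, hs2, hs3, hs4⟩ := P.H.A2
  let i0 : Fin r := ⟨0, P.H.r1⟩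
  set σ : Z := φ.symm ⟨s i0, (P.hZ₁ _).2 ⟨hs1 i0, hs2 i0⟩⟩ with hσ
  have hφσ : (φ σ : Θ ≃ₐ[l] Θ) = s i0 := by rw [hσ, φ.apply_symm_apply]
  obtain ⟨O1, h1, h1' | ⟨a, u, v, ha, hu, hv, huv⟩⟩ := P.rp hc p hct σ
  · exact ⟨O1, h1'⟩
  have hnT : ((φ σ : Θ ≃ₐ[l] Θ) ^ (ℓ ^ a.valuation)) ∉ inertiaSubgroup O₁ := by
    intro hin
    refine hs4 (Pi.single i0 ((ℓ ^ a.valuation : ℕ) : ℤ_[ℓ])) ?_ (Pi.mulSingle i0 ((φ σ : Θ ≃ₐ[l] Θ) ^ (ℓ ^ a.valuation))) ?_ ?_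
    · intro h
      have := congrFun h i0
      rw [Pi.single_eq_same] at this
      exact (Nat.cast_ne_zero.2 (pow_pos hℓ.out.pos _).ne') this
    · intro i
      by_cases hi : i = i0
      · subst hi
        rw [Pi.single_eq_same, Pi.mulSingle_eq_same, hφσ]; exact IsPw.nat _ _
      · rw [Pi.single_eq_of_ne hi, Pi.mulSingle_eq_of_ne hi]; simpa using IsPw.nat (s i) 0
    · refine Subgroup.list_prod_mem _ fun x hx => ?_
      rw [List.mem_ofFn] at hx
      obtain ⟨i, rfl⟩ := hx
      by_cases hi : i = i0
      · subst hi; rw [Pi.mulSingle_eq_same]; exact hin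
      · rw [Pi.mulSingle_eq_of_ne hi]; exact one_mem _
  obtain ⟨g, hg1, hg2, hg3⟩ := P.H.NC hd (pow_mem ((P.hZ₁ _).1 (φ σ).2).1 _) (P.pl₁ (φ σ ^ (ℓ ^ a.valuation))) hnT
  set τ : Z := φ.symm ⟨g, (P.hZ₁ _).2 ⟨hg1, hg2⟩⟩ with hτ
  have hφτ : (φ τ : Θ ≃ₐ[l] Θ) = g := by rw [hτ, φ.apply_symm_apply]
  obtain ⟨O2, h2, h2' | ⟨a', u', v', ha', hu', hv', huv'⟩⟩ := P.rp hc p hct τ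
  · exact ⟨O2, h2'⟩
  have key : ¬ ((u * v) * (u' * v') = (u' * v') * (u * v)) := by
    intro hcom
    have e : u * u' = u' * u := by
      have c1 : Commute v u' := hv u'
      have c2 : Commute v' u := hv' u
      have c3 : Commute v v' := hv v'
      have e1 : u * v * (u' * v') = (u * u') * (v * v') := by
        rw [mul_assoc, ← mul_assoc v, c1.eq, mul_assoc u', mul_assoc u]
      have e2 : u' * v' * (u * v) = (u' * u) * (v * v') := by
        rw [mul_assoc, ← mul_assoc v', c2.eq, mul_assoc u, ← c3.eq, mul_assoc u']
      rw [e1, e2] at hcom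
      exact mul_right_cancel hcom
    have e1 := P.npow ha hu (congrArg Subtype.val e)
    have e2 := P.npow ha' hu' e1.symm
    have e3 : τ ^ (ℓ ^ a'.valuation) * σ ^ (ℓ ^ a.valuation) = σ ^ (ℓ ^ a.valuation) * τ ^ (ℓ ^ a'.valuation) := Subtype.ext e2
    have e4 := congrArg (fun x => (φ x : Θ ≃ₐ[l] Θ)) e3
    simp only [map_mul, map_pow, Subgroup.coe_mul, Subgroup.coe_pow, hφτ] at e4
    exact hg3 _ (pow_pos hℓ.out.pos _).ne' e4
  have key2 : ∀ O : ValuationSubring Ω, ((u * v : Z) : Ω ≃ₐ[k] Ω) ∈ inertiaSubgroup O → ((u' * v' : Z) : Ω ≃ₐ[k] Ω) ∈ inertiaSubgroup O → False :=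
    fun O ha hb => key (Subtype.ext (hc.E hb (T_le_Z ha) (P.pl _) (P.pl _) (P.pl ((u' * v')⁻¹ * ((u * v) * (u' * v') * (u * v)⁻¹)))))
  by_cases h12 : O1 ≤ O2
  · exact (key2 O1 huv (coarseT h12 huv')).elim
  by_cases h21 : O2 ≤ O1
  · exact (key2 O2 (coarseT h21 huv) huv').elim
  exact ⟨_, hc.Dep h12 h21 (P.pl t) h1 h2⟩
theorem Px.B3 [IsAlgClosed k] (p : ℕ) [Fact p.Prime] [CharP k p] (F : Fx Kb (r + 1)) {t : Z} (ht : (φ t : Θ ≃ₐ[l] Θ) ∈ inertiaSubgroup O₁) (ht1 : t ≠ 1) :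
    ∃ U : ValuationSubring Ω, (t : Ω ≃ₐ[k] Ω) ∈ inertiaSubgroup U ∧ Z ≤ decompSubgroup U ∧ Wx hc Kb U r := by
  obtain ⟨O, hO⟩ := P.B2 hc p ht
  obtain ⟨U, hU, hU'⟩ := hc.Ostar (P.pl t) hO
  have hZU : Z ≤ decompSubgroup U := fun g hg => hU' g (congrArg Subtype.val (P.cent ht ⟨g, hg⟩))
  refine ⟨U, hU, hZU, P.G, F, ?_, ?_, P.H.r1⟩
  · by_contra! hcon
    refine ht1 (Subtype.ext (inertia_top ?_))
    rwa [show (⊤ : ValuationSubring Ω) = U from le_antisymm (fun x _ => ?_) le_top]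
    by_cases hx : x = 0
    · subst hx; exact zero_mem _
    have := hcon x⁻¹ (inv_ne_zero hx)
    rw [map_inv₀, one_le_inv₀ (zero_lt_iff.2 (by simpa using hx))] at this
    exact (U.valuation_le_one_iff _).1 this
  letI := rAlg (hc.kmem U)
  obtain ⟨s, hs1, hs2, hs3, hs4⟩ := P.H.A2
  let s' : Fin r → Z := fun i => φ.symm ⟨s i, (P.hZ₁ _).2 ⟨hs1 i, hs2 i⟩⟩
  have hφs : ∀ i, (φ (s' i) : Θ ≃ₐ[l] Θ) = s i := fun i => by simp only [s', φ.apply_symm_apply]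
  let j : Z → decompSubgroup (F := k) U := fun g => ⟨g, hZU g.2⟩
  rcases (hc.resCx U).indep_or' p (s := fun i => ract hc U (j (s' i))) (fun a b => by
      have h : s' a * s' b = s' b * s' a := by
        simp only [s']; rw [← map_mul, ← map_mul]; congr 1; exact Subtype.ext (hs3 a b)
      rw [← map_mul, ← map_mul]
      exact congrArg (ract hc U) (Subtype.ext (congrArg (fun x : Z => (x : Ω ≃ₐ[k] Ω)) h))) (fun i => ract_PL hc (P.pl (s' i))) with h | ⟨α, hα, h⟩
  · exact h
  exfalso
  choose u hu hu' using fun i => P.pw (s' i) (α i)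
  have h1 := h (fun i => ract hc U (j (u i))) fun i => ract_pw hc (P.pl (s' i)) (hu i)
  have h2 : (List.ofFn u).prod.1 ∈ inertiaSubgroup U := by
    have e : List.ofFn (fun i => ract hc U (j (u i))) = (List.ofFn u).map ((ract hc U).comp (Subgroup.inclusion hZU)) := by
      rw [List.map_ofFn]; rfl
    rw [e, ← map_list_prod] at h1
    exact ract_one hc h1
  set m := (List.ofFn u).prod with hm
  have h3 : (φ m : Θ ≃ₐ[l] Θ) ∈ inertiaSubgroup O₁ := by
    by_contra hcon
    obtain ⟨g, hg1, hg2, hg3⟩ := P.H.NC hd ((P.hZ₁ _).1 (φ m).2).1 (P.pl₁ _) hcon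
    refine hg3 1 one_ne_zero ?_
    set τ : Z := φ.symm ⟨g, (P.hZ₁ _).2 ⟨hg1, hg2⟩⟩ with hτ
    have hφτ : (φ τ : Θ ≃ₐ[l] Θ) = g := by rw [hτ, φ.apply_symm_apply]
    have e : τ * m = m * τ := Subtype.ext (hc.E h2 (hZU τ.2) (P.pl _) (P.pl _) (P.pl (m⁻¹ * (τ * m * τ⁻¹))))
    have e4 := congrArg (fun x => (φ x : Θ ≃ₐ[l] Θ)) e
    simpa only [map_mul, Subgroup.coe_mul, hφτ, pow_one] using e4
  refine hs4 α hα (fun i => φ (u i)) (fun i => by rw [← hφs]; exact hu' i) ?_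
  have e : List.ofFn (fun i => (φ (u i) : Θ ≃ₐ[l] Θ)) = (List.ofFn u).map (Z₁.subtype.comp φ.toMonoidHom) := by
    rw [List.map_ofFn]; rfl
  rw [e, ← map_list_prod]
  exact h3
end V
end S5
namespace S5
section V
variable {ℓ : ℕ} [hℓ : Fact ℓ.Prime] {k Ω : Type*} [Field k] [Field Ω] [Algebra k Ω] {ζ : ℕ → k}
variable (hc : Cx ℓ Ω ζ)
include hc
variable {Kb : IntermediateField k Ω} {O : ValuationSubring Ω} {r : ℕ}
theorem Wx.rat (H : Wx hc Kb O r) {π : Ω} (hπ0 : π ≠ 0) (hπ : O.valuation π < 1) :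
    (∀ z, z ≠ 0 → ∃ i : ℕ, 0 < i ∧ ∃ e : ℤ, O.valuation (z ^ i) = O.valuation (π ^ e)) ∧
    ∃ n : ℕ, ∀ z ∈ Kb, z ≠ 0 → ∃ i : ℕ, 0 < i ∧ i ≤ n ∧ ∃ e : ℤ, O.valuation (z ^ i) = O.valuation (π ^ e) := by
  letI := rAlg (hc.kmem O)
  obtain ⟨t, ht⟩ := H.t
  choose T hT using fun i => IsLocalRing.residue_surjective (R := O) (t i)
  have hab := abh (hc.kmem O) (u := fun i => (T i : Ω)) (fun i => (T i).2)
    (by convert ht using 2 with i; exact hT i) (hc.vpi hπ0 hπ)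
  set b := Sum.elim (fun _ : Unit => π) (fun i => (T i : Ω))
  have key : ∀ z, z ≠ 0 → ∀ P : Polynomial (IntermediateField.adjoin k (Set.range b)), P ≠ 0 → Polynomial.aeval z P = 0 →
      ∃ i : ℕ, 0 < i ∧ i ≤ P.natDegree ∧ ∃ e : ℤ, O.valuation (z ^ i) = O.valuation (π ^ e) := fun z hz P hP hz' => by
    obtain ⟨i, hi, hi', c, hc0, h⟩ := vtors O.valuation hz P hP hz'
    obtain ⟨e, he⟩ := hab.2 c c.2 (by simpa using hc0)
    exact ⟨i, hi, hi', e (), by rw [h]; exact he.trans (by simp [mon])⟩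
  refine ⟨fun z hz => ?_, ?_⟩
  · obtain ⟨P, hP, hz'⟩ := (H.F.basis hab.1 (by simp [add_comm])).isAlgebraic_field.isAlgebraic z
    obtain ⟨i, hi, -, h⟩ := key z hz P hP hz'
    exact ⟨i, hi, h⟩
  · obtain ⟨n, hn⟩ := H.F.deg hab.1 (by simp [add_comm]) Set.finite_empty
    refine ⟨n, fun z hz hz0 => ?_⟩
    obtain ⟨P, hP, hPn, hz'⟩ := hn z ((le_sup_left : Kb ≤ Kb ⊔ _) hz)
    obtain ⟨i, hi, h', h⟩ := key z hz0 P hP hz'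
    exact ⟨i, hi, h'.trans hPn, h⟩
theorem Wx.max (H : Wx hc Kb O r) {J : ValuationSubring Ω} (hJ : O ≤ J) (hJ1 : J ≠ ⊤) : J = O := by
  refine le_antisymm (fun z hz => ?_) hJ
  by_contra hzO
  obtain ⟨x, hx⟩ : ∃ x, x ∉ J := by by_contra! h; exact hJ1 (le_antisymm le_top fun x _ => h x)
  have hx0 : x ≠ 0 := by rintro rfl; exact hx (zero_mem _)
  have hπ : J.valuation x⁻¹ < 1 := vlt.2 (.inr (by rwa [inv_inv]))
  have hz0 : z ≠ 0 := by rintro rfl; exact hzO (zero_mem _)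
  have hzJ : J.valuation z = 1 := by
    refine le_antisymm ((J.valuation_le_one_iff _).2 hz) (not_lt.1 fun h => hzO ?_)
    rw [← O.valuation_le_one_iff]; exact (vlt_mono hJ h).le
  obtain ⟨i, hi, e, he⟩ := (H.rat hc (inv_ne_zero hx0) (vlt_mono hJ hπ)).1 z hz0
  have hpe : (x⁻¹) ^ e ≠ 0 := zpow_ne_zero _ (inv_ne_zero hx0)
  have h1 : O.valuation (z ^ i * ((x⁻¹) ^ e)⁻¹) = 1 := by
    rw [map_mul, he, ← map_mul, mul_inv_cancel₀ hpe, map_one]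
  have h2 := vmono hJ h1
  rw [map_mul, map_pow, hzJ, one_pow, one_mul, map_inv₀, inv_eq_one, map_zpow₀] at h2
  have he0 : e = 0 := by
    have := (hc.vpi (inv_ne_zero hx0) hπ).2 (fun _ => e) (by simpa [mon] using h2)
    exact congrFun this ()
  rw [he0, zpow_zero, map_one, map_pow] at he
  exact hzO ((O.valuation_le_one_iff _).1 ((pow_eq_one_iff.1 he).resolve_right hi.ne').le)
theorem Wx.ne_top (H : Wx hc Kb O r) : O ≠ ⊤ := by
  rintro rfl
  obtain ⟨π, h0, h⟩ := H.pi
  rcases vlt.1 h with h | h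
  exacts [h0 h, h trivial]
theorem Wx.uniq {O' : ValuationSubring Ω} (H : Wx hc Kb O r) (H' : Wx hc Kb O' r) {t : Ω ≃ₐ[k] Ω} (h : t ∈ decompSubgroup O)
    (h' : t ∈ decompSubgroup O') (ht : ∀ y ∈ Kb, t y = y) (h1 : t ≠ 1) : O = O' := by
  by_cases h12 : O ≤ O'
  · exact (H.max hc h12 (H'.ne_top hc)).symm
  by_cases h21 : O' ≤ O
  · exact H'.max hc h21 (H.ne_top hc)
  have hj : jn O O' ≠ ⊤ := fun hj => h1 (inertia_top (hj ▸ hc.Dep h12 h21 (H.G.pl _ ht) h h'))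
  exact (H.max hc (jn_left _ _) hj).symm.trans (H'.max hc (jn_right _ _) hj)
end V
end S5
namespace S5
universe v u
section R
variable {k : Type v} {K Ω : Type u} [Field k] [Field K] [Field Ω] [Algebra k K] [Algebra K Ω] [Algebra k Ω] [IsScalarTower k K Ω]
def cm (K : Type u) [Field K] [Algebra K Ω] (O : ValuationSubring Ω) : O.comap (algebraMap K Ω) →+* O :=
  ((algebraMap K Ω).comp (O.comap (algebraMap K Ω)).subtype).codRestrict O.toSubring fun x => x.2
instance cm_loc (O : ValuationSubring Ω) : IsLocalHom (cm K O) := ⟨fun a ha => by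
  by_contra h
  have h1 : IsLocalRing.residue (O.comap (algebraMap K Ω)) a = 0 := by
    rw [IsLocalRing.residue_eq_zero_iff]; exact h
  have h2 : (O.comap (algebraMap K Ω)).valuation (a : K) < 1 := (res_zero _).1 h1
  rcases vlt.1 h2 with h3 | h3
  · have : a = 0 := Subtype.ext h3
    rw [this, map_zero] at ha; exact not_isUnit_zero ha
  · refine h3 ?_
    obtain ⟨b, hb⟩ := ha.exists_right_inv
    have : algebraMap K Ω a * (b : Ω) = 1 := congrArg Subtype.val hb
    change algebraMap K Ω _ ∈ O
    rw [map_inv₀, ← eq_inv_of_mul_eq_one_right this]; exact b.2⟩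
theorem vcm {O : ValuationSubring Ω} {x : K} :
    (O.comap (algebraMap K Ω)).valuation x < 1 ↔ O.valuation (algebraMap K Ω x) < 1 := by
  rw [vlt, vlt, ← map_inv₀, map_eq_zero]; rfl
theorem vcm1 {O : ValuationSubring Ω} {x : K} :
    (O.comap (algebraMap K Ω)).valuation x = 1 ↔ O.valuation (algebraMap K Ω x) = 1 := by
  have h : (O.comap (algebraMap K Ω)).valuation x ≤ 1 ↔ O.valuation (algebraMap K Ω x) ≤ 1 := by
    rw [ValuationSubring.valuation_le_one_iff, ValuationSubring.valuation_le_one_iff]; rfl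
  rw [le_antisymm_iff, le_antisymm_iff, h, ← not_lt (b := (1 : (O.comap (algebraMap K Ω)).ValueGroup)), ← not_lt (b := (1 : O.ValueGroup)), vcm]
noncomputable def rj (O : ValuationSubring Ω) (h : ∀ c : k, algebraMap k K c ∈ O.comap (algebraMap K Ω)) (h' : ∀ c : k, algebraMap k Ω c ∈ O) :
    letI := (resMap (O.comap (algebraMap K Ω)) h).toAlgebra
    letI := rAlg h'
    IsLocalRing.ResidueField (O.comap (algebraMap K Ω)) →ₐ[k] IsLocalRing.ResidueField O :=
  letI := (resMap (O.comap (algebraMap K Ω)) h).toAlgebra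
  letI := rAlg h'
  { IsLocalRing.ResidueField.map (cm K O) with
    commutes' := fun c => by
      change IsLocalRing.residue O (cm K O ⟨algebraMap k K c, h c⟩) = IsLocalRing.residue O ⟨algebraMap k Ω c, h' c⟩
      congr 1
      exact Subtype.ext (IsScalarTower.algebraMap_apply k K Ω c).symm }
theorem rj_alg [Algebra.IsAlgebraic K Ω] (O : ValuationSubring Ω) :
    letI := (IsLocalRing.ResidueField.map (cm K O)).toAlgebra
    Algebra.IsAlgebraic (IsLocalRing.ResidueField (O.comap (algebraMap K Ω))) (IsLocalRing.ResidueField O) := by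
  letI := (IsLocalRing.ResidueField.map (cm K O)).toAlgebra
  refine ⟨fun y => ?_⟩
  obtain ⟨x, rfl⟩ := IsLocalRing.residue_surjective y
  obtain ⟨P, hP, hx⟩ := Algebra.IsAlgebraic.isAlgebraic (R := K) (x : Ω)
  let R := O.comap (algebraMap K Ω)
  obtain ⟨j, hj, hmax⟩ := P.support.exists_max_image (fun i => R.valuation (P.coeff i)) (Polynomial.support_nonempty.2 hP)
  have hj0 : P.coeff j ≠ 0 := Polynomial.mem_support_iff.1 hj
  have hm : ∀ i, P.coeff i / P.coeff j ∈ R := fun i => by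
    rw [← ValuationSubring.valuation_le_one_iff, map_div₀]
    refine div_le_one_of_le₀ ?_ zero_le'
    by_cases hi : i ∈ P.support
    · exact hmax i hi
    · rw [Polynomial.notMem_support_iff.1 hi, map_zero]; exact zero_le'
  refine ⟨∑ i ∈ P.support, Polynomial.C (IsLocalRing.residue R ⟨_, hm i⟩) * Polynomial.X ^ i, fun h => ?_, ?_⟩
  · have := congrArg (fun Q => Polynomial.coeff Q j) h
    simp only [Polynomial.finset_sum_coeff, Polynomial.coeff_C_mul_X_pow, Finset.sum_ite_eq, if_pos hj, Polynomial.coeff_zero] at this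
    rw [show (⟨_, hm j⟩ : R) = 1 from Subtype.ext (div_self hj0), map_one] at this
    exact one_ne_zero this
  · have e : ∑ i ∈ P.support, cm K O ⟨_, hm i⟩ * x ^ i = 0 := by
      refine Subtype.ext ?_
      push_cast
      have h1 : ∀ i, ((cm K O ⟨_, hm i⟩ : O) : Ω) = algebraMap K Ω (P.coeff i) / algebraMap K Ω (P.coeff j) := fun i =>
        map_div₀ (algebraMap K Ω) _ _
      simp only [h1, div_mul_eq_mul_div]
      rw [← Finset.sum_div, div_eq_zero_iff]; left
      rw [Polynomial.aeval_eq_sum_range] at hx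
      rw [← hx]
      simp only [Algebra.smul_def]
      refine Finset.sum_subset (fun i hi => Finset.mem_range_succ_iff.2 (Polynomial.le_natDegree_of_mem_supp i hi)) fun i _ hi => ?_
      rw [Polynomial.notMem_support_iff.1 hi]; simp
    have := congrArg (IsLocalRing.residue O) e
    rw [map_sum, map_zero] at this
    rw [map_sum, ← this]
    refine Finset.sum_congr rfl fun i _ => ?_
    rw [map_mul, Polynomial.aeval_C, map_pow, Polynomial.aeval_X, map_mul, map_pow]
    rfl
theorem rj_td [Algebra.IsAlgebraic K Ω] (O : ValuationSubring Ω) (h : ∀ c : k, algebraMap k K c ∈ O.comap (algebraMap K Ω)) (h' : ∀ c : k, algebraMap k Ω c ∈ O) :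
    (letI := (resMap (O.comap (algebraMap K Ω)) h).toAlgebra
    Algebra.trdeg k (IsLocalRing.ResidueField (O.comap (algebraMap K Ω)))) =
    letI := rAlg h'
    Algebra.trdeg k (IsLocalRing.ResidueField O) := by
  letI i1 := (resMap (O.comap (algebraMap K Ω)) h).toAlgebra
  letI i2 := rAlg h'
  letI i3 := (IsLocalRing.ResidueField.map (cm K O)).toAlgebra
  haveI := rj_alg (K := K) O
  haveI : IsScalarTower k (IsLocalRing.ResidueField (O.comap (algebraMap K Ω))) (IsLocalRing.ResidueField O) :=
    IsScalarTower.of_algebraMap_eq fun c => ((rj O h h').commutes c).symm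
  have := trdeg_add_eq k (IsLocalRing.ResidueField (O.comap (algebraMap K Ω))) (A := IsLocalRing.ResidueField O)
  rwa [trdeg_eq_zero (A := IsLocalRing.ResidueField O), add_zero] at this
end R
end S5
namespace S5
section D
theorem disc {K : Type*} [Field K] {R : ValuationSubring K} {x : K} (hx0 : x ≠ 0) (hx : R.valuation x < 1) {n : ℕ}
    (h : ∀ z : K, z ≠ 0 → ∃ i : ℕ, 0 < i ∧ i ≤ n ∧ ∃ e : ℤ, R.valuation (z ^ i) = R.valuation (x ^ e)) :
    Nonempty ((R.ValueGroup)ˣ ≃* Multiplicative ℤ) := by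
  have hv0 : R.valuation x ≠ 0 := by simpa using hx0
  let g : (R.ValueGroup)ˣ := Units.mk0 _ hv0
  have hg : g ≠ 1 := fun h => hx.ne (congrArg Units.val h)
  haveI : Nontrivial (R.ValueGroup)ˣ := ⟨g, 1, hg⟩
  have hm : ∀ γ : (R.ValueGroup)ˣ, γ ^ n.factorial ∈ Subgroup.zpowers g := fun γ => by
    obtain ⟨z, hz⟩ := R.valuation_surjective γ
    have hz0 : z ≠ 0 := by rintro rfl; exact γ.ne_zero (by simpa using hz.symm)
    obtain ⟨i, hi, hin, e, he⟩ := h z hz0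
    obtain ⟨m, hm⟩ := Nat.dvd_factorial hi hin
    have : γ ^ i = g ^ e := by
      refine Units.ext ?_
      push_cast
      rw [← hz, ← map_pow, he, map_zpow₀]; rfl
    rw [hm, pow_mul, this]
    exact pow_mem (zpow_mem (Subgroup.mem_zpowers g) e) m
  have : IsCyclic (R.ValueGroup)ˣ := isCyclic_of_injective ((powMonoidHom n.factorial : (R.ValueGroup)ˣ →* _).codRestrict (Subgroup.zpowers g) hm)
    fun a b hab => pow_left_injective n.factorial_ne_zero (congrArg Subtype.val hab)
  obtain ⟨e⟩ := LinearOrderedCommGroup.isCyclic_iff_nonempty_equiv_int.1 this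
  exact ⟨e.toMulEquiv⟩
end D
section W
variable {ℓ : ℕ} [hℓ : Fact ℓ.Prime] {k K : Type*} [Field k] [Field K] [Algebra k K] {ζ : ℕ → k}
theorem td_nat (h : (⊤ : IntermediateField k K).FG) : ∃ n : ℕ, Algebra.trdeg k K = n := by
  haveI := IntermediateField.fg_top_iff.1 h
  obtain ⟨n, hn⟩ := Cardinal.lt_aleph0.1 (trdeg_lt_aleph0 k K)
  exact ⟨n, hn⟩
theorem proL_td : Algebra.trdeg k (proL ℓ K) = Algebra.trdeg k K := by
  have := trdeg_add_eq k K (A := proL ℓ K)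
  rw [← this, trdeg_eq_zero (R := K), add_zero]
theorem proL_fx {d : ℕ} (h : (⊤ : IntermediateField k K).FG) (hd : Algebra.trdeg k K = d) : Fx (Kb ℓ k K) d := by
  refine ⟨?_, proL_td.trans hd⟩
  obtain ⟨S, hS⟩ := h
  refine ⟨algebraMap K (proL ℓ K) '' S, S.finite_toSet.image _, ?_⟩
  have := IntermediateField.adjoin_map k (S : Set K) (IsScalarTower.toAlgHom k K (proL ℓ K))
  rw [hS] at this
  refine Eq.trans ?_ this
  ext x
  rw [mem_Kb, IntermediateField.mem_map]; simp
variable (hc : Cx ℓ (proL ℓ K) ζ) {O : ValuationSubring (proL ℓ K)} {r : ℕ}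
theorem Wx.of_zpd (h : (⊤ : IntermediateField k K).FG) (hd : Algebra.trdeg k K = (r + 1 : ℕ)) (hr : 1 ≤ r)
    (H : IsZPD k (O.comap (algebraMap K (proL ℓ K)))) : Wx hc (Kb ℓ k K) O r := by
  refine ⟨proL_gx hc, proL_fx h hd, ?_, ?_, hr⟩
  · obtain ⟨x, hx⟩ : ∃ x, x ∉ O.comap (algebraMap K (proL ℓ K)) := by
      by_contra! h; exact H.nontrivial (le_antisymm le_top fun x _ => h x)
    refine ⟨(algebraMap K (proL ℓ K) x)⁻¹, inv_ne_zero fun h => hx ?_, vlt.2 (.inr (by rwa [inv_inv]))⟩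
    change algebraMap K (proL ℓ K) x ∈ O
    rw [h]; exact zero_mem _
  · letI := rAlg (hc.kmem O)
    have h1 := (congrArg (· + 1) (rj_td O H.trivialBase (hc.kmem O))).symm.trans (H.residue_td.trans hd)
    push_cast at h1
    have h2 := Cardinal.add_one_inj.1 h1
    obtain ⟨B, hB⟩ := exists_isTranscendenceBasis k (IsLocalRing.ResidueField O)
    rw [← hB.cardinalMk_eq_trdeg] at h2
    obtain ⟨e⟩ : Nonempty (B ≃ Fin r) := by
      rw [← Cardinal.lift_mk_eq']; simpa using h2
    exact ⟨_, hB.1.comp _ e.symm.injective⟩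
theorem Wx.zpd (hd : Algebra.trdeg k K = (r + 1 : ℕ))
    (H : Wx hc (Kb ℓ k K) O r) : IsZPD k (O.comap (algebraMap K (proL ℓ K))) := by
  have h0 : ∀ c : k, algebraMap k K c ∈ O.comap (algebraMap K (proL ℓ K)) := fun c => by
    change algebraMap K (proL ℓ K) (algebraMap k K c) ∈ O
    rw [← IsScalarTower.algebraMap_apply]; exact hc.kmem O c
  obtain ⟨x, hx0, hx⟩ : ∃ x : K, x ≠ 0 ∧ O.valuation (algebraMap K (proL ℓ K) x) < 1 := by
    obtain ⟨π, hπ0, hπ⟩ := H.pi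
    obtain ⟨P, hP, hz'⟩ := Algebra.IsAlgebraic.isAlgebraic (R := K) π
    obtain ⟨i, hi, hi', c, hc0, h⟩ := vtors O.valuation hπ0 P hP hz'
    exact ⟨c, hc0, by rw [← h, map_pow]; exact pow_lt_one₀ zero_le' hπ hi.ne'⟩
  have hx0' : algebraMap K (proL ℓ K) x ≠ 0 := by simpa using hx0
  refine ⟨h0, fun h => ?_, ?_, ?_⟩
  · rcases vlt.1 (vcm.2 hx) with h1 | h1
    · exact hx0 h1
    · exact h1 (h ▸ trivial)
  · obtain ⟨n, hn⟩ := (H.rat hc hx0' hx).2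
    refine disc hx0 (vcm.2 hx) (n := n) fun z hz => ?_
    obtain ⟨i, hi, hin, e, he⟩ := hn (algebraMap K (proL ℓ K) z) (mem_Kb.2 ⟨z, rfl⟩) (by simpa using hz)
    refine ⟨i, hi, hin, e, ?_⟩
    have h1 : O.valuation (algebraMap K (proL ℓ K) (z ^ i * (x ^ e)⁻¹)) = 1 := by
      rw [map_mul, map_mul, map_pow, he, map_inv₀, map_zpow₀ (algebraMap K _), ← map_mul, mul_inv_cancel₀ (zpow_ne_zero _ hx0'), map_one]
    have h2 := vcm1.2 h1
    rwa [map_mul, map_inv₀, mul_inv_eq_one₀ ((Valuation.ne_zero_iff _).2 (zpow_ne_zero e hx0))] at h2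
  · refine (congrArg (· + 1) ((rj_td O h0 (hc.kmem O)).trans (H.td hc))).trans ?_
    change _ = Algebra.trdeg k K
    rw [hd]; push_cast; rfl
end W
end S5
open Filter Topology
namespace S5
section T
variable {ℓ : ℕ} [hℓ : Fact ℓ.Prime] {K : Type*} [Field K]
theorem ev_nhds {E F : Type*} [Field E] [Field F] [Algebra F E] [Algebra.IsAlgebraic F E] (h : E ≃ₐ[F] E) (z : E) :
    ∀ᶠ σ in 𝓝 h, σ z = h z := by
  have h1 := stabilizer_isOpen_of_isIntegral (K := F) z
  have h2 : IsOpen ((fun σ : E ≃ₐ[F] E => h⁻¹ * σ) ⁻¹' (MulAction.stabilizer (E ≃ₐ[F] E) z : Set _)) :=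
    h1.preimage (continuous_const_mul _)
  filter_upwards [h2.mem_nhds (by simp [one_mem])] with σ hσ
  have : h⁻¹ (σ z) = z := hσ
  exact (h.apply_symm_apply (σ z)).symm.trans (congrArg h this)
variable {Z : Subgroup (GalL ℓ K)}
theorem lim_pw {g h : Z} {c : ℤ_[ℓ]} (H : Tendsto (fun m => g ^ c.appr m) atTop (𝓝 h)) (z : proL ℓ K) (n : ℕ) :
    ∃ e : ℕ, (ℓ : ℤ_[ℓ]) ^ n ∣ c - e ∧ (h : GalL ℓ K) z = ((g : GalL ℓ K) ^ e) z := by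
  have h1 : Tendsto (fun m => ((g ^ c.appr m : Z) : GalL ℓ K)) atTop (𝓝 (h : GalL ℓ K)) :=
    (continuous_subtype_val.tendsto h).comp H
  obtain ⟨m, hm, hn⟩ := ((h1.eventually (ev_nhds _ z)).and (eventually_ge_atTop n)).exists
  exact ⟨c.appr m, (pow_dvd_pow _ hn).trans (Ideal.mem_span_singleton.1 (PadicInt.appr_spec m c)), hm.symm⟩
theorem ex_lim (hZ : IsClosed (Z : Set (GalL ℓ K))) (g : Z) (c : ℤ_[ℓ]) : ∃ h : Z, Tendsto (fun m => g ^ c.appr m) atTop (𝓝 h) := by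
  haveI := proL_norm (ℓ := ℓ) K
  haveI : CompactSpace Z := isCompact_iff_compactSpace.1 hZ.isCompact
  have key : ∀ z : proL ℓ K, ∃ w, ∀ h : Z, MapClusterPt h atTop (fun m => g ^ c.appr m) → (h : GalL ℓ K) z = w := fun z => by
    obtain ⟨n, hn⟩ := proL_PL K (g : GalL ℓ K) z
    refine ⟨((g : GalL ℓ K) ^ c.appr n) z, fun h hh => ?_⟩
    have h1 : ∀ᶠ σ : Z in 𝓝 h, (σ : GalL ℓ K) z = (h : GalL ℓ K) z := (continuous_subtype_val.tendsto h).eventually (ev_nhds _ z)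
    obtain ⟨m, hm, hmn⟩ := ((hh.frequently h1).and_eventually (eventually_ge_atTop n)).exists
    rw [← hm]
    refine pow_cong hn ?_
    have a1 := (pow_dvd_pow (ℓ : ℤ_[ℓ]) hmn).trans (Ideal.mem_span_singleton.1 (PadicInt.appr_spec m c))
    have a2 := (Ideal.mem_span_singleton.1 (PadicInt.appr_spec n c))
    have := dvd_sub a2 a1
    rwa [sub_sub_sub_cancel_left] at this
  obtain ⟨h, hh⟩ := exists_clusterPt_of_compactSpace (map (fun m => g ^ c.appr m) atTop)
  refine ⟨h, tendsto_nhds_of_unique_mapClusterPt fun h' hh' => Subtype.ext (AlgEquiv.ext fun z => ?_)⟩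
  obtain ⟨w, hw⟩ := key z
  rw [hw h hh, hw h' hh']
end T
section Q
variable {ℓ : ℕ} [hℓ : Fact ℓ.Prime] {k K : Type*} [Field k] [Field K] [Algebra k K] {ζ : ℕ → k}
  {l L : Type*} [Field l] [Field L] [Algebra l L] {ξ : ℕ → l}
noncomputable abbrev rs (ℓ : ℕ) (k K : Type*) [Field k] [Field K] [Algebra k K] : GalL ℓ K →* (proL ℓ K ≃ₐ[k] proL ℓ K) :=
  AlgEquiv.restrictScalarsHom k
theorem rs_inj : Function.Injective (rs ℓ k K) := AlgEquiv.restrictScalarsHom_injective k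
theorem rs_fix (g : GalL ℓ K) : ∀ y ∈ Kb ℓ k K, rs ℓ k K g y = y := by
  intro y hy
  obtain ⟨x, rfl⟩ := mem_Kb.1 hy
  exact g.commutes x
theorem rs_pw {Z : Subgroup (GalL ℓ K)} {g h : Z} {c : ℤ_[ℓ]} (H : Tendsto (fun m => g ^ c.appr m) atTop (𝓝 h)) :
    IsPw (rs ℓ k K g) c (rs ℓ k K h) := IsPw.of fun z n _ => by
  obtain ⟨e, he, h1⟩ := lim_pw H z n
  refine ⟨e, he, ?_⟩
  rw [← map_pow]; exact h1
noncomputable def phi (k l : Type*) [Field k] [Algebra k K] [Field l] [Algebra l L] {Z : Subgroup (GalL ℓ K)} {Z₁ : Subgroup (GalL ℓ L)} (e : Z ≃* Z₁) : Z.map (rs ℓ k K) ≃* Z₁.map (rs ℓ l L) :=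
  (Z.equivMapOfInjective (rs ℓ k K) rs_inj).symm.trans (e.trans (Z₁.equivMapOfInjective (rs ℓ l L) rs_inj))
theorem phi_apply {Z : Subgroup (GalL ℓ K)} {Z₁ : Subgroup (GalL ℓ L)} (e : Z ≃* Z₁) (g : Z) (h : rs ℓ k K g ∈ Z.map (rs ℓ k K)) :
    (phi k l e ⟨rs ℓ k K g, h⟩ : proL ℓ L ≃ₐ[l] proL ℓ L) = rs ℓ l L (e g) := by
  have : (Z.equivMapOfInjective (rs ℓ k K) rs_inj).symm ⟨rs ℓ k K g, h⟩ = g := by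
    rw [MulEquiv.symm_apply_eq]; exact Subtype.ext rfl
  simp only [phi, MulEquiv.trans_apply, this]; rfl
theorem mkPx (hc : Cx ℓ (proL ℓ K) ζ) (hd : Cx ℓ (proL ℓ L) ξ) {r : ℕ} {O₁ : ValuationSubring (proL ℓ L)} (H : Wx hd (Kb ℓ l L) O₁ r)
    {Z : Subgroup (GalL ℓ K)} (hZ : IsClosed (Z : Set (GalL ℓ K))) {Z₁ : Subgroup (GalL ℓ L)} (hZ₁ : Z₁ = decompSubgroup O₁)
    (e : Z ≃* Z₁) (he : Continuous e) : Px hd (Kb ℓ k K) (Z.map (rs ℓ k K)) (Kb ℓ l L) O₁ r (phi k l e) := by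
  subst hZ₁
  refine ⟨proL_gx hc, ?_, H, fun g => ⟨?_, ?_⟩, ?_⟩
  · rintro _ ⟨g, -, rfl⟩; exact rs_fix g
  · rintro ⟨g, hg, rfl⟩; exact ⟨hg, rs_fix g⟩
  · rintro ⟨h1, h2⟩; exact ⟨toK g h2, h1, AlgEquiv.ext fun x => rfl⟩
  · rintro ⟨_, g, hg, rfl⟩ c
    obtain ⟨h, hh⟩ := ex_lim hZ ⟨g, hg⟩ c
    refine ⟨⟨rs ℓ k K h, h, h.2, rfl⟩, rs_pw hh, ?_⟩
    have h1 := (he.tendsto h).comp hh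
    simp only [Function.comp_def, map_pow] at h1
    have h2 := rs_pw (k := l) h1
    rw [← phi_apply (k := k) e ⟨g, hg⟩ ⟨g, hg, rfl⟩, ← phi_apply (k := k) e h ⟨h, h.2, rfl⟩] at h2
    exact h2
end Q
end S5
open Filter Topology
namespace S5
section Y
variable {ℓ : ℕ} [hℓ : Fact ℓ.Prime] {k K : Type*} [Field k] [Field K] [Algebra k K] {ζ : ℕ → k}
  {l L : Type*} [Field l] [Field L] [Algebra l L] {ξ : ℕ → l}
theorem cl_pt {E F : Type*} [Field E] [Field F] [Algebra F E] [Algebra.IsAlgebraic F E] (z : E) (P : E → Prop) :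
    IsClosed {σ : E ≃ₐ[F] E | P (σ z)} := by
  rw [← isOpen_compl_iff, isOpen_iff_mem_nhds]
  intro σ hσ
  filter_upwards [ev_nhds σ z] with τ hτ
  simpa [hτ] using hσ
theorem cl_in {E F : Type*} [Field E] [Field F] [Algebra F E] [Algebra.IsAlgebraic F E] (O : ValuationSubring E) :
    IsClosed (inertiaSubgroup (F := F) O : Set (E ≃ₐ[F] E)) := by
  have : (inertiaSubgroup (F := F) O : Set (E ≃ₐ[F] E)) = ⋂ x : E, {σ | (σ x ∈ O ↔ x ∈ O) ∧ (x ∈ O → O.valuation (σ x - x) < 1)} := by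
    ext σ
    simp only [Set.mem_iInter, Set.mem_setOf_eq]
    exact ⟨fun h x => ⟨h.1 x, h.2 x⟩, fun h => ⟨fun x => (h x).1, fun x => (h x).2⟩⟩
  rw [this]
  exact isClosed_iInter fun x => cl_pt x fun y => (y ∈ O ↔ x ∈ O) ∧ (x ∈ O → O.valuation (y - x) < 1)
theorem rch (p : ℕ) [CharP k p] (hpl : p ≠ ℓ) (hc : Cx ℓ (proL ℓ K) ζ) (O : ValuationSubring (proL ℓ K)) :
    ringChar (IsLocalRing.ResidueField O) ≠ ℓ := by
  letI := rAlg (hc.kmem O)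
  haveI := charP_of_injective_algebraMap (algebraMap k (IsLocalRing.ResidueField O)).injective p
  rw [ringChar.eq (IsLocalRing.ResidueField O) p]; exact hpl
theorem fin_main {p q : ℕ} [Fact p.Prime] [Fact q.Prime] (hpl : p ≠ ℓ) (hql : q ≠ ℓ) [IsAlgClosed k] [CharP k p] [IsAlgClosed l] [CharP l q]
    (hk : Algebra.IsAlgebraic (⊥ : Subfield k) k) (hl : Algebra.IsAlgebraic (⊥ : Subfield l) l)
    (hK : (⊤ : IntermediateField k K).FG) (hL : (⊤ : IntermediateField l L).FG) {r : ℕ} (hr : 1 ≤ r)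
    (tK : Algebra.trdeg k K = (r + 1 : ℕ)) (tL : Algebra.trdeg l L = (r + 1 : ℕ))
    (Z : Subgroup (GalL ℓ K)) (hclosed : IsClosed (Z : Set (GalL ℓ K))) (Z₁ : Subgroup (GalL ℓ L))
    (hdiv : IsDivisorialSubgroup ℓ l L Z₁) (e : Z ≃* Z₁) (he : Continuous e) :
    (∃! O' : ValuationSubring ↥(proL ℓ K),
      IsZPD k (O'.comap (algebraMap K ↥(proL ℓ K))) ∧
      Z ≤ decompSubgroup O' ∧
      ringChar (IsLocalRing.ResidueField ↥O') ≠ ℓ) ∧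
    (∀ O' : ValuationSubring ↥(proL ℓ K),
      IsZPD k (O'.comap (algebraMap K ↥(proL ℓ K))) →
      Z ≤ decompSubgroup O' →
      ringChar (IsLocalRing.ResidueField ↥O') ≠ ℓ →
      ((IsClosed ((Z ⊓ inertiaSubgroup O' : Subgroup (GalL ℓ K)) : Set (GalL ℓ K)) ∧
          Z ⊓ inertiaSubgroup O' ≤ Z ∧
          (∀ a ∈ Z ⊓ inertiaSubgroup (F := K) O', ∀ b ∈ Z ⊓ inertiaSubgroup (F := K) O',
            a * b = b * a) ∧
          (∀ z ∈ Z, ∀ t ∈ Z ⊓ inertiaSubgroup (F := K) O',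
            z * t * z⁻¹ ∈ Z ⊓ inertiaSubgroup (F := K) O')) ∧
        ∀ T : Subgroup (GalL ℓ K), IsClosed (T : Set (GalL ℓ K)) → T ≤ Z →
          (∀ a ∈ T, ∀ b ∈ T, a * b = b * a) →
          (∀ z ∈ Z, ∀ t ∈ T, z * t * z⁻¹ ∈ T) →
          T ≤ Z ⊓ inertiaSubgroup O')) := by
  obtain ⟨ζ, hc⟩ := proL_cx (ℓ := ℓ) (K := K) p hpl hk
  obtain ⟨ξ, hd⟩ := proL_cx (ℓ := ℓ) (K := L) q hql hl
  obtain ⟨O₁, hO₁, hZ₁⟩ := hdiv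
  have H := Wx.of_zpd hd hL tL hr hO₁
  have P := mkPx (k := k) hc hd H hclosed hZ₁ e he
  have F := proL_fx (ℓ := ℓ) hK tK
  have pl : ∀ a : GalL ℓ K, PL ℓ (rs ℓ k K a) := fun a => (proL_gx hc).pl _ (rs_fix a)
  have B : ∀ t : Z, rs ℓ l L (e t) ∈ inertiaSubgroup O₁ → t ≠ 1 →
      ∃ U : ValuationSubring (proL ℓ K), (t : GalL ℓ K) ∈ inertiaSubgroup U ∧ Z ≤ decompSubgroup U ∧ Wx hc (Kb ℓ k K) U r := fun t ht ht1 => by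
    obtain ⟨U, h1, h2, h3⟩ := P.B3 hc p F (t := ⟨rs ℓ k K t, t, t.2, rfl⟩) (by
      have h0 := ht
      rw [← phi_apply (k := k) (l := l) e t ⟨t, t.2, rfl⟩] at h0; exact h0) (fun h => ht1 (by
      have : rs ℓ k K t = rs ℓ k K 1 := (congrArg Subtype.val h).trans (map_one _).symm
      exact Subtype.ext (rs_inj this)))
    exact ⟨U, h1, fun g hg => h2 ⟨g, hg, rfl⟩, h3⟩
  have un : ∀ O O' : ValuationSubring (proL ℓ K), Wx hc (Kb ℓ k K) O r → Wx hc (Kb ℓ k K) O' r → Z ≤ decompSubgroup O → Z ≤ decompSubgroup O' →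
      ∀ t : Z, t ≠ 1 → O = O' := fun O O' h h' hO hO' t ht =>
    h.uniq hc h' (t := rs ℓ k K t) (hO t.2) (hO' t.2) (rs_fix _) (fun h => ht (Subtype.ext (rs_inj (h.trans (map_one _).symm))))
  obtain ⟨t, ht, ht1⟩ : ∃ t : Z, rs ℓ l L (e t) ∈ inertiaSubgroup O₁ ∧ t ≠ 1 := by
    obtain ⟨s, h1, h2, h3⟩ := H.A0 hd
    have hs : toK s h2 ∈ Z₁ := by rw [hZ₁]; exact T_le_Z h1
    refine ⟨e.symm ⟨toK s h2, hs⟩, ?_, fun h => h3 ?_⟩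
    · rw [e.apply_symm_apply]; exact h1
    · rw [e.symm_apply_eq, map_one] at h
      have h4 : toK s h2 = 1 := congrArg Subtype.val h
      exact AlgEquiv.ext fun x => congrArg (fun σ : GalL ℓ L => σ x) h4
  obtain ⟨U, -, hU2, hU3⟩ := B t ht ht1
  refine ⟨⟨U, ⟨hU3.zpd hc tK, hU2, rch p hpl hc U⟩, fun O' h => un _ _ (Wx.of_zpd hc hK tK hr h.1) hU3 h.2.1 hU2 t ht1⟩, fun O' h1 h2 _ => ?_⟩
  have H' := Wx.of_zpd hc hK tK hr h1
  have com : ∀ z ∈ Z, ∀ t ∈ Z ⊓ inertiaSubgroup (F := K) O', z * t = t * z := fun z hz t ht => by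
    refine rs_inj (k := k) ?_
    rw [map_mul, map_mul]
    refine hc.E (O := O') (s := rs ℓ k K t) (g := rs ℓ k K z) ht.2 (h2 hz) (pl _) (pl _) ?_
    have := pl (t⁻¹ * (z * t * z⁻¹))
    simpa only [map_mul, map_inv] using this
  refine ⟨⟨hclosed.inter (cl_in O'), inf_le_left, fun a ha b hb => com a ha.1 b hb, fun z hz t ht => ?_⟩, fun T _ hT hab hn t ht => ⟨hT ht, ?_⟩⟩
  · rwa [com z hz t ht, mul_inv_cancel_right]
  · by_cases h1 : t = 1
    · rw [h1]; exact one_mem _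
    have key : ∀ a ∈ (((T.subgroupOf Z).map e.toMonoidHom).map Z₁.subtype).map (rs ℓ l L), a ∈ inertiaSubgroup O₁ := by
      refine H.A3 hd ?_ ?_ ?_ ?_
      · rintro _ ⟨_, ⟨b, -, rfl⟩, rfl⟩
        exact hZ₁.le b.2
      · rintro _ ⟨a, -, rfl⟩; exact rs_fix a
      · rintro _ ⟨_, ⟨_, ⟨a, ha, rfl⟩, rfl⟩, rfl⟩ _ ⟨_, ⟨_, ⟨b, hb, rfl⟩, rfl⟩, rfl⟩
        have : a * b = b * a := Subtype.ext (hab _ ha _ hb)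
        simpa only [map_mul] using congrArg (fun x => rs ℓ l L (Z₁.subtype (e.toMonoidHom x))) this
      · rintro g hg hg2 _ ⟨_, ⟨_, ⟨a, ha, rfl⟩, rfl⟩, rfl⟩
        have hs : toK g hg2 ∈ Z₁ := by rw [hZ₁]; exact hg
        set b := e.symm ⟨toK g hg2, hs⟩ with hb
        have hb' : rs ℓ l L (Z₁.subtype (e.toMonoidHom b)) = g := by
          have : e.toMonoidHom b = ⟨toK g hg2, hs⟩ := e.apply_symm_apply _
          rw [this]; exact AlgEquiv.ext fun x => rfl
        refine ⟨_, ⟨_, ⟨b * a * b⁻¹, hn b b.2 a ha, rfl⟩, rfl⟩, ?_⟩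
        simp only [map_mul, map_inv, hb']
    obtain ⟨V, hV1, hV2, hV3⟩ := B ⟨t, hT ht⟩ (key _ ⟨_, ⟨_, ⟨⟨t, hT ht⟩, ht, rfl⟩, rfl⟩, rfl⟩) (fun h => h1 (congrArg Subtype.val h))
    rw [← un V O' hV3 H' hV2 h2 ⟨t, hT ht⟩ (fun h => h1 (congrArg Subtype.val h))]
    exact hV1
end Y
end S5
/-- A divisorial like subgroup `Z` of `G^ℓ_K` lies in the decomposition group
`Z_v` of a unique Zariski prime divisor `v` of `K^ℓ` with residue characteristic `≠ ℓ`;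
moreover the unique maximal closed abelian normal subgroup of `Z` is `Z ∩ T_v`. -/
theorem statement5.{u} (ℓ p : ℕ) [Fact ℓ.Prime] [Fact p.Prime] (hpℓ : p ≠ ℓ)
    (k K : Type*) [Field k] [Field K] [Algebra k K]
    [IsAlgClosed k] [CharP k p] (hkfin : Algebra.IsAlgebraic (⊥ : Subfield k) k)
    (hKfg : (⊤ : IntermediateField k K).FG) (htd : 1 < trdeg k K)
    (Z : Subgroup (GalL ℓ K)) (hclosed : IsClosed (Z : Set (GalL ℓ K)))
    (hlike : Nonempty (DivisorialLikeWitness.{u} ℓ ↥Z (trdeg k K))) :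
    -- (1) existence and uniqueness of the Zariski prime divisor of `K^ℓ`
    (∃! O' : ValuationSubring ↥(proL ℓ K),
      IsZPD k (O'.comap (algebraMap K ↥(proL ℓ K))) ∧
      Z ≤ decompSubgroup O' ∧
      ringChar (IsLocalRing.ResidueField ↥O') ≠ ℓ) ∧
    -- (2) for the divisor from (1), `Z ⊓ T_v` is the unique maximal closed abelian
    -- subgroup of `Z` normalized by `Z`
    (∀ O' : ValuationSubring ↥(proL ℓ K),
      IsZPD k (O'.comap (algebraMap K ↥(proL ℓ K))) →
      Z ≤ decompSubgroup O' →
      ringChar (IsLocalRing.ResidueField ↥O') ≠ ℓ →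
      ((IsClosed ((Z ⊓ inertiaSubgroup O' : Subgroup (GalL ℓ K)) : Set (GalL ℓ K)) ∧
          Z ⊓ inertiaSubgroup O' ≤ Z ∧
          (∀ a ∈ Z ⊓ inertiaSubgroup (F := K) O', ∀ b ∈ Z ⊓ inertiaSubgroup (F := K) O',
            a * b = b * a) ∧
          (∀ z ∈ Z, ∀ t ∈ Z ⊓ inertiaSubgroup (F := K) O',
            z * t * z⁻¹ ∈ Z ⊓ inertiaSubgroup (F := K) O')) ∧
        ∀ T : Subgroup (GalL ℓ K), IsClosed (T : Set (GalL ℓ K)) → T ≤ Z →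
          (∀ a ∈ T, ∀ b ∈ T, a * b = b * a) →
          (∀ z ∈ Z, ∀ t ∈ T, z * t * z⁻¹ ∈ T) →
          T ≤ Z ⊓ inertiaSubgroup O')) := by
  obtain ⟨W⟩ := hlike
  letI := W.field_k₁
  letI := W.field_K₁
  letI := W.alg
  haveI := W.algClosed
  haveI := W.charP
  haveI : Fact W.p₁.Prime := ⟨W.p₁_prime⟩
  obtain ⟨n, hn⟩ := S5.td_nat hKfg
  have h1 : 1 < n := by
    have h : 1 < Algebra.trdeg k K := htd
    rw [hn] at h
    exact_mod_cast h
  obtain ⟨r, rfl⟩ : ∃ r, n = r + 1 := ⟨n - 1, by omega⟩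
  have tL : Algebra.trdeg W.k₁ W.K₁ = ((r + 1 : ℕ) : Cardinal) := by
    have h := W.td
    change Cardinal.lift (Algebra.trdeg W.k₁ W.K₁) = Cardinal.lift (Algebra.trdeg k K) at h
    rw [hn, Cardinal.lift_natCast] at h
    exact Cardinal.lift_eq_nat_iff.1 h
  exact S5.fin_main hpℓ W.p₁_ne hkfin W.over_finite hKfg W.fg (by omega) hn tL Z hclosed W.Z₁ W.divisorial W.e W.cont
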